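/- arXiv:2507.19019 — 3 statements merged into one kernel-verified Lean document; each statement's English description precedes it below -/
import Mathlib

section
/- Let M be a nonzero finitely generated R-module and let d be a natural number equal to the Krull dimension of the ring R/Ann_R(M). Then the cohomological dimension of M ⊗_R S with respect to the ideal mS equals d; that is, the local cohomology module H^d_{mS}(M ⊗_R S) is nonzero, and H^i_{mS}(M ⊗_R S) = 0 for every integer i > d. -/
open IsLocalRing TensorProduct

universe u

section

open CategoryTheory Abelian

namespace ExtLocalCohomology

section Defs

variable {A : Type u} [CommRing A] (J : Ideal A)

/-- The module `A ⧸ J ^ t`. -/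
abbrev quotPow (t : ℕ) : ModuleCat.{u} A := ModuleCat.of A (A ⧸ J ^ t)

/-- The canonical surjection `A ⧸ J ^ t ⟶ A ⧸ J ^ s` for `s ≤ t`. -/
def quotPowMap {s t : ℕ} (h : s ≤ t) : quotPow J t ⟶ quotPow J s :=
  ModuleCat.ofHom (Submodule.factor (Ideal.pow_le_pow_right h))

lemma quotPowMap_refl (t : ℕ) : quotPowMap J (le_refl t) = 𝟙 _ := by
  ext
  rfl

lemma quotPowMap_comp {r s t : ℕ} (h : r ≤ s) (h' : s ≤ t) :
    quotPowMap J h' ≫ quotPowMap J h = quotPowMap J (h.trans h') := by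
  ext
  rfl

/-- The transition maps `Ext^i(A ⧸ J ^ s, N) → Ext^i(A ⧸ J ^ t, N)` for `s ≤ t`. -/
noncomputable def transition (i : ℕ) (N : ModuleCat.{u} A) (s t : ℕ) (h : s ≤ t) :
    Ext (quotPow J s) N i →ₗ[A] Ext (quotPow J t) N i :=
  (Ext.mk₀ (quotPowMap J h)).precompOfLinear A N (zero_add i)

@[simp]
lemma transition_apply (i : ℕ) (N : ModuleCat.{u} A) (s t : ℕ) (h : s ≤ t)
    (x : Ext (quotPow J s) N i) :
    transition J i N s t h x = (Ext.mk₀ (quotPowMap J h)).comp x (zero_add i) := rfl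

instance (i : ℕ) (N : ModuleCat.{u} A) :
    DirectedSystem (fun t ↦ Ext (quotPow J t) N i) (fun s t h ↦ transition J i N s t h) where
  map_self _ x := by simp [quotPowMap_refl]
  map_map r s t h h' x := by
    simp only [transition_apply]
    rw [← quotPowMap_comp J h h', ← Ext.mk₀_comp_mk₀, Ext.comp_assoc_of_second_deg_zero]

/-- The direct limit of the modules `Ext^i(A ⧸ J ^ t, N)`. -/
abbrev LC (i : ℕ) (N : ModuleCat.{u} A) : Type u :=
  Module.DirectLimit (fun t ↦ Ext (quotPow J t) N i) (transition J i N)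

variable {J}

/-- The map from a term of the direct system to the direct limit. -/
noncomputable abbrev LC.of {i : ℕ} {N : ModuleCat.{u} A} (t : ℕ) :
    Ext (quotPow J t) N i →ₗ[A] LC J i N :=
  Module.DirectLimit.of A ℕ (fun t ↦ Ext (quotPow J t) N i) (transition J i N) t

lemma LC.exists_of {i : ℕ} {N : ModuleCat.{u} A} (x : LC J i N) : ∃ t ξ, LC.of t ξ = x :=
  Module.DirectLimit.exists_of x

lemma LC.of_eq_zero_iff {i : ℕ} {N : ModuleCat.{u} A} {t : ℕ} (ξ : Ext (quotPow J t) N i) :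
    (LC.of t ξ : LC J i N) = 0 ↔
      ∃ (s : ℕ) (h : t ≤ s), (Ext.mk₀ (quotPowMap J h)).comp ξ (zero_add i) = 0 := by
  constructor
  · intro h
    obtain ⟨s, hs, h⟩ := Module.DirectLimit.of.zero_exact h
    exact ⟨s, hs, h⟩
  · rintro ⟨s, hs, h⟩
    rw [LC.of, ← Module.DirectLimit.of_f (hij := hs), transition_apply, h, map_zero]

lemma LC.of_transition {i : ℕ} {N : ModuleCat.{u} A} {s t : ℕ} (h : s ≤ t)
    (ξ : Ext (quotPow J s) N i) :
    (LC.of t ((Ext.mk₀ (quotPowMap J h)).comp ξ (zero_add i)) : LC J i N) = LC.of s ξ :=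
  Module.DirectLimit.of_f (f := transition J i N) (hij := h)

lemma LC.subsingleton_iff {i : ℕ} {N : ModuleCat.{u} A} :
    Subsingleton (LC J i N) ↔ ∀ (t : ℕ) (ξ : Ext (quotPow J t) N i),
      ∃ (s : ℕ) (h : t ≤ s), (Ext.mk₀ (quotPowMap J h)).comp ξ (zero_add i) = 0 := by
  constructor
  · intro _ t ξ
    exact (LC.of_eq_zero_iff ξ).1 (Subsingleton.elim _ _)
  · intro h
    refine subsingleton_of_forall_eq 0 fun x ↦ ?_
    obtain ⟨t, ξ, rfl⟩ := LC.exists_of x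
    exact (LC.of_eq_zero_iff ξ).2 (h t ξ)

/-- Postcomposition with an `Ext`-class. -/
noncomputable def LC.postcomp {i a j : ℕ} {N N' : ModuleCat.{u} A} (α : Ext N N' a)
    (h : i + a = j) : LC J i N →ₗ[A] LC J j N' :=
  Module.DirectLimit.map (fun _ ↦ α.postcompOfLinear A _ h) fun s t hst ↦ by
    ext x
    simp only [LinearMap.comp_apply, transition_apply, Ext.postcompOfLinear,
      LinearMap.flip_apply, Ext.bilinearCompOfLinear_apply_apply]
    rw [Ext.comp_assoc _ _ _ (zero_add i) h (by lia)]

@[simp]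
lemma LC.postcomp_of {i a j : ℕ} {N N' : ModuleCat.{u} A} (α : Ext N N' a)
    (h : i + a = j) (t : ℕ) (ξ : Ext (quotPow J t) N i) :
    LC.postcomp (J := J) α h (LC.of t ξ) = LC.of t (ξ.comp α h) := by
  simp [LC.postcomp, LC.of]

lemma LC.postcomp_smul_id (i : ℕ) (N : ModuleCat.{u} A) (r : A) (x : LC J i N) :
    LC.postcomp (Ext.mk₀ (r • 𝟙 N)) (add_zero i) x = r • x := by
  obtain ⟨t, ξ, rfl⟩ := LC.exists_of x
  rw [LC.postcomp_of, ← Ext.smul_eq_comp_mk₀, map_smul]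

/-- The map induced on direct limits of `Ext` by a morphism. -/
noncomputable abbrev LC.map (i : ℕ) {N N' : ModuleCat.{u} A} (f : N ⟶ N') :
    LC J i N →ₗ[A] LC J i N' := LC.postcomp (Ext.mk₀ f) (add_zero i)

variable {S : ShortComplex (ModuleCat.{u} A)} (hS : S.ShortExact)

/-- The connecting map. -/
noncomputable abbrev LC.δ {i j : ℕ} (h : i + 1 = j) : LC J i S.X₃ →ₗ[A] LC J j S.X₁ :=
  LC.postcomp hS.extClass h

include hS in
lemma LC.exact₂ (i : ℕ) : Function.Exact (LC.map (J := J) i S.f) (LC.map i S.g) := by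
  intro x
  constructor
  · intro hx
    obtain ⟨t, ξ, rfl⟩ := LC.exists_of x
    rw [LC.postcomp_of, LC.of_eq_zero_iff] at hx
    obtain ⟨s, hs, hx⟩ := hx
    rw [← Ext.comp_assoc _ _ _ (zero_add _) (by lia) (by lia)] at hx
    obtain ⟨η, hη⟩ := Ext.covariant_sequence_exact₂ _ hS _ hx
    exact ⟨LC.of s η, by rw [LC.postcomp_of, hη, LC.of_transition]⟩
  · rintro ⟨y, rfl⟩
    obtain ⟨t, ξ, rfl⟩ := LC.exists_of y
    rw [LC.postcomp_of, LC.postcomp_of, Ext.comp_assoc_of_second_deg_zero, Ext.mk₀_comp_mk₀,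
      S.zero, Ext.mk₀_zero, Ext.comp_zero, map_zero]

lemma LC.exact₁ {i j : ℕ} (h : i + 1 = j) :
    Function.Exact (LC.δ (J := J) hS h) (LC.map j S.f) := by
  intro x
  constructor
  · intro hx
    obtain ⟨t, ξ, rfl⟩ := LC.exists_of x
    rw [LC.postcomp_of, LC.of_eq_zero_iff] at hx
    obtain ⟨s, hs, hx⟩ := hx
    rw [← Ext.comp_assoc _ _ _ (zero_add _) (by lia) (by lia)] at hx
    obtain ⟨η, hη⟩ := Ext.covariant_sequence_exact₁ _ hS _ hx h
    exact ⟨LC.of s η, by rw [LC.postcomp_of, hη, LC.of_transition]⟩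
  · rintro ⟨y, rfl⟩
    obtain ⟨t, ξ, rfl⟩ := LC.exists_of y
    rw [LC.postcomp_of, LC.postcomp_of, Ext.comp_assoc _ _ _ h (add_zero _) (by lia),
      hS.extClass_comp, Ext.comp_zero, map_zero]

lemma LC.exact₃ {i j : ℕ} (h : i + 1 = j) :
    Function.Exact (LC.map (J := J) i S.g) (LC.δ hS h) := by
  intro x
  constructor
  · intro hx
    obtain ⟨t, ξ, rfl⟩ := LC.exists_of x
    rw [LC.postcomp_of, LC.of_eq_zero_iff] at hx
    obtain ⟨s, hs, hx⟩ := hx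
    rw [← Ext.comp_assoc _ _ _ (zero_add _) (by lia) (by lia)] at hx
    obtain ⟨η, hη⟩ := Ext.covariant_sequence_exact₃ _ hS _ h hx
    exact ⟨LC.of s η, by rw [LC.postcomp_of, hη, LC.of_transition]⟩
  · rintro ⟨y, rfl⟩
    obtain ⟨t, ξ, rfl⟩ := LC.exists_of y
    rw [LC.postcomp_of, LC.postcomp_of, Ext.comp_assoc _ _ _ (add_zero _) (zero_add _) (by lia),
      hS.comp_extClass, Ext.comp_zero, map_zero]

/-- Every element of the direct limit is killed by a power of `J`. -/
lemma LC.exists_pow_smul_eq_zero {i : ℕ} {N : ModuleCat.{u} A} (x : LC J i N) :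
    ∃ k : ℕ, ∀ a ∈ J ^ k, a • x = 0 := by
  obtain ⟨t, ξ, rfl⟩ := LC.exists_of x
  refine ⟨t, fun a ha ↦ ?_⟩
  have h : a • 𝟙 (quotPow J t) = 0 := by
    refine ModuleCat.hom_ext (LinearMap.ext fun x ↦ ?_)
    obtain ⟨x, rfl⟩ := Submodule.Quotient.mk_surjective _ x
    exact (Submodule.Quotient.mk_eq_zero _).2 (Ideal.mul_mem_right _ _ ha)
  have : a • ξ = 0 := by
    rw [← Ext.mk₀_id_comp ξ, ← Ext.smul_comp, ← Ext.mk₀_smul, h, Ext.mk₀_zero, Ext.zero_comp]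
  rw [← map_smul, this, map_zero]

lemma LC.subsingleton_of_subsingleton (i : ℕ) (N : ModuleCat.{u} A) [Subsingleton N] :
    Subsingleton (LC J i N) := by
  refine LC.subsingleton_iff.2 fun t ξ ↦ ⟨t, le_rfl, ?_⟩
  have : 𝟙 N = 0 := ModuleCat.hom_ext (LinearMap.ext fun x ↦ Subsingleton.elim _ _)
  rw [← Ext.comp_mk₀_id ξ, this, Ext.mk₀_zero, Ext.comp_zero, Ext.comp_zero]

/-- Evaluation at `1` of a morphism out of `A ⧸ J ^ t`. -/
noncomputable def evalOne (N : ModuleCat.{u} A) (t : ℕ) : Ext (quotPow J t) N 0 →ₗ[A] N :=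
  (LinearMap.applyₗ (Submodule.Quotient.mk (1 : A))).comp
    ((ModuleCat.homLinearEquiv (S := A) (M := quotPow J t) (N := N)).toLinearMap.comp
      (Ext.linearEquiv₀ (R := A)).toLinearMap)

lemma evalOne_mk₀ (N : ModuleCat.{u} A) (t : ℕ) (f : quotPow J t ⟶ N) :
    evalOne N t (Ext.mk₀ f) = f.hom (Submodule.Quotient.mk 1) := by
  obtain ⟨f', hf⟩ : ∃ f', Ext.linearEquiv₀ (R := A) (Ext.mk₀ f) = f' := ⟨_, rfl⟩
  have := Ext.mk₀_linearEquiv₀_apply (R := A) (Ext.mk₀ f)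
  have h2 := (Ext.mk₀_bijective _ _).1 this
  conv_rhs => rw [← h2]
  rfl

/-- The direct limit in degree zero embeds into `N`. -/
noncomputable def LC.eval (N : ModuleCat.{u} A) : LC J 0 N →ₗ[A] N :=
  Module.DirectLimit.lift A ℕ (fun t ↦ Ext (quotPow J t) N 0) (transition J 0 N)
    (evalOne N) fun s t hst x ↦ by
      obtain ⟨f, rfl⟩ := (Ext.mk₀_bijective _ _).2 x
      rw [transition_apply, Ext.mk₀_comp_mk₀, evalOne_mk₀, evalOne_mk₀]
      rfl

lemma LC.eval_injective (N : ModuleCat.{u} A) : Function.Injective (LC.eval (J := J) N) := by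
  refine Module.DirectLimit.lift_injective _ _ fun t x y h ↦ ?_
  obtain ⟨f, rfl⟩ := (Ext.mk₀_bijective _ _).2 x
  obtain ⟨g, rfl⟩ := (Ext.mk₀_bijective _ _).2 y
  rw [evalOne_mk₀, evalOne_mk₀] at h
  congr 1
  refine ModuleCat.hom_ext (LinearMap.ext fun a ↦ ?_)
  obtain ⟨a, rfl⟩ := Submodule.Quotient.mk_surjective _ a
  have ha : (Submodule.Quotient.mk a : A ⧸ J ^ t) = a • Submodule.Quotient.mk 1 := by
    rw [← Submodule.Quotient.mk_smul, smul_eq_mul, mul_one]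
  rw [ha, map_smul, map_smul, h]

lemma LC.mem_range_eval {N : ModuleCat.{u} A} {n : N} {k : ℕ} (h : ∀ a ∈ J ^ k, a • n = 0) :
    n ∈ LinearMap.range (LC.eval (J := J) N) := by
  let f : quotPow J k ⟶ N := ModuleCat.ofHom
    (Submodule.liftQ (J ^ k) (LinearMap.toSpanSingleton A N n) fun a ha ↦ h a ha)
  refine ⟨LC.of k (Ext.mk₀ f), ?_⟩
  rw [LC.eval, LC.of, Module.DirectLimit.lift_of, evalOne_mk₀]
  exact (Submodule.liftQ_apply _ _ _).trans (one_smul _ _)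

lemma LC.bijective_eval {N : ModuleCat.{u} A} (h : ∀ n : N, ∃ k, ∀ a ∈ J ^ k, a • n = 0) :
    Function.Bijective (LC.eval (J := J) N) :=
  ⟨LC.eval_injective N, fun n ↦ (h n).elim fun _ hk ↦ LC.mem_range_eval hk⟩

end Defs

section BoundedTorsion

variable {A : Type u} [CommRing A]

lemma mk₀_comp_extClass_comp_eq_zero {Y Z F L : Type u} [AddCommGroup Y] [AddCommGroup Z]
    [AddCommGroup F] [AddCommGroup L] [Module A Y] [Module A Z] [Module A F] [Module A L]
    {q : Y →ₗ[A] Z} {p : F →ₗ[A] L} (hq : Function.Surjective q) (hp : Function.Surjective p)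
    (a : Y →ₗ[A] F) (b : Z →ₗ[A] L) (hab : ∀ y, p (a y) = b (q y)) (N : ModuleCat.{u} A)
    {i j : ℕ} (h : 1 + i = j) (η : Ext (ModuleCat.of A (LinearMap.ker p)) N i)
    (hη : ∀ g : LinearMap.ker q →ₗ[A] LinearMap.ker p, (∀ y, (g y : F) = a y) →
      (Ext.mk₀ (ModuleCat.ofHom g)).comp η (zero_add i) = 0) :
    (Ext.mk₀ (ModuleCat.ofHom b)).comp
      ((LinearMap.shortExact_shortComplexKer hp).extClass.comp η h) (zero_add j) = 0 := by
  let g : LinearMap.ker q →ₗ[A] LinearMap.ker p :=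
    (a.comp (LinearMap.ker q).subtype).codRestrict _ fun y ↦ by
      rw [LinearMap.mem_ker, LinearMap.comp_apply, hab, Submodule.subtype_apply, y.2, map_zero]
  let φ : q.shortComplexKer ⟶ p.shortComplexKer :=
    { τ₁ := ModuleCat.ofHom g
      τ₂ := ModuleCat.ofHom a
      τ₃ := ModuleCat.ofHom b
      comm₁₂ := rfl
      comm₂₃ := ModuleCat.hom_ext (LinearMap.ext hab) }
  have key := ShortComplex.ShortExact.extClass_naturality
    (LinearMap.shortExact_shortComplexKer hq) (LinearMap.shortExact_shortComplexKer hp) φ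
  have h₀ := hη g fun _ ↦ rfl
  rw [← Ext.comp_assoc _ _ _ (zero_add 1) h (by lia), ← key,
    Ext.comp_assoc _ _ _ (add_zero 1) (zero_add i) (by lia), h₀, Ext.comp_zero]

variable [IsNoetherianRing A] {J : Ideal A} {N : ModuleCat.{u} A} {k : ℕ}

lemma exists_pow_smul_comp_eq_zero (hN : ∀ a ∈ J ^ k, ∀ x : N, a • x = 0) (i : ℕ) :
    ∀ (L : Type u) [AddCommGroup L] [Module A L] [Module.Finite A L]
      (ξ : Ext (ModuleCat.of A L) N i), ∃ n : ℕ, ∀ (X : Type u) [AddCommGroup X] [Module A X]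
      (g : X →ₗ[A] L), LinearMap.range g ≤ J ^ n • (⊤ : Submodule A L) →
      (Ext.mk₀ (ModuleCat.ofHom g)).comp ξ (zero_add i) = 0 := by
  induction i with
  | zero =>
    intro L _ _ _ ξ
    obtain ⟨f, rfl⟩ := (Ext.mk₀_bijective _ _).2 ξ
    refine ⟨k, fun X _ _ g hg ↦ ?_⟩
    rw [Ext.mk₀_comp_mk₀]
    suffices h : ModuleCat.ofHom g ≫ f = 0 by rw [h, Ext.mk₀_zero]
    refine ModuleCat.hom_ext (LinearMap.ext fun x ↦ ?_)
    have hle : J ^ k • (⊤ : Submodule A L) ≤ LinearMap.ker f.hom :=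
      Submodule.smul_le.2 fun a ha y _ ↦ by
        rw [LinearMap.mem_ker, map_smul, hN a ha]
    exact hle (hg (LinearMap.mem_range_self g x))
  | succ i ih =>
    intro L _ _ _ ξ
    obtain ⟨F, _, _, _, _, p, hp⟩ := Module.exists_finite_presentation A L
    obtain ⟨η, rfl⟩ := Ext.contravariant_sequence_exact₃
      (LinearMap.shortExact_shortComplexKer hp) N ξ
      (Ext.eq_zero_of_projective (P := ModuleCat.of A F) _) (add_comm 1 i)
    obtain ⟨n₀, hn₀⟩ := ih (LinearMap.ker p) η
    obtain ⟨c, hc⟩ := Ideal.exists_pow_inf_eq_pow_smul J (LinearMap.ker p)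
    refine ⟨n₀ + c, fun X _ _ g hg ↦ ?_⟩
    let g' : X →ₗ[A] (J ^ (n₀ + c) • (⊤ : Submodule A L) : Submodule A L) :=
      g.codRestrict _ fun x ↦ hg (LinearMap.mem_range_self g x)
    have hg' : ModuleCat.ofHom g = ModuleCat.ofHom g' ≫ ModuleCat.ofHom (Submodule.subtype _) :=
      rfl
    rw [hg', ← Ext.mk₀_comp_mk₀, Ext.comp_assoc_of_second_deg_zero]
    suffices h : (Ext.mk₀ (ModuleCat.ofHom (Submodule.subtype
        (J ^ (n₀ + c) • (⊤ : Submodule A L))))).comp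
        ((LinearMap.shortExact_shortComplexKer hp).extClass.comp η (add_comm 1 i))
        (zero_add (i + 1)) = 0 by rw [h, Ext.comp_zero]
    have hmap : (J ^ (n₀ + c) • (⊤ : Submodule A F)).map p = J ^ (n₀ + c) • ⊤ := by
      rw [Submodule.map_smul'', Submodule.map_top, LinearMap.range_eq_top.2 hp]
    let q : (J ^ (n₀ + c) • (⊤ : Submodule A F) : Submodule A F) →ₗ[A]
        (J ^ (n₀ + c) • (⊤ : Submodule A L) : Submodule A L) :=
      p.restrict fun x hx ↦ hmap ▸ Submodule.mem_map_of_mem hx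
    refine mk₀_comp_extClass_comp_eq_zero (q := q) ?_ hp (Submodule.subtype _)
      (Submodule.subtype _) (fun _ ↦ rfl)
      N _ η ?_
    · rintro ⟨y, hy⟩
      obtain ⟨x, hx, rfl⟩ := hmap.symm ▸ hy
      exact ⟨⟨x, hx⟩, rfl⟩
    · intro f hf
      refine hn₀ _ f ?_
      rintro _ ⟨y, rfl⟩
      have hy : (f y : F) ∈ J ^ (n₀ + c) • (⊤ : Submodule A F) ⊓ LinearMap.ker p :=
        ⟨by rw [hf]; exact y.1.2, (f y).2⟩
      rw [hc _ (by lia), Nat.add_sub_cancel] at hy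
      have hle : J ^ n₀ • (J ^ c • (⊤ : Submodule A F) ⊓ LinearMap.ker p) ≤
          (J ^ n₀ • (⊤ : Submodule A (LinearMap.ker p))).map (Submodule.subtype _) := by
        rw [Submodule.map_smul'', Submodule.map_top, Submodule.range_subtype]
        exact Submodule.smul_mono le_rfl inf_le_right
      obtain ⟨z, hz, hzy⟩ := hle hy
      rwa [← Subtype.ext hzy]

/-- If `N` is killed by a power of `J`, then the direct limit of `Ext^i(A ⧸ J ^ t, N)` vanishes
for `i ≥ 1`. -/
lemma LC.subsingleton_of_pow_smul_eq_zero (hN : ∀ a ∈ J ^ k, ∀ x : N, a • x = 0) (i : ℕ) :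
    Subsingleton (LC J (i + 1) N) := by
  refine LC.subsingleton_iff.2 fun t ξ ↦ ?_
  have hp := (J ^ t).mkQ_surjective
  obtain ⟨η, rfl⟩ := Ext.contravariant_sequence_exact₃
    (LinearMap.shortExact_shortComplexKer hp) N ξ
    (Ext.eq_zero_of_projective (P := ModuleCat.of A A) _) (add_comm 1 i)
  obtain ⟨n, hn⟩ := exists_pow_smul_comp_eq_zero hN i _ η
  have hle : t ≤ t + n := by lia
  refine ⟨t + n, hle, mk₀_comp_extClass_comp_eq_zero (J ^ (t + n)).mkQ_surjective hp
    LinearMap.id _ (fun _ ↦ rfl) N _ η fun f hf ↦ hn _ f ?_⟩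
  rintro _ ⟨y, rfl⟩
  have hy : (f y : A) ∈ J ^ (t + n) := by
    rw [hf]
    exact (Submodule.ker_mkQ _).le y.2
  have hle : J ^ (t + n) ≤ (J ^ n • (⊤ : Submodule A (LinearMap.ker (J ^ t).mkQ))).map
      (Submodule.subtype _) := by
    rw [Submodule.map_smul'', Submodule.map_top, Submodule.range_subtype, Submodule.ker_mkQ,
      smul_eq_mul, add_comm, pow_add]
  obtain ⟨z, hz, hzy⟩ := hle hy
  rwa [← Subtype.ext hzy]

end BoundedTorsion

section Artinian

variable {R A : Type*} [CommRing R] [AddCommGroup A] [Module R A]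

/-- The elements of `s ^ k • B` killed by `s`. -/
def powSMulInfKer (s : R) (k : ℕ) (B : Submodule R A) : Submodule R (LinearMap.ker
    (LinearMap.lsmul R A s)) :=
  (B.map (LinearMap.lsmul R A (s ^ k))).comap (Submodule.subtype _)

lemma mem_powSMulInfKer {s : R} {k : ℕ} {B : Submodule R A} {x} :
    x ∈ powSMulInfKer s k B ↔ ∃ y ∈ B, s ^ k • y = x := Iff.rfl

lemma powSMulInfKer_mono (s : R) {k l : ℕ} (hkl : k ≤ l) {B C : Submodule R A} (h : B ≤ C) :
    powSMulInfKer s l B ≤ powSMulInfKer s k C := by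
  rintro x ⟨y, hy, hx⟩
  refine mem_powSMulInfKer.2 ⟨s ^ (l - k) • y, C.smul_mem _ (h hy), ?_⟩
  rw [smul_smul, ← pow_add, Nat.add_sub_cancel' hkl]
  exact hx

lemma le_of_powSMulInfKer_le {s : R} (hs : ∀ x : A, ∃ k : ℕ, s ^ k • x = 0) {B C : Submodule R A}
    (hCB : C ≤ B) (h : ∀ k, powSMulInfKer s k B ≤ powSMulInfKer s k C) : B ≤ C := by
  suffices H : ∀ (k : ℕ) (x : A), x ∈ B → s ^ k • x = 0 → x ∈ C from
    fun x hx ↦ (hs x).elim fun k hk ↦ H k x hx hk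
  intro k
  induction k with
  | zero =>
    intro x _ hx
    rw [pow_zero, one_smul] at hx
    exact hx ▸ C.zero_mem
  | succ k ih =>
    intro x hxB hx
    have hker : s ^ k • x ∈ LinearMap.ker (LinearMap.lsmul R A s) := by
      rw [LinearMap.mem_ker, LinearMap.lsmul_apply, smul_smul, ← pow_succ', hx]
    obtain ⟨y, hy, hxy⟩ := h k (x := ⟨_, hker⟩) (mem_powSMulInfKer.2 ⟨x, hxB, rfl⟩)
    have hxy' : s ^ k • y = s ^ k • x := hxy
    have := ih (x - y) (B.sub_mem hxB (hCB hy)) (by rw [smul_sub, hxy', sub_self])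
    simpa using C.add_mem this hy

/-- An `s`-power torsion module such that the kernel of multiplication by `s` is Artinian is
Artinian. -/
lemma isArtinian_of_isArtinian_ker {s : R} (hs : ∀ x : A, ∃ k : ℕ, s ^ k • x = 0)
    [IsArtinian R (LinearMap.ker (LinearMap.lsmul R A s))] : IsArtinian R A := by
  refine monotone_stabilizes_iff_artinian.1 fun f ↦ ?_
  have stab := monotone_stabilizes_iff_artinian.2
    (inferInstance : IsArtinian R (LinearMap.ker (LinearMap.lsmul R A s)))
  have hf : ∀ {i j : ℕ}, i ≤ j → (f j).ofDual ≤ (f i).ofDual := fun h ↦ f.monotone h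
  obtain ⟨n, hn⟩ := stab ⟨fun j ↦ OrderDual.toDual (powSMulInfKer s j (f j).ofDual),
    fun i j hij ↦ powSMulInfKer_mono s hij (hf hij)⟩
  choose g hg using fun k ↦ stab ⟨fun j ↦ OrderDual.toDual (powSMulInfKer s k (f j).ofDual),
    fun i j hij ↦ powSMulInfKer_mono s le_rfl (hf hij)⟩
  have hn' : ∀ j, n ≤ j →
      powSMulInfKer s n (f n).ofDual = powSMulInfKer s j (f j).ofDual := hn
  have hg' : ∀ k j, g k ≤ j →
      powSMulInfKer s k (f (g k)).ofDual = powSMulInfKer s k (f j).ofDual := hg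
  let N := n + (Finset.range n).sup g
  refine ⟨N, fun j hj ↦ le_antisymm (f.monotone hj) ?_⟩
  refine le_of_powSMulInfKer_le hs (hf hj) fun k ↦ ?_
  obtain hk | hk := lt_or_ge k n
  · have hgk : g k ≤ N := (Finset.le_sup (Finset.mem_range.2 hk)).trans (Nat.le_add_left _ _)
    exact ((hg' k N hgk).symm.trans (hg' k j (hgk.trans hj))).le
  · calc powSMulInfKer s k (f N).ofDual ≤ powSMulInfKer s n (f n).ofDual :=
          powSMulInfKer_mono s hk (hf (Nat.le_add_right _ _))
      _ = powSMulInfKer s (k + j) (f (k + j)).ofDual := hn' _ (by lia)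
      _ ≤ powSMulInfKer s k (f j).ofDual := powSMulInfKer_mono s (by lia) (hf (by lia))

lemma exists_finset_isPrime_of_submodule [IsNoetherianRing R] [IsArtinian R A] (m : Ideal R)
    (B : Submodule R A) :
    ∃ F : Finset (Ideal R), (∀ p ∈ F, p.IsPrime ∧ ¬ m ≤ p) ∧
      ∀ r : R, (∀ p ∈ F, r ∉ p) → ∃ k : ℕ, ∀ a ∈ m ^ k, ∀ x ∈ B, ∃ y ∈ B, a • x = r • y := by
  classical
  induction B using IsArtinian.induction with
  | hgt B ih =>
  by_cases hB : ∃ C D : Submodule R A, C < B ∧ D < B ∧ B ≤ C ⊔ D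
  · obtain ⟨C, D, hC, hD, hCD⟩ := hB
    obtain ⟨F, hF, hF'⟩ := ih C hC
    obtain ⟨G, hG, hG'⟩ := ih D hD
    refine ⟨F ∪ G, fun p hp ↦ (Finset.mem_union.1 hp).elim (hF p) (hG p), fun r hr ↦ ?_⟩
    obtain ⟨k, hk⟩ := hF' r fun p hp ↦ hr p (Finset.mem_union_left _ hp)
    obtain ⟨l, hl⟩ := hG' r fun p hp ↦ hr p (Finset.mem_union_right _ hp)
    refine ⟨k + l, fun a ha x hx ↦ ?_⟩
    obtain ⟨c, hc, d, hd, rfl⟩ := Submodule.mem_sup.1 (hCD hx)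
    obtain ⟨c', hc', h₁⟩ := hk a (Ideal.pow_le_pow_right (by lia) ha) c hc
    obtain ⟨d', hd', h₂⟩ := hl a (Ideal.pow_le_pow_right (by lia) ha) d hd
    exact ⟨c' + d', B.add_mem (hC.le hc') (hD.le hd'), by rw [smul_add, smul_add, h₁, h₂]⟩
  push Not at hB
  obtain rfl | hne := eq_or_ne B ⊥
  · refine ⟨∅, by simp, fun r _ ↦ ⟨0, fun a _ x hx ↦ ⟨0, zero_mem _, ?_⟩⟩⟩
    rw [(Submodule.mem_bot R).1 hx, smul_zero, smul_zero]
  have fitting (r : R) : (∀ x ∈ B, ∃ y ∈ B, x = r • y) ∨ ∃ n : ℕ, ∀ x ∈ B, r ^ n • x = 0 := by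
    have hle : ∀ {i j : ℕ}, i ≤ j → B.map (LinearMap.lsmul R A (r ^ j)) ≤
        B.map (LinearMap.lsmul R A (r ^ i)) := by
      rintro i j hij _ ⟨x, hx, rfl⟩
      refine ⟨r ^ (j - i) • x, B.smul_mem _ hx, ?_⟩
      rw [LinearMap.lsmul_apply, LinearMap.lsmul_apply, smul_smul, ← pow_add,
        Nat.add_sub_cancel' hij]
    obtain ⟨n, hn⟩ := monotone_stabilizes_iff_artinian.2 (inferInstanceAs (IsArtinian R A))
      ⟨fun j ↦ OrderDual.toDual (B.map (LinearMap.lsmul R A (r ^ (j + 1)))),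
        fun i j hij ↦ hle (Nat.add_le_add_right hij 1)⟩
    have hn' : B.map (LinearMap.lsmul R A (r ^ (n + 1))) =
      B.map (LinearMap.lsmul R A (r ^ (n + 1 + n + 1))) := hn (n + 1 + n) (by lia)
    let C := B.map (LinearMap.lsmul R A (r ^ (n + 1)))
    let D := B ⊓ LinearMap.ker (LinearMap.lsmul R A (r ^ (n + 1)))
    have hC : C ≤ B := by
      rintro _ ⟨x, hx, rfl⟩
      exact B.smul_mem _ hx
    have hsup : B ≤ C ⊔ D := by
      intro x hx
      have : r ^ (n + 1) • x ∈ B.map (LinearMap.lsmul R A (r ^ (n + 1 + n + 1))) :=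
        hn' ▸ ⟨x, hx, rfl⟩
      obtain ⟨y, hy, hxy⟩ := this
      refine Submodule.mem_sup.2 ⟨r ^ (n + 1) • y, ⟨y, hy, rfl⟩, x - r ^ (n + 1) • y,
        ⟨B.sub_mem hx (B.smul_mem _ hy), ?_⟩, by abel⟩
      rw [SetLike.mem_coe, LinearMap.mem_ker, LinearMap.lsmul_apply, smul_sub, smul_smul,
        ← pow_add, ← hxy, LinearMap.lsmul_apply, add_assoc (n + 1), sub_self]
    obtain hC' | hC' := hC.lt_or_eq
    · refine .inr ⟨n + 1, fun x hx ↦ ?_⟩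
      have hD : D = B := by
        by_contra h
        exact hB C D hC' (lt_of_le_of_ne inf_le_left h) hsup
      exact (hD.symm ▸ hx : x ∈ D).2
    · refine .inl fun x hx ↦ ?_
      obtain ⟨y, hy, rfl⟩ := hC'.symm ▸ hx
      exact ⟨r ^ n • y, B.smul_mem _ hy, by rw [smul_smul, ← pow_succ', LinearMap.lsmul_apply]⟩
  have hpow {r : R} (hr : ∀ x ∈ B, ∃ y ∈ B, x = r • y) (n : ℕ) :
      ∀ x ∈ B, ∃ y ∈ B, x = r ^ n • y := by
    induction n with
    | zero => exact fun x hx ↦ ⟨x, hx, by simp⟩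
    | succ n ih =>
      intro x hx
      obtain ⟨y, hy, rfl⟩ := ih x hx
      obtain ⟨z, hz, rfl⟩ := hr y hy
      exact ⟨z, hz, by rw [smul_smul, ← pow_succ]⟩
  have hdich {r : R} (hr : ∀ x ∈ B, ∃ y ∈ B, x = r • y) {n : ℕ} (hn : ∀ x ∈ B, r ^ n • x = 0) :
      False := by
    refine hne ((Submodule.eq_bot_iff B).2 fun x hx ↦ ?_)
    obtain ⟨y, hy, rfl⟩ := hpow hr n x hx
    exact hn y hy
  have hann {r : R} : r ∈ B.annihilator.radical ↔ ∃ n : ℕ, ∀ x ∈ B, r ^ n • x = 0 := by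
    simp_rw [Ideal.mem_radical_iff, Submodule.mem_annihilator]
  by_cases hm : m ≤ B.annihilator.radical
  · obtain ⟨k, hk⟩ := B.annihilator.exists_radical_pow_le_of_fg (IsNoetherian.noetherian _)
    refine ⟨∅, by simp, fun r _ ↦ ⟨k, fun a ha x hx ↦ ⟨0, B.zero_mem, ?_⟩⟩⟩
    rw [smul_zero, Submodule.mem_annihilator.1 (hk (Ideal.pow_right_mono hm k ha)) x hx]
  · refine ⟨{B.annihilator.radical}, ?_, fun r hr ↦ ⟨0, fun a _ x hx ↦ ?_⟩⟩
    · simp only [Finset.mem_singleton, forall_eq]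
      refine ⟨⟨fun h ↦ ?_, fun {a b} hab ↦ ?_⟩, hm⟩
      · obtain ⟨n, hn⟩ := hann.1 (h ▸ Submodule.mem_top (x := (1 : R)))
        exact hne ((Submodule.eq_bot_iff B).2 fun x hx ↦ by simpa using hn x hx)
      · by_contra! h
        rw [hann, hann] at h
        obtain ⟨n, hn⟩ := hann.1 hab
        refine hdich (fun x hx ↦ ?_) hn
        obtain ⟨y, hy, rfl⟩ := ((fitting a).resolve_right h.1) x hx
        obtain ⟨z, hz, rfl⟩ := ((fitting b).resolve_right h.2) y hy
        exact ⟨z, hz, smul_smul _ _ _⟩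
    · have hr' := hr _ (Finset.mem_singleton_self _)
      rw [hann] at hr'
      exact ((fitting r).resolve_right hr') (a • x) (B.smul_mem _ hx)

/-- For an Artinian module `A` there are finitely many primes not containing `m` such that, for
`r` outside of them, a power of `m` kills `A ⧸ r A`. -/
lemma exists_finset_isPrime [IsNoetherianRing R] [IsArtinian R A] (m : Ideal R) :
    ∃ F : Finset (Ideal R), (∀ p ∈ F, p.IsPrime ∧ ¬ m ≤ p) ∧
      ∀ r : R, (∀ p ∈ F, r ∉ p) → ∃ k : ℕ, ∀ a ∈ m ^ k, ∀ x : A, ∃ y, a • x = r • y := by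
  obtain ⟨F, hF, hF'⟩ := exists_finset_isPrime_of_submodule m (⊤ : Submodule R A)
  refine ⟨F, hF, fun r hr ↦ (hF' r hr).imp fun k hk a ha x ↦ ?_⟩
  obtain ⟨y, -, hy⟩ := hk a ha x trivial
  exact ⟨y, hy⟩

end Artinian

section Torsion

variable {R : Type*} [CommRing R] [IsNoetherianRing R]
  (M : Type*) [AddCommGroup M] [Module R M] [Module.Finite R M]

/-- The submodule of elements killed by a power of `m` is killed by a power of `m`. -/
lemma exists_torsion_submodule (m : Ideal R) : ∃ (Γ : Submodule R M) (k : ℕ),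
    (∀ a ∈ m ^ k, ∀ x ∈ Γ, a • x = 0) ∧
      ∀ (j : ℕ) (x : M), (∀ a ∈ m ^ j, a • x ∈ Γ) → x ∈ Γ := by
  obtain ⟨k, hk⟩ := monotone_stabilizes_iff_noetherian.2 (inferInstanceAs (IsNoetherian R M))
    ⟨fun j ↦ Submodule.torsionBySet R M (m ^ j : Ideal R),
      fun i j hij ↦ Submodule.torsionBySet_le_torsionBySet_pow i j hij m⟩
  refine ⟨Submodule.torsionBySet R M (m ^ k : Ideal R), k,
    fun a ha x hx ↦ (Submodule.mem_torsionBySet_iff _ _).1 hx ⟨a, ha⟩, fun j x hx ↦ ?_⟩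
  have hk' : Submodule.torsionBySet R M (m ^ k : Ideal R) =
    Submodule.torsionBySet R M (m ^ (k + j) : Ideal R) := hk (k + j) (by lia)
  rw [hk', Submodule.mem_torsionBySet_iff]
  rintro ⟨a, ha⟩
  rw [SetLike.mem_coe, pow_add] at ha
  change a • x = 0
  clear hk'
  refine Submodule.mul_induction_on ha (fun b hb c hc ↦ ?_) fun b c hb hc ↦ ?_
  · rw [mul_smul]
    exact (Submodule.mem_torsionBySet_iff _ _).1 (hx c hc) ⟨b, hb⟩
  · rw [add_smul, hb, hc, add_zero]

/-- Prime avoidance for the associated primes of `M` and finitely many further primes. -/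
lemma exists_isSMulRegular_avoiding [IsLocalRing R]
    (hM : ∀ x : M, (∀ a ∈ maximalIdeal R, a • x = 0) → x = 0)
    (F : Finset (Ideal R)) (hF : ∀ p ∈ F, p.IsPrime ∧ ¬ maximalIdeal R ≤ p) :
    ∃ r ∈ maximalIdeal R, IsSMulRegular M r ∧ ∀ p ∈ F, r ∉ p := by
  have hfin : (associatedPrimes R M ∪ F).Finite :=
    (associatedPrimes.finite R M).union F.finite_toSet
  have h := (maximalIdeal R).subset_union_prime_finite hfin (f := id) ⊥ ⊥ fun p hp _ _ ↦
    hp.elim (fun h ↦ h.isPrime) fun h ↦ (hF p h).1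
  have hnot : ¬ ((maximalIdeal R : Set R) ⊆ ⋃ p ∈ associatedPrimes R M ∪ F, (id p : Ideal R)) := by
    rw [h]
    rintro ⟨p, hp | hp, hle⟩
    · have hprime : p.IsPrime := hp.isPrime
      rw [AssociatedPrimes.mem_iff, isAssociatedPrime_iff] at hp
      obtain ⟨_, x, rfl⟩ := hp
      have hx := hM x fun a ha ↦ by simpa [Submodule.mem_colon_singleton] using hle ha
      exact hprime.ne_top (by simp [hx])
    · exact (hF p hp).2 hle
  obtain ⟨r, hr, hr'⟩ := Set.not_subset.1 hnot
  simp only [Set.mem_iUnion, not_exists, id] at hr'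
  refine ⟨r, hr, ?_, fun p hp ↦ hr' p (.inr hp)⟩
  have : r ∈ (⋃ p ∈ associatedPrimes R M, p : Set R)ᶜ := by
    simp only [Set.mem_compl_iff, Set.mem_iUnion, not_exists]
    exact fun p hp ↦ hr' p (.inl hp)
  rwa [biUnion_associatedPrimes_eq_compl_regular, compl_compl] at this

variable [IsLocalRing R]

lemma exists_pow_smul_eq_zero_of_supportDim_eq_zero (h : Module.supportDim R M = 0) :
    ∃ k : ℕ, ∀ a ∈ maximalIdeal R ^ k, ∀ x : M, a • x = 0 := by
  have hs := support_of_supportDim_eq_zero R M h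
  rw [Module.support_eq_zeroLocus, PrimeSpectrum.zeroLocus_eq_iff] at hs
  obtain ⟨k, hk⟩ := (Module.annihilator R M).exists_radical_pow_le_of_fg
    (IsNoetherian.noetherian _)
  refine ⟨k, fun a ha x ↦ Module.mem_annihilator.1 (hk (Ideal.pow_right_mono ?_ k ha)) x⟩
  rw [hs]
  exact Ideal.le_radical

lemma isArtinian_of_pow_smul_eq_zero {k : ℕ} (h : ∀ a ∈ maximalIdeal R ^ k, ∀ x : M, a • x = 0) :
    IsArtinian R M := by
  obtain rfl | hk := eq_or_ne k 0
  · have : Subsingleton M := subsingleton_of_forall_eq 0 fun x ↦ by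
      simpa using h 1 (by simp) x
    infer_instance
  let I := maximalIdeal R ^ k
  have hI : I ≤ maximalIdeal R := Ideal.pow_le_self hk
  have hI' : I ≠ ⊤ := fun h ↦ (maximalIdeal.isMaximal R).ne_top (top_le_iff.1 (h ▸ hI))
  have : Nontrivial (R ⧸ I) := Ideal.Quotient.nontrivial_iff.2 hI'
  have : IsLocalRing (R ⧸ I) := .of_surjective' _ Ideal.Quotient.mk_surjective
  have : IsArtinianRing (R ⧸ I) := by
    rw [isArtinianRing_iff_isNilpotent_maximalIdeal]
    refine ⟨k, ?_⟩
    have hle : maximalIdeal (R ⧸ I) ≤ (maximalIdeal R).map (Ideal.Quotient.mk I) := by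
      intro x hx
      obtain ⟨x, rfl⟩ := Ideal.Quotient.mk_surjective x
      exact Ideal.mem_map_of_mem _ fun hu ↦ hx (hu.map _)
    rw [Ideal.zero_eq_bot, ← le_bot_iff]
    refine (Ideal.pow_right_mono hle k).trans ?_
    rw [← Ideal.map_pow, Ideal.map_quotient_self]
  have hM : Module.IsTorsionBySet R M I := fun x a ↦ h a a.2 x
  let _ : Module (R ⧸ I) M := hM.module
  have : IsScalarTower R (R ⧸ I) M := hM.isScalarTower
  have : Module.Finite (R ⧸ I) M := .of_restrictScalars_finite R _ _
  let l : M →ₛₗ[Ideal.Quotient.mk I] M :=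
    { toFun := id
      map_add' := fun _ _ ↦ rfl
      map_smul' := fun _ _ ↦ rfl }
  have : RingHomSurjective (Ideal.Quotient.mk I) := ⟨Ideal.Quotient.mk_surjective⟩
  exact (LinearMap.isArtinian_iff_of_bijective l Function.bijective_id).2 inferInstance

end Torsion

section ExactSequences

variable {A : Type u} [CommRing A] {J : Ideal A} {S : ShortComplex (ModuleCat.{u} A)}
  (hS : S.ShortExact)

include hS

lemma LC.subsingleton_X₂ {i : ℕ} (h₁ : Subsingleton (LC J i S.X₁))
    (h₃ : Subsingleton (LC J i S.X₃)) : Subsingleton (LC J i S.X₂) := by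
  refine subsingleton_of_forall_eq 0 fun x ↦ ?_
  obtain ⟨y, rfl⟩ := (LC.exact₂ hS i x).1 (Subsingleton.elim _ _)
  rw [Subsingleton.elim y 0, map_zero]

lemma LC.map_f_injective {i j : ℕ} (h : i + 1 = j) (h₃ : Subsingleton (LC J i S.X₃)) :
    Function.Injective (LC.map (J := J) j S.f) := by
  refine (injective_iff_map_eq_zero _).2 fun x hx ↦ ?_
  obtain ⟨y, rfl⟩ := (LC.exact₁ hS h x).1 hx
  rw [Subsingleton.elim y 0, map_zero]

lemma LC.map_g_bijective [IsNoetherianRing A] {k : ℕ} (hN : ∀ a ∈ J ^ k, ∀ x : S.X₁, a • x = 0)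
    (i : ℕ) : Function.Bijective (LC.map (J := J) (i + 1) S.g) := by
  have h₁ := LC.subsingleton_of_pow_smul_eq_zero hN
  refine ⟨(injective_iff_map_eq_zero _).2 fun x hx ↦ ?_, fun x ↦ ?_⟩
  · obtain ⟨y, rfl⟩ := (LC.exact₂ hS (i + 1) x).1 hx
    have := h₁ i
    rw [Subsingleton.elim y 0, map_zero]
  · have := h₁ (i + 1)
    exact (LC.exact₃ hS (i := i + 1) rfl x).1 (Subsingleton.elim _ _)

end ExactSequences

lemma LC.eq_zero_of_smul_injective {A : Type u} [CommRing A] {J : Ideal A} {i : ℕ}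
    {N : ModuleCat.{u} A} {r : A} (hr : r ∈ J)
    (h : Function.Injective fun x : LC J i N ↦ r • x) : Subsingleton (LC J i N) := by
  refine subsingleton_of_forall_eq 0 fun x ↦ ?_
  obtain ⟨k, hk⟩ := LC.exists_pow_smul_eq_zero x
  have h₁ : IsSMulRegular (LC J i N) r := h
  refine h₁.pow k ?_
  simp only [smul_zero]
  exact hk _ (Ideal.pow_mem_pow hr k)

section BaseChange

variable (R S : Type u) [CommRing R] [CommRing S] [Algebra R S]

/-- The functor `M ↦ S ⊗[R] M`. -/
noncomputable def baseChangeFunctor : ModuleCat.{u} R ⥤ ModuleCat.{u} S where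
  obj M := ModuleCat.of S (S ⊗[R] M)
  map f := ModuleCat.ofHom (f.hom.baseChange S)
  map_id _ := ModuleCat.hom_ext (LinearMap.baseChange_id)
  map_comp _ _ := ModuleCat.hom_ext (LinearMap.baseChange_comp _ _)

instance : (baseChangeFunctor R S).Additive where
  map_add := ModuleCat.hom_ext (LinearMap.baseChange_add _ _)

lemma baseChangeFunctor_map_smul_id (M : ModuleCat.{u} R) (r : R) :
    (baseChangeFunctor R S).map (r • 𝟙 M) = algebraMap R S r • 𝟙 _ := by
  refine ModuleCat.hom_ext ?_
  change (r • (LinearMap.id : M →ₗ[R] M)).baseChange S = algebraMap R S r • LinearMap.id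
  ext x
  simp [TensorProduct.smul_tmul', Algebra.algebraMap_eq_smul_one]

lemma baseChangeFunctor_map_exact [Module.Flat R S] (T : ShortComplex (ModuleCat.{u} R))
    (hT : T.Exact) : (T.map (baseChangeFunctor R S)).Exact := by
  rw [ShortComplex.ShortExact.moduleCat_exact_iff_function_exact] at hT ⊢
  exact Module.Flat.lTensor_exact S hT

lemma baseChangeFunctor_preserves [Module.Flat R S] :
    Limits.PreservesFiniteLimits (baseChangeFunctor R S) ∧
      Limits.PreservesFiniteColimits (baseChangeFunctor R S) :=
  ((Functor.exact_tfae (baseChangeFunctor R S)).out 1 3).mp (baseChangeFunctor_map_exact R S)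

instance [Module.Flat R S] : Limits.PreservesFiniteLimits (baseChangeFunctor R S) :=
  (baseChangeFunctor_preserves R S).1

instance [Module.Flat R S] : Limits.PreservesFiniteColimits (baseChangeFunctor R S) :=
  (baseChangeFunctor_preserves R S).2

variable {R}

lemma baseChange_pow_smul_eq_zero {I : Ideal R} {k : ℕ} {M : Type u} [AddCommGroup M] [Module R M]
    (h : ∀ a ∈ I ^ k, ∀ x : M, a • x = 0) :
    ∀ b ∈ (I.map (algebraMap R S)) ^ k, ∀ y : S ⊗[R] M, b • y = 0 := by
  intro b hb y
  rw [← Ideal.map_pow] at hb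
  induction hb using Submodule.span_induction with
  | mem b hb =>
    obtain ⟨a, ha, rfl⟩ := hb
    induction y with
    | zero => exact smul_zero _
    | tmul s x =>
      rw [TensorProduct.smul_tmul', algebraMap_smul, TensorProduct.smul_tmul, h a ha,
        TensorProduct.tmul_zero]
    | add x y hx hy => rw [smul_add, hx, hy, add_zero]
  | zero => exact zero_smul _ _
  | add b c _ _ hb hc => rw [add_smul, hb, hc, add_zero]
  | smul s b _ hb => rw [smul_assoc, hb, smul_zero]

end BaseChange

section Vanishing

/-- The short exact sequence attached to a submodule. -/
lemma shortExact_mkQ {R M : Type u} [CommRing R] [AddCommGroup M] [Module R M]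
    (Γ : Submodule R M) : (Γ.mkQ.shortComplexKer).ShortExact :=
  LinearMap.shortExact_shortComplexKer Γ.mkQ_surjective

variable {R : Type u} [CommRing R] [IsLocalRing R] [IsNoetherianRing R]

lemma exists_submodule_pow_smul_eq_zero (M : Type u) [AddCommGroup M] [Module R M]
    [Module.Finite R M] : ∃ (Γ : Submodule R M) (k : ℕ),
      (∀ a ∈ maximalIdeal R ^ k, ∀ x : LinearMap.ker Γ.mkQ, a • x = 0) ∧
      ∀ x : M ⧸ Γ, (∀ a ∈ maximalIdeal R, a • x = 0) → x = 0 := by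
  obtain ⟨Γ, k, hk, hΓ⟩ := exists_torsion_submodule M (maximalIdeal R)
  refine ⟨Γ, k, fun a ha x ↦ ?_, fun x hx ↦ ?_⟩
  · have hx : (x : M) ∈ Γ := by simpa using x.2
    exact Subtype.ext (hk a ha x hx)
  · obtain ⟨x, rfl⟩ := Γ.mkQ_surjective x
    refine (Submodule.Quotient.mk_eq_zero Γ).2 (hΓ 1 x fun a ha ↦ ?_)
    rw [pow_one] at ha
    exact (Submodule.Quotient.mk_eq_zero Γ).1 (hx a ha)

lemma smulShortComplex_shortExact {R M : Type u} [CommRing R] [AddCommGroup M] [Module R M] {r : R}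
    (hr : IsSMulRegular M r) : (ModuleCat.smulShortComplex (ModuleCat.of R M) r).ShortExact :=
  IsSMulRegular.smulShortComplex_shortExact hr

lemma add_one_lt_natCast_add_one {a : WithBot ℕ∞} {d : ℕ} (h : a + 1 < (d + 1 : ℕ)) : a < d := by
  by_contra! h'
  exact h.not_ge (by push_cast; gcongr)

variable (S : Type u) [CommRing S] [IsNoetherianRing S] [Algebra R S] [Module.Flat R S]

lemma LC.subsingleton_baseChange_of_supportDim_lt (d : ℕ) (M : Type u) [AddCommGroup M]
    [Module R M] [Module.Finite R M] (hM : Module.supportDim R M < d) (i : ℕ) (hi : d ≤ i) :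
    Subsingleton (LC ((maximalIdeal R).map (algebraMap R S)) i
      ((baseChangeFunctor R S).obj (ModuleCat.of R M))) := by
  induction d generalizing M i with
  | zero =>
    have : Subsingleton M := by
      rw [← Module.supportDim_eq_bot_iff_subsingleton (R := R)]
      generalize Module.supportDim R M = a at hM
      induction a with
      | bot => rfl
      | coe a => simp at hM
    have : Subsingleton ((baseChangeFunctor R S).obj (ModuleCat.of R M)) :=
      (inferInstance : Subsingleton (S ⊗[R] M))
    exact LC.subsingleton_of_subsingleton _ _
  | succ d ih =>
    obtain ⟨j, rfl⟩ : ∃ j, i = j + 1 := ⟨i - 1, by lia⟩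
    obtain ⟨Γ, k, hk, hΓ⟩ := exists_submodule_pow_smul_eq_zero (R := R) M
    have hses := (shortExact_mkQ Γ).map_of_exact (baseChangeFunctor R S)
    refine LC.subsingleton_X₂ hses (LC.subsingleton_of_pow_smul_eq_zero (k := k)
      (baseChange_pow_smul_eq_zero S hk) j) ?_
    have hM' : Module.supportDim R (M ⧸ Γ) < (d + 1 : ℕ) :=
      (Module.supportDim_le_of_surjective _ Γ.mkQ_surjective).trans_lt hM
    obtain ⟨r, hr, hreg, -⟩ := exists_isSMulRegular_avoiding (R := R) (M ⧸ Γ) hΓ ∅ (by simp)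
    have hQ : Module.supportDim R (QuotSMulTop r (M ⧸ Γ)) < d :=
      add_one_lt_natCast_add_one
        ((Module.supportDim_quotSMulTop_succ_eq_supportDim hreg hr).trans_lt hM')
    have hses' := (smulShortComplex_shortExact hreg).map_of_exact (baseChangeFunctor R S)
    refine LC.eq_zero_of_smul_injective (Ideal.mem_map_of_mem _ hr) ?_
    have hinj := LC.map_f_injective hses' (i := j) rfl (ih _ hQ j (by lia))
    have hmul (x : LC ((maximalIdeal R).map (algebraMap R S)) (j + 1)
        ((baseChangeFunctor R S).obj (ModuleCat.of R (M ⧸ Γ)))) :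
        LC.map (j + 1) ((baseChangeFunctor R S).map (r • 𝟙 (ModuleCat.of R (M ⧸ Γ)))) x =
          algebraMap R S r • x := by
      rw [baseChangeFunctor_map_smul_id, LC.map, LC.postcomp_smul_id]
    exact fun x y hxy ↦ hinj ((hmul x).trans (hxy.trans (hmul y).symm))

end Vanishing

section LocalRing

lemma LC.map_smulShortComplex {A : Type u} [CommRing A] {J : Ideal A} (i : ℕ) (N : ModuleCat.{u} A)
    (r : A) (x : LC J i N) : LC.map i (ModuleCat.smulShortComplex N r).f x = r • x :=
  LC.postcomp_smul_id i N r x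

lemma LC.exists_smul_sequence {A M : Type u} [CommRing A] (J : Ideal A) [AddCommGroup M]
    [Module A M] {r : A} (hr : IsSMulRegular M r) (i : ℕ) :
    ∃ (π : LC J i (ModuleCat.of A M) →ₗ[A] LC J i (ModuleCat.of A (QuotSMulTop r M)))
      (δ : LC J i (ModuleCat.of A (QuotSMulTop r M)) →ₗ[A] LC J (i + 1) (ModuleCat.of A M)),
      (∀ x, π (r • x) = 0) ∧ (∀ z, δ z = 0 → ∃ x, π x = z) ∧
        ∀ x : LC J (i + 1) (ModuleCat.of A M), r • x = 0 ↔ ∃ z, δ z = x := by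
  have hses := smulShortComplex_shortExact hr
  refine ⟨LC.map i (ModuleCat.smulShortComplex (ModuleCat.of A M) r).g, LC.δ hses rfl,
    fun x ↦ ?_, fun z hz ↦ (LC.exact₃ hses rfl z).1 hz, fun x ↦ ?_⟩
  · refine (congrArg _ (LC.map_smulShortComplex i (ModuleCat.of A M) r x)).symm.trans ?_
    exact (LC.exact₂ hses i).apply_apply_eq_zero x
  · refine Iff.trans ?_ (LC.exact₁ (J := J) hses (i := i) rfl x)
    exact (LC.map_smulShortComplex (i + 1) (ModuleCat.of A M) r x).symm ▸ Iff.rfl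

lemma eq_of_add_one_eq_natCast_add_one {a : WithBot ℕ∞} {d : ℕ} (h : a + 1 = (d + 1 : ℕ)) :
    a = d :=
  ENat.WithBot.add_one_cancel.1 (h.trans (by push_cast; rfl))

variable {R : Type u} [CommRing R] [IsLocalRing R] [IsNoetherianRing R]
variable (M : Type u) [AddCommGroup M] [Module R M] [Module.Finite R M]

lemma LC.isArtinian (i : ℕ) : IsArtinian R (LC (maximalIdeal R) i (ModuleCat.of R M)) := by
  induction i generalizing M with
  | zero =>
    obtain ⟨Γ, k, hk, hΓ⟩ := exists_torsion_submodule M (maximalIdeal R)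
    have : IsArtinian R Γ := isArtinian_of_pow_smul_eq_zero (k := k) Γ
      fun a ha x ↦ Subtype.ext (hk a ha x x.2)
    refine isArtinian_of_injective ((LC.eval (J := maximalIdeal R) (ModuleCat.of R M)).codRestrict Γ
      fun x ↦ ?_) ((LinearMap.injective_codRestrict_iff _).2 (LC.eval_injective _))
    obtain ⟨j, hj⟩ := LC.exists_pow_smul_eq_zero x
    refine hΓ j _ fun a ha ↦ ?_
    rw [← map_smul, hj a ha, map_zero]
    exact Γ.zero_mem
  | succ i ih =>
    obtain ⟨Γ, k, hk, hΓ⟩ := exists_submodule_pow_smul_eq_zero (R := R) M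
    obtain ⟨r, hr, hreg, -⟩ := exists_isSMulRegular_avoiding (R := R) (M ⧸ Γ) hΓ ∅ (by simp)
    have := ih (QuotSMulTop r (M ⧸ Γ))
    obtain ⟨_, δ, -, -, hδ⟩ := LC.exists_smul_sequence (maximalIdeal R) hreg i
    have hker : LinearMap.ker (LinearMap.lsmul R
        (LC (maximalIdeal R) (i + 1) (ModuleCat.of R (M ⧸ Γ))) r) = LinearMap.range δ := by
      ext x
      exact hδ x
    have hA : IsArtinian R (LinearMap.ker (LinearMap.lsmul R
        (LC (maximalIdeal R) (i + 1) (ModuleCat.of R (M ⧸ Γ))) r)) := by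
      rw [hker]
      exact isArtinian_of_surjective _ _ (LinearMap.surjective_rangeRestrict δ)
    have hA' : IsArtinian R (LC (maximalIdeal R) (i + 1) (ModuleCat.of R (M ⧸ Γ))) :=
      isArtinian_of_isArtinian_ker (s := r) fun x ↦
        (LC.exists_pow_smul_eq_zero x).imp fun k hk ↦ hk _ (Ideal.pow_mem_pow hr k)
    exact isArtinian_of_injective _ (LC.map_g_bijective (shortExact_mkQ Γ) hk i).1

omit [IsNoetherianRing R] [Module.Finite R M] in
lemma supportDim_quotient_eq {d : ℕ} (hM : Module.supportDim R M = (d + 1 : ℕ)) (Γ : Submodule R M)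
    {k : ℕ} (hk : ∀ a ∈ maximalIdeal R ^ k, ∀ x : LinearMap.ker Γ.mkQ, a • x = 0) :
    Module.supportDim R (M ⧸ Γ) = (d + 1 : ℕ) := by
  have hsupp : Module.support R M =
      Module.support R (LinearMap.ker Γ.mkQ) ∪ Module.support R (M ⧸ Γ) :=
    Module.support_of_exact (LinearMap.exact_subtype_ker_map Γ.mkQ) (Submodule.subtype_injective _)
      Γ.mkQ_surjective
  have hΓ : Module.support R (LinearMap.ker Γ.mkQ) ⊆ {closedPoint R} := by
    intro p hp
    have hle : maximalIdeal R ≤ p.asIdeal := p.2.le_of_pow_le (n := k) fun a ha ↦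
      Module.mem_support_iff_exists_annihilator.1 hp |>.elim fun x hx ↦
        hx ((Submodule.mem_annihilator_span_singleton _ _).2 (hk a ha x))
    exact PrimeSpectrum.ext ((maximalIdeal.isMaximal R).eq_of_le p.2.ne_top hle).symm
  by_cases h : Nontrivial (M ⧸ Γ)
  · rw [← hM, Module.supportDim, Module.supportDim, hsupp,
      Set.union_eq_self_of_subset_left (hΓ.trans ?_)]
    exact Set.singleton_subset_iff.2 (closedPoint_mem_support R _)
  · rw [not_nontrivial_iff_subsingleton] at h
    rw [Module.support_eq_empty (M := M ⧸ Γ), Set.union_empty] at hsupp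
    have : Module.supportDim R M ≤ 0 := by
      rw [Module.supportDim, hsupp]
      have : Subsingleton (Module.support R (LinearMap.ker Γ.mkQ)) :=
        ⟨fun a b ↦ Subtype.ext ((hΓ a.2).trans (hΓ b.2).symm)⟩
      exact Order.krullDim_nonpos_of_subsingleton
    rw [hM] at this
    norm_cast at this

lemma LC.subsingleton_zero_of_isSMulRegular {A : Type u} [CommRing A] {J : Ideal A}
    {N : ModuleCat.{u} A} {r : A} (hr : r ∈ J) (hreg : IsSMulRegular N r) :
    Subsingleton (LC J 0 N) :=
  LC.eq_zero_of_smul_injective hr fun x y h ↦ LC.eval_injective N <| hreg <| by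
    simpa only [map_smul] using congrArg (LC.eval N) h

lemma LC.not_pow_smul_eq_zero (d : ℕ) (hM : Module.supportDim R M = (d + 1 : ℕ)) (k : ℕ) :
    ¬ ∀ a ∈ maximalIdeal R ^ k, ∀ x : LC (maximalIdeal R) (d + 1) (ModuleCat.of R M),
      a • x = 0 := by
  induction d generalizing M k with
  | zero =>
    intro h
    obtain ⟨Γ, l, hl, hΓ⟩ := exists_submodule_pow_smul_eq_zero (R := R) M
    replace h : ∀ a ∈ maximalIdeal R ^ k,
        ∀ x : LC (maximalIdeal R) 1 (ModuleCat.of R (M ⧸ Γ)), a • x = 0 := by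
      intro a ha x
      obtain ⟨x, rfl⟩ := (LC.map_g_bijective (shortExact_mkQ Γ) hl 0).2 x
      rw [← map_smul, h a ha, map_zero]
    have hdim := supportDim_quotient_eq M hM Γ hl
    obtain ⟨r, hr, hreg, -⟩ := exists_isSMulRegular_avoiding (R := R) (M ⧸ Γ) hΓ ∅ (by simp)
    have hreg' := hreg.pow (k + 1)
    have hr' : r ^ (k + 1) ∈ maximalIdeal R := Ideal.pow_mem_of_mem _ hr _ (by lia)
    obtain ⟨π, δ, -, hδ, -⟩ := LC.exists_smul_sequence (maximalIdeal R) hreg' 0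
    have hsub : Subsingleton (LC (maximalIdeal R) 0 (ModuleCat.of R (M ⧸ Γ))) :=
      LC.subsingleton_zero_of_isSMulRegular hr hreg
    have hQ : Module.supportDim R (QuotSMulTop (r ^ (k + 1)) (M ⧸ Γ)) = 0 := by
      exact_mod_cast eq_of_add_one_eq_natCast_add_one
        ((Module.supportDim_quotSMulTop_succ_eq_supportDim hreg' hr').trans hdim)
    obtain ⟨j, hj⟩ := exists_pow_smul_eq_zero_of_supportDim_eq_zero _ hQ
    have hker (x : LC (maximalIdeal R) 0 (ModuleCat.of R (QuotSMulTop (r ^ (k + 1)) (M ⧸ Γ)))) :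
        r ^ k • x = 0 := by
      obtain ⟨y, hy⟩ := hδ (r ^ k • x)
        ((map_smul _ _ _).trans (h _ (Ideal.pow_mem_pow hr k) _))
      rw [← hy, Subsingleton.elim y 0, map_zero]
    have hker' (x : QuotSMulTop (r ^ (k + 1)) (M ⧸ Γ)) : r ^ k • x = 0 := by
      obtain ⟨x, rfl⟩ := (LC.bijective_eval (J := maximalIdeal R)
        (N := ModuleCat.of R (QuotSMulTop (r ^ (k + 1)) (M ⧸ Γ)))
        fun n ↦ ⟨j, fun a ha ↦ hj a ha n⟩).2 x
      exact (map_smul _ _ _).symm.trans ((congrArg _ (hker x)).trans (map_zero _))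
    have hsub' : Subsingleton (QuotSMulTop r (M ⧸ Γ)) := by
      refine Submodule.Quotient.subsingleton_iff.2 (eq_top_iff.2 fun x _ ↦ ?_)
      have := (Submodule.Quotient.mk_eq_zero _).1 (hker' (Submodule.Quotient.mk x))
      rw [Submodule.mem_smul_pointwise_iff_exists] at this ⊢
      obtain ⟨y, -, hy⟩ := this
      refine ⟨y, trivial, hreg.pow k ?_⟩
      simpa [pow_succ, mul_smul] using hy
    have := Module.supportDim_quotSMulTop_succ_eq_supportDim hreg hr
    rw [hdim, Module.supportDim_eq_bot_of_subsingleton] at this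
    simp at this
  | succ d ih =>
    intro h
    obtain ⟨Γ, l, hl, hΓ⟩ := exists_submodule_pow_smul_eq_zero (R := R) M
    replace h : ∀ a ∈ maximalIdeal R ^ k,
        ∀ x : LC (maximalIdeal R) (d + 2) (ModuleCat.of R (M ⧸ Γ)), a • x = 0 := by
      intro a ha x
      obtain ⟨x, rfl⟩ := (LC.map_g_bijective (shortExact_mkQ Γ) hl (d + 1)).2 x
      rw [← map_smul, h a ha, map_zero]
    have hdim := supportDim_quotient_eq M hM Γ hl
    have := LC.isArtinian (R := R) (M ⧸ Γ) (d + 1)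
    obtain ⟨F, hF, hF'⟩ := exists_finset_isPrime (R := R)
      (A := LC (maximalIdeal R) (d + 1) (ModuleCat.of R (M ⧸ Γ))) (maximalIdeal R)
    obtain ⟨r, hr, hreg, hrF⟩ := exists_isSMulRegular_avoiding (R := R) (M ⧸ Γ) hΓ F hF
    obtain ⟨j, hj⟩ := hF' r hrF
    obtain ⟨π, δ, hπ, hδ, -⟩ := LC.exists_smul_sequence (maximalIdeal R) hreg (d + 1)
    have hQ : Module.supportDim R (QuotSMulTop r (M ⧸ Γ)) = (d + 1 : ℕ) :=
      eq_of_add_one_eq_natCast_add_one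
        ((Module.supportDim_quotSMulTop_succ_eq_supportDim hreg hr).trans hdim)
    refine ih _ hQ (j + k) fun c hc z ↦ ?_
    rw [pow_add] at hc
    induction hc using Submodule.mul_induction_on' with
    | mem_mul_mem a ha b hb =>
      obtain ⟨x, hx⟩ := hδ (b • z)
        ((map_smul _ _ _).trans (h _ hb _))
      obtain ⟨y, hy⟩ := hj a ha x
      rw [mul_smul, ← hx, ← map_smul, hy, hπ]
    | add b _ c _ hb hc => rw [add_smul, hb, hc, add_zero]

lemma LC.nontrivial_of_supportDim_eq (d : ℕ) (hM : Module.supportDim R M = d) :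
    Nontrivial (LC (maximalIdeal R) d (ModuleCat.of R M)) := by
  by_contra h
  rw [not_nontrivial_iff_subsingleton] at h
  cases d with
  | zero =>
    obtain ⟨k, hk⟩ := exists_pow_smul_eq_zero_of_supportDim_eq_zero M hM
    have : Subsingleton M := (Equiv.ofBijective _ (LC.bijective_eval (J := maximalIdeal R)
      (N := ModuleCat.of R M) fun n ↦ ⟨k, fun a ha ↦ hk a ha n⟩)).symm.subsingleton
    simp [Module.supportDim_eq_bot_of_subsingleton] at hM
  | succ d => exact LC.not_pow_smul_eq_zero M d hM 0 fun a _ x ↦ Subsingleton.elim _ _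

end LocalRing

section Descent

lemma exists_extension_of_baseChange {R S : Type u} [CommRing R] [CommRing S] [Algebra R S]
    [Module.FaithfullyFlat R S] {K P M : Type u} [AddCommGroup K] [AddCommGroup P] [AddCommGroup M]
    [Module R K] [Module R P] [Module R M] [Module.FinitePresentation R K]
    [Module.FinitePresentation R P] (ι : K →ₗ[R] P) (η : K →ₗ[R] M)
    (θ : S ⊗[R] P →ₗ[S] S ⊗[R] M) (h : θ ∘ₗ ι.baseChange S = η.baseChange S) :
    ∃ ψ : P →ₗ[R] M, ψ ∘ₗ ι = η := by
  have hP := Module.FinitePresentation.isBaseChange_map R P M S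
  have hK := Module.FinitePresentation.isBaseChange_map R K M S
  let φ : (P →ₗ[R] M) →ₗ[R] (K →ₗ[R] M) := ι.lcomp R M
  have hφ (z : S ⊗[R] (P →ₗ[R] M)) :
      hK.equiv (φ.baseChange S z) = hP.equiv z ∘ₗ ι.baseChange S := by
    induction z with
    | zero => simp
    | add x y hx hy => rw [map_add, map_add, hx, hy, map_add, LinearMap.add_comp]
    | tmul s f =>
      rw [LinearMap.baseChange_tmul, IsBaseChange.equiv_tmul, IsBaseChange.equiv_tmul,
        LinearMap.baseChangeHom_apply, LinearMap.baseChangeHom_apply, LinearMap.smul_comp,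
        ← LinearMap.baseChange_comp]
      rfl
  have hz : φ.baseChange S (hP.equiv.symm θ) = 1 ⊗ₜ η := by
    apply hK.equiv.injective
    rw [hφ, LinearEquiv.apply_symm_apply, h, IsBaseChange.equiv_tmul, one_smul,
      LinearMap.baseChangeHom_apply]
  have hη : (1 : S) ⊗ₜ[R] (LinearMap.range φ).mkQ η = 0 := by
    have h₁ : (LinearMap.range φ).mkQ ∘ₗ φ = 0 := LinearMap.range_mkQ_comp φ
    have h₂ := congr((LinearMap.range φ).mkQ.baseChange S $hz)
    rw [← LinearMap.comp_apply, ← LinearMap.baseChange_comp, h₁, LinearMap.baseChange_zero,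
      LinearMap.zero_apply, LinearMap.baseChange_tmul] at h₂
    exact h₂.symm
  have h₀ : (LinearMap.range φ).mkQ η = 0 :=
    Module.FaithfullyFlat.tensorProduct_mk_injective (A := R) (B := S) _
      (hη.trans (TensorProduct.tmul_zero _ _).symm)
  obtain ⟨ψ, hψ⟩ := (Submodule.Quotient.mk_eq_zero _).1 h₀
  exact ⟨ψ, hψ⟩

variable {R : Type u} [CommRing R] [IsNoetherianRing R] (S : Type u) [CommRing S] [Algebra R S]
  [Module.FaithfullyFlat R S]

lemma eq_zero_of_mapExactFunctor_eq_zero (M : ModuleCat.{u} R) (i : ℕ) (L : Type u)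
    [AddCommGroup L] [Module R L] [Module.Finite R L] (ξ : Ext (ModuleCat.of R L) M i)
    (hξ : ξ.mapExactFunctor (baseChangeFunctor R S) = 0) : ξ = 0 := by
  induction i generalizing L with
  | zero =>
    obtain ⟨f, rfl⟩ := (Ext.mk₀_bijective _ _).2 ξ
    rw [Ext.mapExactFunctor_mk₀] at hξ
    have h := (Ext.mk₀_bijective _ _).1 (hξ.trans (Ext.mk₀_zero _ _).symm)
    suffices hf : f = 0 by rw [hf, Ext.mk₀_zero]
    refine ModuleCat.hom_ext (LinearMap.ext fun x ↦ ?_)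
    refine Module.FaithfullyFlat.tensorProduct_mk_injective (A := R) (B := S) M ?_
    exact (congr(($h).hom (1 ⊗ₜ x : S ⊗[R] L))).trans (TensorProduct.tmul_zero _ _).symm
  | succ i ih =>
    obtain ⟨P, _, _, _, _, p, hp⟩ := Module.exists_finite_presentation R L
    have hses := LinearMap.shortExact_shortComplexKer hp
    obtain ⟨η, rfl⟩ := Ext.contravariant_sequence_exact₃ hses M ξ
      (Ext.eq_zero_of_projective (P := ModuleCat.of R P) _) (add_comm 1 i)
    rw [Ext.mapExactFunctor_comp, Ext.mapExactFunctor_extClass] at hξ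
    obtain ⟨θ, hθ⟩ := Ext.contravariant_sequence_exact₁ (hses.map_of_exact (baseChangeFunctor R S))
      _ _ (add_comm 1 i) hξ
    have hproj : Projective ((baseChangeFunctor R S).obj (ModuleCat.of R P)) :=
      (inferInstance : Projective (ModuleCat.of S (S ⊗[R] P)))
    cases i with
    | zero =>
      have : Module.Finite R (LinearMap.ker p) := inferInstance
      have := Module.finitePresentation_of_finite R (LinearMap.ker p)
      have := Module.finitePresentation_of_finite R P
      obtain ⟨f, rfl⟩ := (Ext.mk₀_bijective _ _).2 η
      obtain ⟨g, rfl⟩ := (Ext.mk₀_bijective _ _).2 θ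
      rw [Ext.mk₀_comp_mk₀, Ext.mapExactFunctor_mk₀] at hθ
      have h := congr(($((Ext.mk₀_bijective _ _).1 hθ)).hom)
      obtain ⟨ψ, hψ⟩ := exists_extension_of_baseChange (LinearMap.ker p).subtype f.hom g.hom h
      have hf : f = ModuleCat.ofHom (LinearMap.ker p).subtype ≫ ModuleCat.ofHom ψ :=
        ModuleCat.hom_ext hψ.symm
      rw [hf, ← Ext.mk₀_comp_mk₀, ← Ext.comp_assoc _ _ _ (add_zero 1) (zero_add 0) (by lia)]
      suffices h₀ : hses.extClass.comp (Ext.mk₀ (ModuleCat.ofHom (LinearMap.ker p).subtype))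
          (add_zero 1) = 0 by rw [h₀, Ext.zero_comp]
      exact hses.extClass_comp
    | succ i =>
      have hθ₀ : θ = 0 :=
        Ext.eq_zero_of_projective (P := (baseChangeFunctor R S).obj (ModuleCat.of R P)) θ
      rw [hθ₀, Ext.comp_zero] at hθ
      rw [ih (LinearMap.ker p) η hθ.symm, Ext.comp_zero]

variable (J : Ideal R) (t : ℕ)

omit [IsNoetherianRing R] in
lemma pow_smul_quotient_eq_zero (a : R) (ha : a ∈ J ^ t) (x : R ⧸ J ^ t) : a • x = 0 := by
  obtain ⟨x, rfl⟩ := Submodule.Quotient.mk_surjective _ x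
  exact (Submodule.Quotient.mk_eq_zero _).2 (Ideal.mul_mem_right _ _ ha)

/-- The base change of `R ⧸ J ^ t`. -/
noncomputable def quotPowBaseChange : quotPow (J.map (algebraMap R S)) t ⟶
    (baseChangeFunctor R S).obj (quotPow J t) :=
  ModuleCat.ofHom (Submodule.liftQ _
    (LinearMap.toSpanSingleton S (S ⊗[R] (R ⧸ J ^ t)) (1 ⊗ₜ 1)) fun b hb ↦
      LinearMap.mem_ker.2 ((LinearMap.toSpanSingleton_apply ..).trans
        (baseChange_pow_smul_eq_zero S (pow_smul_quotient_eq_zero J t) b hb _)))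

omit [IsNoetherianRing R] [Module.FaithfullyFlat R S] in
lemma quotPowMap_comp_quotPowBaseChange {s t : ℕ} (h : s ≤ t) :
    quotPowMap _ h ≫ quotPowBaseChange S J s =
      quotPowBaseChange S J t ≫ (baseChangeFunctor R S).map (quotPowMap J h) := by
  refine ModuleCat.hom_ext (Submodule.linearMap_qext _ (LinearMap.ext_ring ?_))
  change (1 : S) • (1 ⊗ₜ 1 : S ⊗[R] (R ⧸ J ^ s)) =
    ((quotPowMap J h).hom.baseChange S) ((1 : S) • (1 ⊗ₜ 1 : S ⊗[R] (R ⧸ J ^ t)))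
  rw [one_smul, one_smul]
  rfl

omit [IsNoetherianRing R] [Module.FaithfullyFlat R S] in
lemma exists_comp_quotPowBaseChange_eq_id : ∃ v, v ≫ quotPowBaseChange S J t = 𝟙 _ := by
  let v : S ⊗[R] (R ⧸ J ^ t) →ₗ[S] S ⧸ (J.map (algebraMap R S)) ^ t := LinearMap.liftBaseChange S
    (Submodule.liftQ (J ^ t) (Algebra.linearMap R (S ⧸ (J.map (algebraMap R S)) ^ t)) fun a ha ↦
      (Submodule.Quotient.mk_eq_zero _).2 (Ideal.map_pow (algebraMap R S) J t ▸
        Ideal.mem_map_of_mem _ ha))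
  let w : S ⧸ (J.map (algebraMap R S)) ^ t →ₗ[S] S ⊗[R] (R ⧸ J ^ t) := (quotPowBaseChange S J t).hom
  have hv : v (1 ⊗ₜ 1) = 1 := by
    refine (LinearMap.liftBaseChange_tmul ..).trans ((one_smul ..).trans ?_)
    exact map_one (algebraMap R (S ⧸ (J.map (algebraMap R S)) ^ t))
  have hw : w 1 = 1 ⊗ₜ 1 := one_smul S (1 ⊗ₜ 1 : S ⊗[R] (R ⧸ J ^ t))
  have hwv : w ∘ₗ v = LinearMap.id := by
    refine LinearMap.ext fun x ↦ ?_
    induction x with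
    | zero => simp
    | add x y hx hy => rw [map_add, hx, hy, map_add]
    | tmul s x =>
      obtain ⟨x, rfl⟩ := Ideal.Quotient.mk_surjective x
      have h : s ⊗ₜ Ideal.Quotient.mk (J ^ t) x =
          (s * algebraMap R S x) • (1 ⊗ₜ 1 : S ⊗[R] (R ⧸ J ^ t)) := by
        rw [TensorProduct.smul_tmul', smul_eq_mul, mul_one, mul_comm, ← Algebra.smul_def,
          TensorProduct.smul_tmul]
        congr 1
        exact (Algebra.algebraMap_eq_smul_one x)
      rw [h, map_smul, LinearMap.comp_apply, hv, hw, map_smul, LinearMap.id_apply]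
  exact ⟨ModuleCat.ofHom v, ModuleCat.hom_ext hwv⟩

lemma LC.subsingleton_of_baseChange {M : ModuleCat.{u} R} {i : ℕ}
    (h : Subsingleton (LC (J.map (algebraMap R S)) i ((baseChangeFunctor R S).obj M))) :
    Subsingleton (LC J i M) := by
  rw [LC.subsingleton_iff] at h ⊢
  intro t ξ
  obtain ⟨s, hs, h⟩ := h t ((Ext.mk₀ (quotPowBaseChange S J t)).comp
    (ξ.mapExactFunctor (baseChangeFunctor R S)) (zero_add i))
  refine ⟨s, hs, eq_zero_of_mapExactFunctor_eq_zero S M i _ _ ?_⟩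
  obtain ⟨v, hv⟩ := exists_comp_quotPowBaseChange_eq_id S J s
  rw [Ext.mk₀_comp_mk₀_assoc, quotPowMap_comp_quotPowBaseChange, ← Ext.mk₀_comp_mk₀_assoc,
    ← Ext.mapExactFunctor_mk₀, ← Ext.mapExactFunctor_comp] at h
  have h' := congr((Ext.mk₀ v).comp $h (zero_add i))
  rwa [Ext.mk₀_comp_mk₀_assoc, hv, Ext.mk₀_id_comp, Ext.comp_zero] at h'

end Descent

section Represents

variable {A : Type u} [CommRing A] {ι : Type*} {c : ComplexShape ι}
  {K L : HomologicalComplex (ModuleCat.{u} A)ᵒᵖ c} {n m : ι}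

/-- For a complex `K` in the opposite of the category of modules, `Represents K n f e` means that
`f` is a cocycle of degree `n` of the dual complex of modules, with cohomology class `e`. -/
def Represents (K : HomologicalComplex (ModuleCat.{u} A)ᵒᵖ c) (n : ι)
    (f : (K.X n).unop) (e : (K.homology n).unop) : Prop :=
  ∃ t : (K.opcycles n).unop, (K.pOpcycles n).unop t = f ∧ (K.homologyι n).unop t = e

lemma Represents.exists_class (hm : c.prev n = m) (f : (K.X n).unop)
    (hf : (K.d m n).unop f = 0) : ∃ e, Represents K n f e := by
  have hex : (ShortComplex.mk _ _ (K.d_pOpcycles m n)).Exact :=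
    ShortComplex.exact_of_g_is_cokernel _ (K.opcyclesIsCokernel m n hm)
  obtain ⟨t, ht⟩ := (ShortComplex.moduleCat_exact_iff _).1 hex.unop f hf
  exact ⟨_, t, ht, rfl⟩

lemma Represents.exists_cocycle (m : ι) (e : (K.homology n).unop) :
    ∃ f, (K.d m n).unop f = 0 ∧ Represents K n f e := by
  obtain ⟨t, rfl⟩ := (ModuleCat.epi_iff_surjective (K.homologyι n).unop).1 inferInstance e
  refine ⟨_, ?_, t, rfl, rfl⟩
  rw [← ConcreteCategory.comp_apply, ← unop_comp, K.d_pOpcycles]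
  rfl

lemma Represents.eq_zero_iff {f : (K.X n).unop} {e : (K.homology n).unop}
    (h : Represents K n f e) (hm : c.next n = m) : e = 0 ↔ ∃ g, (K.d n m).unop g = f := by
  obtain ⟨t, rfl, rfl⟩ := h
  have hex : (ShortComplex.mk _ _ (K.homologyι_comp_fromOpcycles n m)).Exact :=
    ShortComplex.exact_of_f_is_kernel _ (K.homologyIsKernel n m hm)
  have hp : Function.Injective (K.pOpcycles n).unop :=
    (ModuleCat.mono_iff_injective _).1 inferInstance
  have hd (g) : (K.d n m).unop g = (K.pOpcycles n).unop ((K.fromOpcycles n m).unop g) := by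
    rw [← ConcreteCategory.comp_apply, ← unop_comp, K.p_fromOpcycles]
  constructor
  · intro h
    obtain ⟨g, hg⟩ := (ShortComplex.moduleCat_exact_iff _).1 hex.unop t h
    exact ⟨g, (hd g).trans congr((K.pOpcycles n).unop $hg)⟩
  · rintro ⟨g, hg⟩
    rw [hd] at hg
    rw [← hp hg, ← ConcreteCategory.comp_apply, ← unop_comp, K.homologyι_comp_fromOpcycles]
    rfl

lemma Represents.map {f : (L.X n).unop} {e : (L.homology n).unop}
    (h : Represents L n f e) (φ : K ⟶ L) :
    Represents K n ((φ.f n).unop f) ((HomologicalComplex.homologyMap φ n).unop e) := by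
  obtain ⟨t, rfl, rfl⟩ := h
  refine ⟨(HomologicalComplex.opcyclesMap φ n).unop t, ?_, ?_⟩
  · rw [← ConcreteCategory.comp_apply, ← ConcreteCategory.comp_apply, ← unop_comp, ← unop_comp,
      HomologicalComplex.p_opcyclesMap]
  · rw [← ConcreteCategory.comp_apply, ← ConcreteCategory.comp_apply, ← unop_comp, ← unop_comp,
      HomologicalComplex.homologyι_naturality]

end Represents

section Comparison

variable {A : Type u} [CommRing A] {X X' Y : ModuleCat.{u} A}

/-- The complex, in the opposite category, of morphisms from a projective resolution to `Y`. -/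
noncomputable abbrev homComplex (P : ProjectiveResolution X) (Y : ModuleCat.{u} A) :
    ChainComplex (ModuleCat.{u} A)ᵒᵖ ℕ :=
  (((linearYoneda A (ModuleCat.{u} A)).obj Y).rightOp.mapHomologicalComplex
    (ComplexShape.down ℕ)).obj P.complex

/-- The map between the complexes of morphisms induced by a map of resolutions. -/
noncomputable abbrev homComplexMap {P : ProjectiveResolution X} {P' : ProjectiveResolution X'}
    (φ : P'.complex ⟶ P.complex) (Y : ModuleCat.{u} A) : homComplex P' Y ⟶ homComplex P Y :=
  (((linearYoneda A (ModuleCat.{u} A)).obj Y).rightOp.mapHomologicalComplex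
    (ComplexShape.down ℕ)).map φ

/-- The derived functor `Ext` as the cohomology of the complex of morphisms from a projective
resolution. -/
noncomputable def extIso (P : ProjectiveResolution X) (n : ℕ) (Y : ModuleCat.{u} A) :
    ((_root_.Ext A (ModuleCat.{u} A) n).obj (Opposite.op X)).obj Y ≅
      ((homComplex P Y).homology n).unop :=
  (P.isoLeftDerivedObj ((linearYoneda A (ModuleCat.{u} A)).obj Y).rightOp n).unop.symm

lemma extIso_naturality {P : ProjectiveResolution X} {P' : ProjectiveResolution X'} (n : ℕ)
    (Y : ModuleCat.{u} A) {g : X' ⟶ X} (φ : ProjectiveResolution.Hom P' P g) :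
    ((_root_.Ext A (ModuleCat.{u} A) n).map g.op).app Y ≫ (extIso P' n Y).hom =
      (extIso P n Y).hom ≫ (HomologicalComplex.homologyMap (homComplexMap φ.hom Y) n).unop := by
  refine (cancel_epi (extIso P n Y).inv).1 ((cancel_mono (extIso P' n Y).inv).1 ?_)
  rw [Iso.inv_hom_id_assoc, Category.assoc, Category.assoc, Iso.hom_inv_id, Category.comp_id]
  have h := ProjectiveResolution.isoLeftDerivedObj_hom_naturality g P' P φ.hom
    (φ.hom_f_zero_comp_π_f_zero.trans
      congr(P'.π.f 0 ≫ $(ChainComplex.single₀_map_f_zero g)))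
    ((linearYoneda A (ModuleCat.{u} A)).obj Y).rightOp n
  exact congr(($h).unop)

/-- The degree `n` element `e` of the derived functor `Ext` is the class of the cocycle `f` of a
projective resolution `P`. -/
def ExtClass (P : ProjectiveResolution X) (n : ℕ) (f : P.complex.X n ⟶ Y)
    (e : ((_root_.Ext A (ModuleCat.{u} A) n).obj (Opposite.op X)).obj Y) : Prop :=
  Represents (homComplex P Y) n f ((extIso P n Y).hom e)

variable {P : ProjectiveResolution X} {P' : ProjectiveResolution X'} {n : ℕ}

lemma ExtClass.exists_class (f : P.complex.X n ⟶ Y) (hf : P.complex.d (n + 1) n ≫ f = 0) :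
    ∃ e, ExtClass P n f e := by
  obtain ⟨e, he⟩ := Represents.exists_class (K := homComplex P Y) (ChainComplex.prev ℕ n) f hf
  obtain ⟨e, rfl⟩ := (ModuleCat.epi_iff_surjective (extIso P n Y).hom).1 inferInstance e
  exact ⟨e, he⟩

lemma ExtClass.exists_cocycle (P : ProjectiveResolution X)
    (e : ((_root_.Ext A (ModuleCat.{u} A) n).obj (Opposite.op X)).obj Y) :
    ∃ f, P.complex.d (n + 1) n ≫ f = 0 ∧ ExtClass P n f e :=
  Represents.exists_cocycle (K := homComplex P Y) (n + 1) ((extIso P n Y).hom e)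

lemma ExtClass.eq_zero_iff {f : P.complex.X n ⟶ Y}
    {e : ((_root_.Ext A (ModuleCat.{u} A) n).obj (Opposite.op X)).obj Y}
    (h : ExtClass P n f e) {m : ℕ} (hm : (ComplexShape.down ℕ).next n = m) :
    e = 0 ↔ ∃ g : P.complex.X m ⟶ Y, P.complex.d n m ≫ g = f := by
  refine Iff.trans ?_ (Represents.eq_zero_iff h hm)
  exact (map_eq_zero_iff (extIso P n Y).hom.hom
    ((ModuleCat.mono_iff_injective (extIso P n Y).hom).1 inferInstance)).symm

lemma ExtClass.map {f : P.complex.X n ⟶ Y}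
    {e : ((_root_.Ext A (ModuleCat.{u} A) n).obj (Opposite.op X)).obj Y}
    (h : ExtClass P n f e) {g : X' ⟶ X} (φ : ProjectiveResolution.Hom P' P g) :
    ExtClass P' n (φ.hom.f n ≫ f)
      (((_root_.Ext A (ModuleCat.{u} A) n).map g.op).app Y e) := by
  have h' := Represents.map h (homComplexMap φ.hom Y)
  have he : (HomologicalComplex.homologyMap (homComplexMap φ.hom Y) n).unop
      ((extIso P n Y).hom e) =
      (extIso P' n Y).hom (((_root_.Ext A (ModuleCat.{u} A) n).map g.op).app Y e) :=
    congr($(extIso_naturality n Y φ) e).symm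
  rw [he] at h'
  exact h'

lemma extMk_eq_zero_iff (f : P.complex.X n ⟶ Y) (hf : P.complex.d (n + 1) n ≫ f = 0)
    {m : ℕ} (hm : (ComplexShape.down ℕ).next n = m) :
    P.extMk f (n + 1) rfl hf = 0 ↔ ∃ g : P.complex.X m ⟶ Y, P.complex.d n m ≫ g = f := by
  cases n with
  | zero =>
    obtain rfl : m = 0 := by simpa using hm.symm
    simp only [← P.extEquivCohomologyClass.apply_eq_iff_eq,
      ProjectiveResolution.extEquivCohomologyClass_extMk,
      ProjectiveResolution.extEquivCohomologyClass_zero,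
      CochainComplex.HomComplex.CohomologyClass.mk_eq_zero_iff]
    rw [CochainComplex.HomComplex.Cocycle.toSingleMk_mem_coboundaries_iff _ _ _ _ _ 1 (by lia)]
    have hd : P.cochainComplex.d 0 1 = 0 :=
      (P.cochainComplex.isZero_of_isStrictlyLE 0 1 (by simp)).eq_of_tgt _ _
    simp [hd, eq_comm (a := (0 : _ ⟶ Y))]
  | succ p =>
    obtain rfl : m = p := by simpa using hm.symm
    exact P.extMk_eq_zero_iff f _ rfl hf _ rfl

variable (J : Ideal A) (i : ℕ) (N : ModuleCat.{u} A)

lemma localCohomology_subsingleton_iff :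
    Subsingleton ((localCohomology J i).obj N) ↔
      ∀ (t : ℕ) (e : ((_root_.Ext A (ModuleCat.{u} A) i).obj (Opposite.op (quotPow J t))).obj N),
        ∃ (s : ℕ) (h : t ≤ s),
          ((_root_.Ext A (ModuleCat.{u} A) i).map (quotPowMap J h).op).app N e = 0 := by
  let D : ℕᵒᵖᵒᵖ ⥤ ModuleCat.{u} A :=
    localCohomology.diagram (localCohomology.idealPowersDiagram J) i ⋙ (evaluation _ _).obj N
  let iso : (localCohomology J i).obj N ≅ Limits.colimit D :=
    Limits.colimitObjIsoColimitCompEvaluation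
      (localCohomology.diagram (localCohomology.idealPowersDiagram J) i) N
  have : Limits.PreservesFilteredColimitsOfSize.{0, 0} (forget (ModuleCat.{u} A)) :=
    Limits.preservesSmallestFilteredColimits_of_preservesFilteredColimits.{u, u} _
  rw [iso.toLinearEquiv.toEquiv.subsingleton_congr]
  constructor
  · intro h t e
    have h0 : Limits.colimit.ι D (Opposite.op (Opposite.op t)) e =
        Limits.colimit.ι D (Opposite.op (Opposite.op t)) 0 := Subsingleton.elim _ _
    obtain ⟨s, f, g, hfg⟩ := (Limits.Concrete.colimit_rep_eq_iff_exists D _ _).1 h0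
    refine ⟨s.unop.unop, leOfHom f.unop.unop, ?_⟩
    rw [map_zero] at hfg
    exact hfg
  · intro h
    refine subsingleton_of_forall_eq 0 fun x ↦ ?_
    obtain ⟨t, e, rfl⟩ := Limits.Concrete.colimit_exists_rep D x
    obtain ⟨s, hs, he⟩ := h t.unop.unop e
    let f : t ⟶ Opposite.op (Opposite.op s) := (homOfLE hs).op.op
    have hf : D.map f e = 0 := he
    rw [← Limits.colimit.w D f, ConcreteCategory.comp_apply, hf, map_zero]

lemma mk₀_comp_eq_zero_iff {f : P.complex.X n ⟶ Y} (hf : P.complex.d (n + 1) n ≫ f = 0)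
    {e : ((_root_.Ext A (ModuleCat.{u} A) n).obj (Opposite.op X)).obj Y} (h : ExtClass P n f e)
    (g : X' ⟶ X) :
    (Ext.mk₀ g).comp (P.extMk f (n + 1) rfl hf) (zero_add n) = 0 ↔
      ((_root_.Ext A (ModuleCat.{u} A) n).map g.op).app Y e = 0 := by
  let P' := projectiveResolution X'
  let φ : ProjectiveResolution.Hom P' P g :=
    ⟨ProjectiveResolution.lift g P' P, ProjectiveResolution.lift_commutes_zero g P' P |>.trans
      congr(P'.π.f 0 ≫ $(ChainComplex.single₀_map_f_zero g)).symm⟩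
  rw [ProjectiveResolution.mk₀_comp_extMk f _ _ hf φ, extMk_eq_zero_iff _ _ rfl,
    (h.map φ).eq_zero_iff rfl]

/-- Local cohomology is computed by the direct limit of the `Ext`-groups `LC`. -/
lemma localCohomology_subsingleton_iff_LC :
    Subsingleton ((localCohomology J i).obj N) ↔ Subsingleton (LC J i N) := by
  rw [localCohomology_subsingleton_iff, LC.subsingleton_iff]
  refine forall_congr' fun t ↦ ?_
  let P := projectiveResolution (quotPow J t)
  constructor
  · intro h ξ
    obtain ⟨f, hf, rfl⟩ := P.extMk_surjective ξ (i + 1) rfl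
    obtain ⟨e, he⟩ := ExtClass.exists_class f hf
    obtain ⟨s, hs, hes⟩ := h e
    exact ⟨s, hs, (mk₀_comp_eq_zero_iff hf he _).2 hes⟩
  · intro h e
    obtain ⟨f, hf, he⟩ := ExtClass.exists_cocycle P e
    obtain ⟨s, hs, hes⟩ := h (P.extMk f (i + 1) rfl hf)
    exact ⟨s, hs, (mk₀_comp_eq_zero_iff hf he _).1 hes⟩

end Comparison

end ExtLocalCohomology

end

/-- If `M` is a nonzero finitely generated `R`-module with `d = dim (R / Ann_R M)`, then the
cohomological dimension of `M ⊗_R S` with respect to `mS` is `d`: the local cohomology module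
`H^d_{mS}(M ⊗_R S)` is nonzero and `H^i_{mS}(M ⊗_R S) = 0` for all `i > d`. -/
theorem stmt16 (R S : Type u) [CommRing R] [CommRing S] [IsNoetherianRing R] [IsNoetherianRing S]
    [IsLocalRing R] [IsLocalRing S] [Algebra R S] [Module.Flat R S]
    [IsLocalHom (algebraMap R S)]
    (M : Type u) [AddCommGroup M] [Module R M] [Module.Finite R M] [Nontrivial M]
    (d : ℕ) (hd : ringKrullDim (R ⧸ Module.annihilator R M) = d) :
    Nontrivial
        ((localCohomology ((maximalIdeal R).map (algebraMap R S)) d).obj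
          (ModuleCat.of S (S ⊗[R] M))) ∧
      ∀ i : ℕ, d < i →
        Subsingleton
          ((localCohomology ((maximalIdeal R).map (algebraMap R S)) i).obj
            (ModuleCat.of S (S ⊗[R] M))) := by
  have hM : Module.supportDim R M = d := by
    rw [Module.supportDim_eq_ringKrullDim_quotient_annihilator, hd]
  constructor
  · by_contra h
    rw [not_nontrivial_iff_subsingleton,
      ExtLocalCohomology.localCohomology_subsingleton_iff_LC] at h
    have : Module.FaithfullyFlat R S := Module.FaithfullyFlat.of_flat_of_isLocalHom
    have := ExtLocalCohomology.LC.nontrivial_of_supportDim_eq M d hM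
    exact not_subsingleton _
      (ExtLocalCohomology.LC.subsingleton_of_baseChange S _ (M := ModuleCat.of R M) h)
  · intro i hi
    refine (ExtLocalCohomology.localCohomology_subsingleton_iff_LC _ _ _).2 ?_
    refine ExtLocalCohomology.LC.subsingleton_baseChange_of_supportDim_lt S (d + 1) M ?_ i hi
    rw [hM]
    exact_mod_cast Nat.lt_succ_self d
end

section
/- Let M be a nonzero finitely generated R-module and let d be a natural number equal to the Krull dimension of the ring R/Ann_R(M). Then the local cohomology module H^d_{mS}(M ⊗_R S) is Artinian as an S-module if and only if the Krull dimension of the ring S/mS is 0. -/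
open IsLocalRing TensorProduct

universe u

section LocalCohomology

open CategoryTheory Abelian Opposite

section ExtComparison

variable {S : Type u} [CommRing S]

namespace CochainComplex

variable (K : CochainComplex (ModuleCat.{u} S) ℕ) (n : ℕ)

/-- The submodule of cocycles of degree `n`. -/
abbrev cocycles : Submodule S (K.X n) := LinearMap.ker (K.d n (n + 1)).hom

/-- The cohomology class of a cocycle. -/
noncomputable def classOfCocycle : ModuleCat.of S (K.cocycles n) ⟶ K.homology n :=
  K.liftCycles (ModuleCat.ofHom (K.cocycles n).subtype) (n + 1) (by simp)
    (by ext z; exact z.2) ≫ K.homologyπ n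

lemma iCycles_liftCycles_apply (z : K.cocycles n) :
    K.iCycles n (K.liftCycles (ModuleCat.ofHom (K.cocycles n).subtype) (n + 1) (by simp)
      (by ext z; exact z.2) z) = z.1 := by
  rw [← ConcreteCategory.comp_apply, HomologicalComplex.liftCycles_i]
  rfl

lemma iCycles_injective : Function.Injective (K.iCycles n) :=
  (ModuleCat.mono_iff_injective _).1 inferInstance

lemma classOfCocycle_surjective : Function.Surjective (K.classOfCocycle n) := by
  have h1 : Function.Surjective (K.homologyπ n) :=
    (ModuleCat.epi_iff_surjective _).1 inferInstance
  refine h1.comp fun c ↦ ?_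
  have hc : K.d n (n + 1) (K.iCycles n c) = 0 := by
    rw [← ConcreteCategory.comp_apply, HomologicalComplex.iCycles_d]
    rfl
  exact ⟨⟨K.iCycles n c, hc⟩, K.iCycles_injective n (K.iCycles_liftCycles_apply n _)⟩

lemma classOfCocycle_eq_zero_iff (z : K.cocycles n) : K.classOfCocycle n z = 0 ↔
    ∃ g, K.d ((ComplexShape.up ℕ).prev n) n g = z.1 := by
  have hex := ShortComplex.exact_of_g_is_cokernel
    (ShortComplex.mk _ _ (K.toCycles_comp_homologyπ ((ComplexShape.up ℕ).prev n) n))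
    (K.homologyIsCokernel _ n rfl)
  rw [ShortComplex.moduleCat_exact_iff_range_eq_ker] at hex
  have e1 : K.classOfCocycle n z = 0 ↔
      K.liftCycles (ModuleCat.ofHom (K.cocycles n).subtype) (n + 1) (by simp)
      (by ext z; exact z.2) z ∈ LinearMap.ker (K.homologyπ n).hom := Iff.rfl
  refine e1.trans ?_
  rw [← hex]
  refine exists_congr fun g ↦ ?_
  rw [← (K.iCycles_injective n).eq_iff, K.iCycles_liftCycles_apply]
  refine Eq.congr ?_ rfl
  exact (ConcreteCategory.comp_apply _ _ _).symm.trans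
    (by rw [HomologicalComplex.toCycles_i])

end CochainComplex

namespace CategoryTheory.ProjectiveResolution

variable {X Y : ModuleCat.{u} S} (P : ProjectiveResolution X) (n : ℕ)

/-- The complex computing `Ext` into `Y`. -/
noncomputable abbrev extComplex (Y : ModuleCat.{u} S) : CochainComplex (ModuleCat.{u} S) ℕ :=
  P.complex.linearYonedaObj S Y

/-- An element of the complex computing `Ext` as a morphism. -/
def toHom (f : (P.extComplex Y).X n) : P.complex.X n ⟶ Y := f

lemma d_comp_toHom (z : (P.extComplex Y).cocycles n) :
    P.complex.d (n + 1) n ≫ P.toHom n z.1 = 0 := z.2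

/-- The class of a cocycle in `Abelian.Ext`. -/
noncomputable def extClass (Y : ModuleCat.{u} S) :
    (P.extComplex Y).cocycles n →ₗ[S] Abelian.Ext.{u} X Y n where
  toFun z := P.extMk (P.toHom n z.1) (n + 1) rfl (P.d_comp_toHom n z)
  map_add' a b := (P.add_extMk _ _ _ _ _ _).symm
  map_smul' r a := by
    rw [RingHom.id_apply, Abelian.Ext.smul_eq_comp_mk₀, P.extMk_comp_mk₀]
    have : P.toHom n (r • a).1 = P.toHom n a.1 ≫ (r • 𝟙 Y) := by
      rw [Linear.comp_smul, Category.comp_id]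
      rfl
    simp only [this]

lemma extClass_surjective : Function.Surjective (P.extClass n Y) := fun α ↦ by
  obtain ⟨f, hf, rfl⟩ := P.extMk_surjective α (n + 1) rfl
  exact ⟨⟨f, hf⟩, rfl⟩

lemma extMk_eq_zero_iff_of_degree_zero (f : P.complex.X 0 ⟶ Y) (hf : P.complex.d 1 0 ≫ f = 0) :
    P.extMk f 1 rfl hf = 0 ↔ f = 0 := by
  refine ⟨fun h ↦ ?_, fun h ↦ by subst h; simp⟩
  rw [← P.extEquivCohomologyClass.apply_eq_iff_eq,
    extEquivCohomologyClass_extMk, extEquivCohomologyClass_zero,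
    CochainComplex.HomComplex.CohomologyClass.mk_eq_zero_iff,
    CochainComplex.HomComplex.Cocycle.toSingleMk_mem_coboundaries_iff _ _ _ _ _ 1 (by lia)] at h
  obtain ⟨g, hg⟩ := h
  have hg0 : g = 0 :=
    (P.cochainComplex.isZero_of_isStrictlyLE 0 1 (by lia)).eq_of_src _ _
  rw [← cancel_epi (P.cochainComplexXIso (-(0 : ℕ)) 0 rfl).hom, ← hg, hg0]
  simp

lemma extClass_eq_zero_iff (z : (P.extComplex Y).cocycles n) : P.extClass n Y z = 0 ↔
    ∃ g, (P.extComplex Y).d ((ComplexShape.up ℕ).prev n) n g = z.1 := by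
  cases n with
  | zero =>
    have h0 : (P.extComplex Y).d ((ComplexShape.up ℕ).prev 0) 0 = 0 :=
      HomologicalComplex.shape _ _ _ (by simp)
    rw [h0]
    refine (P.extMk_eq_zero_iff_of_degree_zero _ (P.d_comp_toHom 0 z)).trans ?_
    exact ⟨fun h ↦ ⟨0, h.symm⟩, fun ⟨_, h⟩ ↦ h.symm⟩
  | succ p =>
    refine (P.extMk_eq_zero_iff _ _ rfl (P.d_comp_toHom (p + 1) z) p rfl).trans ?_
    rw [CochainComplex.prev_nat_succ]
    exact Iff.rfl

/-- The class of a cocycle in the left derived functor `Ext`. -/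
noncomputable def leftExtClass (Y : ModuleCat.{u} S) :
    ModuleCat.of S ((P.extComplex Y).cocycles n) ⟶
      ((_root_.Ext S (ModuleCat S) n).obj (op X)).obj Y :=
  (P.extComplex Y).classOfCocycle n ≫ (P.isoExt n Y).inv

lemma leftExtClass_surjective : Function.Surjective (P.leftExtClass n Y) := by
  have h2 : Function.Surjective (P.isoExt (R := S) n Y).inv :=
    (ModuleCat.epi_iff_surjective _).1 inferInstance
  exact h2.comp (CochainComplex.classOfCocycle_surjective _ n)

lemma leftExtClass_eq_zero_iff (z : (P.extComplex Y).cocycles n) : P.leftExtClass n Y z = 0 ↔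
    ∃ g, (P.extComplex Y).d ((ComplexShape.up ℕ).prev n) n g = z.1 := by
  have h2 : Function.Injective (P.isoExt (R := S) n Y).inv :=
    (ModuleCat.mono_iff_injective _).1 inferInstance
  refine Iff.trans ?_ (CochainComplex.classOfCocycle_eq_zero_iff _ n z)
  exact map_eq_zero_iff (P.isoExt (R := S) n Y).inv.hom h2

lemma ker_leftExtClass :
    LinearMap.ker (P.leftExtClass n Y).hom = LinearMap.ker (P.extClass n Y) := by
  ext z
  exact (P.leftExtClass_eq_zero_iff n z).trans (P.extClass_eq_zero_iff n z).symm

/-- The comparison of the two versions of `Ext`, computed with a given projective resolution. -/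
noncomputable def leftExtEquiv (Y : ModuleCat.{u} S) :
    ((_root_.Ext S (ModuleCat S) n).obj (op X)).obj Y ≃ₗ[S] Abelian.Ext.{u} X Y n :=
  ((P.leftExtClass n Y).hom.quotKerEquivOfSurjective (P.leftExtClass_surjective n)).symm ≪≫ₗ
    Submodule.quotEquivOfEq _ _ (P.ker_leftExtClass n) ≪≫ₗ
    (P.extClass n Y).quotKerEquivOfSurjective (P.extClass_surjective n)

lemma leftExtEquiv_leftExtClass (z : (P.extComplex Y).cocycles n) :
    P.leftExtEquiv n Y (P.leftExtClass n Y z) = P.extClass n Y z := by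
  have : ((P.leftExtClass n Y).hom.quotKerEquivOfSurjective (P.leftExtClass_surjective n)).symm
      (P.leftExtClass n Y z) = Submodule.Quotient.mk z := by
    rw [LinearEquiv.symm_apply_eq]
    rfl
  simp only [leftExtEquiv, LinearEquiv.trans_apply, this]
  rfl

variable {X' : ModuleCat.{u} S} {P' : ProjectiveResolution X'} {g : X ⟶ X'}
variable {P}

/-- The map on the complexes computing `Ext` induced by a map of resolutions. -/
noncomputable def extComplexMap (φ : Hom P P' g) (Y : ModuleCat.{u} S) :
    P'.extComplex Y ⟶ P.extComplex Y :=
  (HomologicalComplex.unopFunctor _ _).map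
    ((((linearYoneda S (ModuleCat.{u} S)).obj Y).rightOp.mapHomologicalComplex _).map φ.hom).op

lemma isoExt_inv_comp_map (φ : Hom P P' g) :
    (P'.isoExt n Y).inv ≫ ((_root_.Ext S (ModuleCat S) n).map g.op).app Y =
      HomologicalComplex.homologyMap (extComplexMap φ Y) n ≫ (P.isoExt n Y).inv := by
  let F := ((linearYoneda S (ModuleCat.{u} S)).obj Y).rightOp
  let H (K : HomologicalComplex (ModuleCat.{u} S)ᵒᵖ (ComplexShape.down ℕ)) :=
    (HomologicalComplex.homologyUnop K n).hom
  have h1 := congrArg Quiver.Hom.unop (isoLeftDerivedObj_hom_naturality g P P' φ.hom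
    (by simpa using φ.hom_f_zero_comp_π_f_zero) F n)
  have h2 := congrArg Quiver.Hom.unop
    (HomologicalComplex.homologyOp_hom_naturality (extComplexMap φ Y) n)
  refine (Category.assoc (H ((F.mapHomologicalComplex _).obj P'.complex))
    (P'.isoLeftDerivedObj F n).hom.unop ((F.leftDerived n).map g).unop).trans ?_
  refine (congrArg (H ((F.mapHomologicalComplex _).obj P'.complex) ≫ ·) h1).trans ?_
  refine (Category.assoc (H ((F.mapHomologicalComplex _).obj P'.complex))
    ((F.mapHomologicalComplex _ ⋙ HomologicalComplex.homologyFunctor _ _ n).map φ.hom).unop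
    (P.isoLeftDerivedObj F n).hom.unop).symm.trans ?_
  refine (congrArg (· ≫ (P.isoLeftDerivedObj F n).hom.unop) h2).trans ?_
  exact Category.assoc (HomologicalComplex.homologyMap (extComplexMap φ Y) n)
    (H ((F.mapHomologicalComplex _).obj P.complex)) (P.isoLeftDerivedObj F n).hom.unop

lemma homologyMap_classOfCocycle {K L : CochainComplex (ModuleCat.{u} S) ℕ} (f : K ⟶ L)
    (z : K.cocycles n) (w : L.cocycles n) (h : w.1 = f.f n z.1) :
    HomologicalComplex.homologyMap f n (K.classOfCocycle n z) = L.classOfCocycle n w := by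
  have h1 : HomologicalComplex.cyclesMap f n
      (K.liftCycles (ModuleCat.ofHom (K.cocycles n).subtype) (n + 1) (by simp)
      (by ext z; exact z.2) z) =
      L.liftCycles (ModuleCat.ofHom (L.cocycles n).subtype) (n + 1) (by simp)
      (by ext z; exact z.2) w := by
    apply L.iCycles_injective
    rw [CochainComplex.iCycles_liftCycles_apply, h, ← ConcreteCategory.comp_apply,
      HomologicalComplex.cyclesMap_i, ConcreteCategory.comp_apply,
      CochainComplex.iCycles_liftCycles_apply]
  simp only [CochainComplex.classOfCocycle, ConcreteCategory.comp_apply]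
  rw [← ConcreteCategory.comp_apply, HomologicalComplex.homologyπ_naturality,
    ConcreteCategory.comp_apply, h1]

lemma leftExtEquiv_naturality (φ : Hom P P' g)
    (x : ((_root_.Ext S (ModuleCat S) n).obj (op X')).obj Y) :
    P.leftExtEquiv n Y (((_root_.Ext S (ModuleCat S) n).map g.op).app Y x) =
      (Ext.mk₀ g).comp (P'.leftExtEquiv n Y x) (zero_add _) := by
  obtain ⟨z, rfl⟩ := P'.leftExtClass_surjective n x
  rw [leftExtEquiv_leftExtClass]
  let w : (P.extComplex Y).cocycles n := ⟨(extComplexMap φ Y).f n z.1, by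
    have h : (extComplexMap φ Y).f n ≫ (P.extComplex Y).d n (n + 1) = _ :=
      (extComplexMap φ Y).comm n (n + 1)
    have h' := congrArg (fun f ↦ f z.1) (congrArg ModuleCat.Hom.hom h)
    refine h'.trans ?_
    change (extComplexMap φ Y).f (n + 1) ((P'.extComplex Y).d n (n + 1) z.1) = 0
    have : (P'.extComplex Y).d n (n + 1) z.1 = 0 := z.2
    rw [this, map_zero]⟩
  have hw : ((_root_.Ext S (ModuleCat S) n).map g.op).app Y (P'.leftExtClass n Y z) =
      P.leftExtClass n Y w := by
    have h := congrArg (fun f ↦ f ((P'.extComplex Y).classOfCocycle n z))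
      (congrArg ModuleCat.Hom.hom (isoExt_inv_comp_map n (Y := Y) φ))
    refine h.trans ?_
    exact congrArg (P.isoExt n Y).inv (homologyMap_classOfCocycle n _ z w rfl)
  rw [hw, leftExtEquiv_leftExtClass]
  exact (mk₀_comp_extMk (P'.toHom n z.1) (n + 1) rfl (P'.d_comp_toHom n z) φ).symm

/-- The lift of a morphism to chosen projective resolutions. -/
noncomputable def liftHom (g : X ⟶ X') (P : ProjectiveResolution X)
    (P' : ProjectiveResolution X') : Hom P P' g where
  hom := lift g P P'
  hom_f_zero_comp_π_f_zero := by
    have := congrArg (fun f ↦ HomologicalComplex.Hom.f f 0) (lift_commutes g P P')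
    exact this

end CategoryTheory.ProjectiveResolution

/-- The two versions of `Ext` agree. -/
noncomputable def leftExtEquiv (X Y : ModuleCat.{u} S) (n : ℕ) :
    ((_root_.Ext S (ModuleCat S) n).obj (op X)).obj Y ≃ₗ[S] Abelian.Ext.{u} X Y n :=
  (projectiveResolution X).leftExtEquiv n Y

lemma leftExtEquiv_naturality {X X' : ModuleCat.{u} S} (g : X ⟶ X') (Y : ModuleCat.{u} S) (n : ℕ)
    (x : ((_root_.Ext S (ModuleCat S) n).obj (op X')).obj Y) :
    leftExtEquiv X Y n (((_root_.Ext S (ModuleCat S) n).map g.op).app Y x) =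
      (Ext.mk₀ g).comp (leftExtEquiv X' Y n x) (zero_add _) :=
  ProjectiveResolution.leftExtEquiv_naturality n (ProjectiveResolution.liftHom g _ _) x

end ExtComparison

section LC

variable {S : Type u} [CommRing S] (J : Ideal S)

/-- The projection between quotients by powers of an ideal. -/
noncomputable def powQuot {t t' : ℕ} (h : t ≤ t') :
    ModuleCat.of S (S ⧸ J ^ t') ⟶ ModuleCat.of S (S ⧸ J ^ t) :=
  ModuleCat.ofHom (Submodule.mapQ _ _ LinearMap.id (Ideal.pow_le_pow_right h))

lemma powQuot_self (t : ℕ) : powQuot J (le_refl t) = 𝟙 _ := by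
  ext
  rfl

lemma powQuot_comp {t t' t'' : ℕ} (h : t ≤ t') (h' : t' ≤ t'') :
    powQuot J h' ≫ powQuot J h = powQuot J (h.trans h') := by
  ext
  rfl

/-- The transition maps of the direct system `Ext^i(S/J^t, N)`. -/
noncomputable def extPow (i : ℕ) (N : ModuleCat.{u} S) (t t' : ℕ) (h : t ≤ t') :
    Ext.{u} (ModuleCat.of S (S ⧸ J ^ t)) N i →ₗ[S] Ext.{u} (ModuleCat.of S (S ⧸ J ^ t')) N i :=
  Ext.precompOfLinear (Ext.mk₀ (powQuot J h)) S N (zero_add i)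

lemma extPow_apply (i : ℕ) (N : ModuleCat.{u} S) (t t' : ℕ) (h : t ≤ t')
    (x : Ext.{u} (ModuleCat.of S (S ⧸ J ^ t)) N i) :
    extPow J i N t t' h x = (Ext.mk₀ (powQuot J h)).comp x (zero_add i) := rfl

instance (i : ℕ) (N : ModuleCat.{u} S) : DirectedSystem
    (fun t ↦ Ext.{u} (ModuleCat.of S (S ⧸ J ^ t)) N i) (extPow J i N · · ·) where
  map_self t x := by simp [extPow_apply, powQuot_self]
  map_map a b c h h' x := by
    simp only [extPow_apply]
    rw [Ext.mk₀_comp_mk₀_assoc, powQuot_comp]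

/-- Local cohomology as a direct limit of `Ext` modules. -/
abbrev LC (i : ℕ) (N : ModuleCat.{u} S) : Type u :=
  Module.DirectLimit (fun t ↦ Ext.{u} (ModuleCat.of S (S ⧸ J ^ t)) N i) (extPow J i N)

/-- The cocone with point the direct limit of `Ext` modules. -/
noncomputable def lcCocone (i : ℕ) (N : ModuleCat.{u} S) :
    Limits.Cocone (localCohomology.diagram (localCohomology.idealPowersDiagram J) i ⋙
      (evaluation _ _).obj N) where
  pt := ModuleCat.of S (LC J i N)
  ι :=
    { app := fun t ↦ ModuleCat.ofHom
        (Module.DirectLimit.of S ℕ (fun t ↦ Ext.{u} (ModuleCat.of S (S ⧸ J ^ t)) N i)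
          (extPow J i N) t.unop.unop ∘ₗ (leftExtEquiv _ N i).toLinearMap)
      naturality := fun a b f ↦ by
        ext x
        have h := leftExtEquiv_naturality (powQuot J f.unop.unop.le) N i x
        refine (congrArg (Module.DirectLimit.of S ℕ
          (fun t ↦ Ext.{u} (ModuleCat.of S (S ⧸ J ^ t)) N i)
          (extPow J i N) b.unop.unop) h).trans ?_
        exact Module.DirectLimit.of_f }

variable {J} in
/-- The map from the direct limit of `Ext` modules given by a cocone. -/
noncomputable def lcDesc {i : ℕ} {N : ModuleCat.{u} S} (s : Limits.Cocone
    (localCohomology.diagram (localCohomology.idealPowersDiagram J) i ⋙ (evaluation _ _).obj N)) :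
    LC J i N →ₗ[S] s.pt :=
  Module.DirectLimit.lift S ℕ _ _
    (fun t ↦ (s.ι.app (op (op t))).hom ∘ₗ (leftExtEquiv _ N i).symm.toLinearMap)
    (fun a b hab x ↦ by
      obtain ⟨y, rfl⟩ := (leftExtEquiv _ N i).surjective x
      have h := leftExtEquiv_naturality (powQuot J hab) N i y
      have h' : extPow J i N a b hab (leftExtEquiv _ N i y) = leftExtEquiv _ N i _ := h.symm
      rw [h']
      refine (congrArg (s.ι.app (op (op b))) (LinearEquiv.symm_apply_apply _ _)).trans ?_
      refine Eq.trans ?_ (congrArg (s.ι.app (op (op a))) (LinearEquiv.symm_apply_apply _ _)).symm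
      exact congrArg (fun f ↦ f y) (congrArg ModuleCat.Hom.hom (s.w (homOfLE hab).op.op)))

lemma lcDesc_of {i : ℕ} {N : ModuleCat.{u} S} (s : Limits.Cocone
    (localCohomology.diagram (localCohomology.idealPowersDiagram J) i ⋙ (evaluation _ _).obj N))
    (t : ℕ) (y : ((_root_.Ext S (ModuleCat S) i).obj (op (ModuleCat.of S (S ⧸ J ^ t)))).obj N) :
    lcDesc s (Module.DirectLimit.of S ℕ (fun t ↦ Ext.{u} (ModuleCat.of S (S ⧸ J ^ t)) N i)
      (extPow J i N) t (leftExtEquiv _ N i y)) = s.ι.app (op (op t)) y := by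
  rw [lcDesc, Module.DirectLimit.lift_of]
  exact congrArg (s.ι.app (op (op t))) (LinearEquiv.symm_apply_apply _ _)

/-- The direct limit of `Ext` modules is a colimit. -/
noncomputable def isColimitLcCocone (i : ℕ) (N : ModuleCat.{u} S) :
    Limits.IsColimit (lcCocone J i N) where
  desc s := ModuleCat.ofHom (lcDesc s)
  fac s t := by
    ext x
    exact lcDesc_of J s t.unop.unop x
  uniq s m hm := by
    ext1
    refine Module.DirectLimit.hom_ext fun t ↦ LinearMap.ext fun x ↦ ?_
    obtain ⟨y, rfl⟩ := (leftExtEquiv _ N i).surjective x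
    refine (congrArg (fun f ↦ f y) (congrArg ModuleCat.Hom.hom (hm (op (op t))))).trans ?_
    exact (lcDesc_of J s t y).symm

/-- Local cohomology is the direct limit of the modules `Ext^i(S/J^t, N)`. -/
noncomputable def localCohomologyEquiv (i : ℕ) (N : ModuleCat.{u} S) :
    (localCohomology J i).obj N ≃ₗ[S] LC J i N :=
  ((Limits.isColimitOfPreserves ((evaluation _ _).obj N) (Limits.colimit.isColimit
    (localCohomology.diagram (localCohomology.idealPowersDiagram J) i))).coconePointUniqueUpToIso
      (isColimitLcCocone J i N)).toLinearEquiv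

end LC

section LocCoh

variable {S : Type u} [CommRing S] (J : Ideal S)

/-- The local cohomology of a module, as a direct limit of `Ext` modules. -/
def LocCoh (i : ℕ) (N : Type u) [AddCommGroup N] [Module S N] : Type u :=
  LC J i (ModuleCat.of S N)

namespace LocCoh

variable {A B C : Type u} [AddCommGroup A] [Module S A] [AddCommGroup B] [Module S B]
  [AddCommGroup C] [Module S C]

noncomputable instance (i : ℕ) : AddCommGroup (LocCoh J i A) :=
  inferInstanceAs (AddCommGroup (LC J i (ModuleCat.of S A)))

noncomputable instance (i : ℕ) : Module S (LocCoh J i A) :=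
  inferInstanceAs (Module S (LC J i (ModuleCat.of S A)))

variable (A) in
/-- The map from a term of the direct system to local cohomology. -/
noncomputable def of (i t : ℕ) :
    Ext.{u} (ModuleCat.of S (S ⧸ J ^ t)) (ModuleCat.of S A) i →ₗ[S] LocCoh J i A :=
  Module.DirectLimit.of S ℕ _ (extPow J i (ModuleCat.of S A)) t

variable {J}

lemma exists_of {i : ℕ} (x : LocCoh J i A) : ∃ t y, of J A i t y = x :=
  Module.DirectLimit.exists_of x

lemma of_precomp {i t t' : ℕ} (h : t ≤ t')
    (y : Ext.{u} (ModuleCat.of S (S ⧸ J ^ t)) (ModuleCat.of S A) i) :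
    of J A i t' ((Ext.mk₀ (powQuot J h)).comp y (zero_add i)) = of J A i t y :=
  Module.DirectLimit.of_f

lemma of_eq_zero {i t : ℕ} {y : Ext.{u} (ModuleCat.of S (S ⧸ J ^ t)) (ModuleCat.of S A) i}
    (h : of J A i t y = 0) :
    ∃ t', ∃ h : t ≤ t', (Ext.mk₀ (powQuot J h)).comp y (zero_add i) = 0 :=
  Module.DirectLimit.of.zero_exact h

variable (J)

/-- The map on local cohomology given by composition with an extension class. -/
noncomputable def postcomp {i n k : ℕ} (h : i + n = k)
    (β : Ext.{u} (ModuleCat.of S A) (ModuleCat.of S B) n) : LocCoh J i A →ₗ[S] LocCoh J k B :=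
  Module.DirectLimit.map (fun _ ↦ Ext.postcompOfLinear β S _ h) (fun a b hab ↦ by
    ext x
    exact Ext.comp_assoc _ _ _ (zero_add i) h (by lia))

@[simp]
lemma postcomp_of {i n k t : ℕ} (h : i + n = k)
    (β : Ext.{u} (ModuleCat.of S A) (ModuleCat.of S B) n)
    (y : Ext.{u} (ModuleCat.of S (S ⧸ J ^ t)) (ModuleCat.of S A) i) :
    postcomp J h β (of J A i t y) = of J B k t (y.comp β h) :=
  Module.DirectLimit.map_apply_of _ _ _

/-- Functoriality of local cohomology. -/
noncomputable def map (i : ℕ) (f : A →ₗ[S] B) : LocCoh J i A →ₗ[S] LocCoh J i B :=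
  postcomp J (add_zero i) (Ext.mk₀ (ModuleCat.ofHom f))

@[simp]
lemma map_of {i t : ℕ} (f : A →ₗ[S] B)
    (y : Ext.{u} (ModuleCat.of S (S ⧸ J ^ t)) (ModuleCat.of S A) i) :
    map J i f (of J A i t y) = of J B i t (y.comp (Ext.mk₀ (ModuleCat.ofHom f)) (add_zero i)) :=
  postcomp_of J _ _ _

lemma map_comp (i : ℕ) (f : A →ₗ[S] B) (g : B →ₗ[S] C) (x : LocCoh J i A) :
    map J i g (map J i f x) = map J i (g ∘ₗ f) x := by
  obtain ⟨t, y, rfl⟩ := exists_of x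
  simp only [map_of, Ext.comp_assoc_of_third_deg_zero, Ext.mk₀_comp_mk₀]
  rfl

lemma map_smul_id (i : ℕ) (r : S) (x : LocCoh J i A) :
    map J i (r • (LinearMap.id : A →ₗ[S] A)) x = r • x := by
  obtain ⟨t, y, rfl⟩ := exists_of x
  rw [map_of, ← map_smul, Ext.smul_eq_comp_mk₀]
  rfl

lemma map_id (i : ℕ) (x : LocCoh J i A) : map J i (LinearMap.id : A →ₗ[S] A) x = x := by
  simpa using map_smul_id J i (1 : S) x

lemma map_zero_map (i : ℕ) (x : LocCoh J i A) : map J i (0 : A →ₗ[S] B) x = 0 := by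
  obtain ⟨t, y, rfl⟩ := exists_of x
  rw [map_of, ModuleCat.ofHom_zero, Ext.mk₀_zero, Ext.comp_zero, LinearMap.map_zero]

lemma subsingleton_of_subsingleton [Subsingleton A] (i : ℕ) : Subsingleton (LocCoh J i A) := by
  refine subsingleton_of_forall_eq 0 fun x ↦ ?_
  rw [← map_id J i x, show (LinearMap.id : A →ₗ[S] A) = 0 from Subsingleton.elim _ _, map_zero_map]

variable {J}

lemma exists_pow_smul_eq_zero {i : ℕ} (x : LocCoh J i A) : ∃ t, ∀ a ∈ J ^ t, a • x = 0 := by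
  obtain ⟨t, y, rfl⟩ := exists_of x
  refine ⟨t, fun a ha ↦ ?_⟩
  have h : a • 𝟙 (ModuleCat.of S (S ⧸ J ^ t)) = 0 := by
    ext
    exact Ideal.Quotient.eq_zero_iff_mem.2 (by simpa using ha)
  rw [← map_smul, ← Ext.mk₀_id_comp y, ← Ext.smul_comp, ← Ext.mk₀_smul, h, Ext.mk₀_zero,
    Ext.zero_comp, LinearMap.map_zero]

section Exact

variable {f : A →ₗ[S] B} {g : B →ₗ[S] C}

lemma shortExact (hf : Function.Injective f) (hfg : Function.Exact f g)
    (hg : Function.Surjective g) :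
    (ShortComplex.mk (ModuleCat.ofHom f) (ModuleCat.ofHom g)
      (by ext x; exact hfg.apply_apply_eq_zero x)).ShortExact :=
  ModuleCat.shortComplex_shortExact _ hfg hf hg

lemma map_exact (i : ℕ) (hf : Function.Injective f) (hfg : Function.Exact f g)
    (hg : Function.Surjective g) : Function.Exact (map J i f) (map J i g) := by
  intro x
  constructor
  · intro hx
    obtain ⟨t, y, rfl⟩ := exists_of x
    rw [map_of] at hx
    obtain ⟨t', h, hy⟩ := of_eq_zero hx
    rw [← Ext.comp_assoc_of_third_deg_zero] at hy
    obtain ⟨z, hz⟩ := Ext.covariant_sequence_exact₂ _ (shortExact hf hfg hg) _ hy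
    refine ⟨of J A i t' z, ?_⟩
    rw [map_of, ← of_precomp h, ← hz]
  · rintro ⟨y, rfl⟩
    rw [map_comp, hfg.linearMap_comp_eq_zero, map_zero_map]

lemma exists_connecting (i : ℕ) (hf : Function.Injective f) (hfg : Function.Exact f g)
    (hg : Function.Surjective g) : ∃ δ : LocCoh J i C →ₗ[S] LocCoh J (i + 1) A,
      Function.Exact (map J i g) δ ∧ Function.Exact δ (map J (i + 1) f) := by
  have hS := shortExact hf hfg hg
  refine ⟨postcomp J rfl hS.extClass, fun x ↦ ⟨fun hx ↦ ?_, ?_⟩, fun x ↦ ⟨fun hx ↦ ?_, ?_⟩⟩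
  · obtain ⟨t, y, rfl⟩ := exists_of x
    rw [postcomp_of] at hx
    obtain ⟨t', h, hy⟩ := of_eq_zero hx
    rw [← Ext.comp_assoc _ _ _ (zero_add i) rfl (by lia)] at hy
    obtain ⟨z, hz⟩ := Ext.covariant_sequence_exact₃ _ hS _ _ hy
    refine ⟨of J B i t' z, ?_⟩
    rw [map_of, ← of_precomp h, ← hz]
  · rintro ⟨y, rfl⟩
    obtain ⟨t, y, rfl⟩ := exists_of y
    rw [map_of, postcomp_of, Ext.comp_assoc _ _ _ _ (zero_add 1) (by lia)]
    have := hS.comp_extClass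
    rw [this, Ext.comp_zero, LinearMap.map_zero]
  · obtain ⟨t, y, rfl⟩ := exists_of x
    rw [map_of] at hx
    obtain ⟨t', h, hy⟩ := of_eq_zero hx
    rw [← Ext.comp_assoc_of_third_deg_zero] at hy
    obtain ⟨z, hz⟩ := Ext.covariant_sequence_exact₁ _ hS _ hy rfl
    refine ⟨of J C i t' z, ?_⟩
    rw [postcomp_of, ← of_precomp h, ← hz]
  · rintro ⟨y, rfl⟩
    obtain ⟨t, y, rfl⟩ := exists_of y
    rw [postcomp_of, map_of, Ext.comp_assoc_of_third_deg_zero]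
    have := hS.extClass_comp
    rw [this, Ext.comp_zero, LinearMap.map_zero]

end Exact

lemma subsingleton_of_ext {i : ℕ}
    (h : ∀ t, Subsingleton (Ext.{u} (ModuleCat.of S (S ⧸ J ^ t)) (ModuleCat.of S A) i)) :
    Subsingleton (LocCoh J i A) := by
  refine subsingleton_of_forall_eq 0 fun x ↦ ?_
  obtain ⟨t, y, rfl⟩ := exists_of x
  rw [Subsingleton.elim y 0, LinearMap.map_zero]

lemma subsingleton_of_injective (i : ℕ) [Injective (ModuleCat.of S A)] :
    Subsingleton (LocCoh J (i + 1) A) :=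
  subsingleton_of_ext fun _ ↦ Ext.subsingleton_of_injective _ _ _

section Zero

variable (J)

/-- The `J`-torsion submodule: elements killed by a power of `J`. -/
def torsion (A : Type u) [AddCommGroup A] [Module S A] : Submodule S A where
  carrier := {x | ∃ t, ∀ a ∈ J ^ t, a • x = 0}
  add_mem' := by
    rintro x y ⟨t, ht⟩ ⟨t', ht'⟩
    refine ⟨max t t', fun a ha ↦ ?_⟩
    rw [smul_add, ht a (Ideal.pow_le_pow_right (le_max_left _ _) ha),
      ht' a (Ideal.pow_le_pow_right (le_max_right _ _) ha), add_zero]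
  zero_mem' := ⟨0, fun a _ ↦ smul_zero a⟩
  smul_mem' := by
    rintro r x ⟨t, ht⟩
    exact ⟨t, fun a ha ↦ by rw [smul_comm, ht a ha, smul_zero]⟩

lemma mem_torsion {x : A} : x ∈ torsion J A ↔ ∃ t, ∀ a ∈ J ^ t, a • x = 0 := Iff.rfl

/-- Evaluation at one of a homomorphism from `S/J^t`. -/
noncomputable def evalOne (t : ℕ) (A : Type u) [AddCommGroup A] [Module S A] :
    Ext.{u} (ModuleCat.of S (S ⧸ J ^ t)) (ModuleCat.of S A) 0 →ₗ[S] A :=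
  (LinearMap.applyₗ (R := S) (1 : S ⧸ J ^ t)) ∘ₗ ModuleCat.homLinearEquiv.toLinearMap ∘ₗ
    (Ext.linearEquiv₀ (R := S)).toLinearMap

lemma evalOne_mk₀ (t : ℕ) (f : ModuleCat.of S (S ⧸ J ^ t) ⟶ ModuleCat.of S A) :
    evalOne J t A (Ext.mk₀ f) = f.hom (1 : S ⧸ J ^ t) := by
  simp only [evalOne, LinearMap.comp_apply, LinearEquiv.coe_coe]
  rw [← Ext.linearEquiv₀_symm_apply (R := S), LinearEquiv.apply_symm_apply]
  rfl

/-- Local cohomology in degree zero maps to the module. -/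
noncomputable def eval (A : Type u) [AddCommGroup A] [Module S A] : LocCoh J 0 A →ₗ[S] A :=
  Module.DirectLimit.lift S ℕ _ _ (fun t ↦ evalOne J t A) (fun a b hab x ↦ by
    obtain ⟨f, rfl⟩ := (Ext.mk₀_bijective _ _).2 x
    rw [extPow_apply, Ext.mk₀_comp_mk₀, evalOne_mk₀, evalOne_mk₀]
    rfl)

lemma eval_of (t : ℕ) (f : ModuleCat.of S (S ⧸ J ^ t) ⟶ ModuleCat.of S A) :
    eval J A (of J A 0 t (Ext.mk₀ f)) = f.hom (1 : S ⧸ J ^ t) :=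
  (Module.DirectLimit.lift_of _ _ _).trans (evalOne_mk₀ J t f)

lemma eval_map (f : A →ₗ[S] B) (x : LocCoh J 0 A) : eval J B (map J 0 f x) = f (eval J A x) := by
  obtain ⟨t, y, rfl⟩ := exists_of x
  obtain ⟨g, rfl⟩ := (Ext.mk₀_bijective _ _).2 y
  rw [map_of, Ext.mk₀_comp_mk₀, eval_of, eval_of]
  rfl

lemma eval_injective : Function.Injective (eval J A) := by
  rw [injective_iff_map_eq_zero]
  intro x hx
  obtain ⟨t, y, rfl⟩ := exists_of x
  obtain ⟨g, rfl⟩ := (Ext.mk₀_bijective _ _).2 y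
  rw [eval_of] at hx
  have : g = 0 := by
    ext
    exact hx
  rw [this, Ext.mk₀_zero, LinearMap.map_zero]

lemma range_eval : LinearMap.range (eval J A) = torsion J A := by
  ext x
  rw [mem_torsion]
  constructor
  · rintro ⟨y, rfl⟩
    obtain ⟨t, ht⟩ := exists_pow_smul_eq_zero y
    exact ⟨t, fun a ha ↦ by rw [← LinearMap.map_smul, ht a ha, LinearMap.map_zero]⟩
  · rintro ⟨t, ht⟩
    refine ⟨of J A 0 t (Ext.mk₀ (ModuleCat.ofHom
      ((J ^ t).liftQ (LinearMap.toSpanSingleton S A x) fun a ha ↦ ht a ha))), ?_⟩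
    rw [eval_of]
    exact one_smul S x

/-- Local cohomology in degree zero is the torsion submodule. -/
noncomputable def equivTorsion : LocCoh J 0 A ≃ₗ[S] torsion J A :=
  (LinearEquiv.ofInjective (eval J A) (eval_injective J)).trans
    (LinearEquiv.ofEq _ _ (range_eval J))

end Zero

end LocCoh

end LocCoh

namespace LocCoh

variable {S : Type u} [CommRing S] {J : Ideal S}
  {A B C : Type u} [AddCommGroup A] [Module S A] [AddCommGroup B] [Module S B]
  [AddCommGroup C] [Module S C]

variable (S A) in
lemma exists_injective_embedding : ∃ (E : Type u) (_ : AddCommGroup E) (_ : Module S E)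
    (f : A →ₗ[S] E), Function.Injective f ∧ Injective (ModuleCat.of S E) := by
  let E : ModuleCat.{u} S := Injective.under (ModuleCat.of S A)
  exact ⟨E, inferInstance, inferInstance, (Injective.ι (ModuleCat.of S A)).hom,
    (ModuleCat.mono_iff_injective _).1 inferInstance,
    inferInstanceAs (Injective (Injective.under (ModuleCat.of S A)))⟩

lemma subsingleton_of_exact {X Y Z : Type*} [AddCommGroup X] [AddCommGroup Y] [AddCommGroup Z]
    [Module S X] [Module S Y] [Module S Z] [Subsingleton X] [Subsingleton Z]
    {f : X →ₗ[S] Y} {g : Y →ₗ[S] Z} (h : Function.Exact f g) : Subsingleton Y := by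
  refine subsingleton_of_forall_eq 0 fun y ↦ ?_
  obtain ⟨x, rfl⟩ := (h y).1 (Subsingleton.elim _ _)
  rw [Subsingleton.elim x 0, map_zero]

lemma exists_pow_smul_eq_zero_of_fg (N : Submodule S A) (hN : N.FG) (h : N ≤ torsion J A) :
    ∃ t, ∀ a ∈ J ^ t, ∀ x ∈ N, a • x = 0 := by
  induction N, hN using Submodule.fg_induction with
  | singleton x =>
    obtain ⟨t, ht⟩ := h (Submodule.mem_span_singleton_self x)
    refine ⟨t, fun a ha y hy ↦ ?_⟩
    obtain ⟨r, rfl⟩ := Submodule.mem_span_singleton.1 hy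
    rw [smul_comm, ht a ha, smul_zero]
  | sup N₁ N₂ _ _ h₁ h₂ =>
    obtain ⟨t₁, h₁⟩ := h₁ (le_sup_left.trans h)
    obtain ⟨t₂, h₂⟩ := h₂ (le_sup_right.trans h)
    refine ⟨max t₁ t₂, fun a ha x hx ↦ ?_⟩
    obtain ⟨y, hy, z, hz, rfl⟩ := Submodule.mem_sup.1 hx
    rw [smul_add, h₁ a (Ideal.pow_le_pow_right (le_max_left _ _) ha) y hy,
      h₂ a (Ideal.pow_le_pow_right (le_max_right _ _) ha) z hz, add_zero]

variable (J A) in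
lemma injective_torsion [IsNoetherianRing S] [hA : Injective (ModuleCat.of S A)] :
    Injective (ModuleCat.of S (torsion J A)) := by
  have hA' : Module.Injective S A := Module.injective_module_of_injective_object S A
  have : Module.Injective S (torsion J A) := by
    refine Module.Baer.injective fun I g ↦ ?_
    obtain ⟨t, ht⟩ := exists_pow_smul_eq_zero_of_fg (J := J)
      (LinearMap.range ((torsion J A).subtype ∘ₗ g)) (Module.Finite.iff_fg.1 inferInstance)
      (by rintro _ ⟨y, rfl⟩; exact (g y).2)
    obtain ⟨k, hk⟩ := Ideal.exists_pow_inf_eq_pow_smul J (I : Submodule S S)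
    have hk' := hk (k + t) (Nat.le_add_right _ _)
    rw [Nat.add_sub_cancel_left] at hk'
    have hker : ∀ x : I, (x : S) ∈ J ^ (k + t) → (g x : A) = 0 := by
      intro x hx
      have hx' : (x : S) ∈ J ^ t • (J ^ k • (⊤ : Submodule S S) ⊓ I) := by
        rw [← hk']
        exact ⟨by simpa using hx, x.2⟩
      have hle : J ^ t • (J ^ k • (⊤ : Submodule S S) ⊓ I) ≤
          (LinearMap.ker ((torsion J A).subtype ∘ₗ g)).map (Submodule.subtype I) := by
        rw [Submodule.smul_le]
        rintro a ha y ⟨-, hy⟩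
        refine ⟨a • ⟨y, hy⟩, ?_, rfl⟩
        simp only [SetLike.mem_coe, LinearMap.mem_ker, map_smul]
        exact ht a ha _ ⟨⟨y, hy⟩, rfl⟩
      obtain ⟨y, hy, hyx⟩ := hle hx'
      obtain rfl : y = x := Subtype.ext hyx
      exact hy
    let p : Submodule S I := Submodule.comap (Submodule.subtype I) (J ^ (k + t))
    let φ : (I ⧸ p) →ₗ[S] (S ⧸ J ^ (k + t)) := p.mapQ _ (Submodule.subtype I) le_rfl
    let γ : (I ⧸ p) →ₗ[S] A := p.liftQ ((torsion J A).subtype ∘ₗ g) fun x hx ↦ hker x hx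
    have hφ : Function.Injective φ := by
      rw [← LinearMap.ker_eq_bot, Submodule.ker_mapQ]
      exact p.mkQ_map_self
    obtain ⟨h, hh⟩ := hA'.out φ hφ γ
    let q : S →ₗ[S] A := h ∘ₗ (J ^ (k + t) : Submodule S S).mkQ
    have hq : ∀ x, q x ∈ torsion J A := fun x ↦ by
      refine ⟨k + t, fun a ha ↦ ?_⟩
      rw [← map_smul]
      have : (J ^ (k + t) : Submodule S S).mkQ (a • x) = 0 :=
        (Submodule.Quotient.mk_eq_zero _).2 (Ideal.mul_mem_right _ _ ha)
      simp only [q, LinearMap.comp_apply, this, map_zero]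
    refine ⟨q.codRestrict _ hq, fun x hx ↦ Subtype.ext ?_⟩
    exact hh (Submodule.Quotient.mk ⟨x, hx⟩)
  exact Module.injective_object_of_injective_module S _

lemma eval_surjective (hA : torsion J A = ⊤) : Function.Surjective (eval J A) := by
  rw [← LinearMap.range_eq_top, range_eval, hA]

/-- Higher local cohomology of torsion modules vanishes. -/
lemma subsingleton_of_torsion [IsNoetherianRing S] (i : ℕ) (hA : torsion J A = ⊤) :
    Subsingleton (LocCoh J (i + 1) A) := by
  induction i generalizing A with
  | zero => ?_
  | succ i ih => ?_
  all_goals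
    obtain ⟨E, _, _, f₀, hf₀, hE⟩ := exists_injective_embedding S A
    have hE' := injective_torsion J E
    have hf₀E : ∀ x, f₀ x ∈ torsion J E := fun x ↦ by
      obtain ⟨t, ht⟩ := hA.ge (Submodule.mem_top (x := x))
      exact ⟨t, fun a ha ↦ by rw [← map_smul, ht a ha, map_zero]⟩
    let f := f₀.codRestrict _ hf₀E
    have hf : Function.Injective f := fun x y h ↦ hf₀ (congrArg Subtype.val h)
    let g := (LinearMap.range f).mkQ
    have hfg : Function.Exact f g := LinearMap.exact_map_mkQ_range f
    have hg : Function.Surjective g := Submodule.mkQ_surjective _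
    have hB : torsion J (torsion J E) = ⊤ := by
      refine eq_top_iff.2 fun x _ ↦ ?_
      obtain ⟨t, ht⟩ := x.2
      exact ⟨t, fun a ha ↦ Subtype.ext (ht a ha)⟩
    have hC : torsion J (torsion J E ⧸ LinearMap.range f) = ⊤ := by
      refine eq_top_iff.2 fun x _ ↦ ?_
      obtain ⟨y, rfl⟩ := hg x
      obtain ⟨t, ht⟩ := hB.ge (Submodule.mem_top (x := y))
      exact ⟨t, fun a ha ↦ by rw [← map_smul, ht a ha, map_zero]⟩
  · obtain ⟨δ, h₁, h₂⟩ := exists_connecting (J := J) 0 hf hfg hg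
    have := subsingleton_of_injective (J := J) (A := torsion J E) 0
    refine subsingleton_of_forall_eq 0 fun x ↦ ?_
    obtain ⟨y, rfl⟩ := (h₂ x).1 (Subsingleton.elim _ _)
    rw [h₁ y]
    obtain ⟨z, hz⟩ := hg (eval J _ y)
    obtain ⟨w, rfl⟩ := eval_surjective hB z
    exact ⟨w, eval_injective J (by rw [eval_map, hz])⟩
  · obtain ⟨δ, -, h₂⟩ := exists_connecting (J := J) (i + 1) hf hfg hg
    have := subsingleton_of_injective (J := J) (A := torsion J E) (i + 1)
    have := ih hC
    exact subsingleton_of_exact h₂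

end LocCoh

section ExtVanishing

variable {S : Type u} [CommRing S] {T : ShortComplex (ModuleCat.{u} S)} (hT : T.ShortExact)
  {Y : ModuleCat.{u} S}

include hT in
lemma CategoryTheory.ShortComplex.ShortExact.subsingleton_ext_one [Projective T.X₂]
    (h : ∀ φ : T.X₁ ⟶ Y, ∃ ψ : T.X₂ ⟶ Y, T.f ≫ ψ = φ) : Subsingleton (Ext.{u} T.X₃ Y 1) := by
  refine subsingleton_of_forall_eq 0 fun x ↦ ?_
  obtain ⟨y, rfl⟩ := Ext.contravariant_sequence_exact₃ hT Y x
    (Ext.eq_zero_of_projective _) (add_zero 1)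
  obtain ⟨φ, rfl⟩ := (Ext.mk₀_bijective _ _).2 y
  obtain ⟨ψ, rfl⟩ := h φ
  rw [← Ext.mk₀_comp_mk₀, ← Ext.comp_assoc_of_second_deg_zero]
  simp

include hT in
lemma CategoryTheory.ShortComplex.ShortExact.subsingleton_ext_succ [Projective T.X₂] (i : ℕ)
    [Subsingleton (Ext.{u} T.X₁ Y (i + 1))] : Subsingleton (Ext.{u} T.X₃ Y (i + 1 + 1)) := by
  refine subsingleton_of_forall_eq 0 fun x ↦ ?_
  obtain ⟨y, rfl⟩ := Ext.contravariant_sequence_exact₃ hT Y x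
    (Ext.eq_zero_of_projective _) (add_comm 1 (i + 1))
  rw [Subsingleton.elim y 0, Ext.comp_zero]

end ExtVanishing

namespace LocCoh

variable {R S : Type u} [CommRing R] [CommRing S] [Algebra R S] [Module.Flat R S]
  {A B C : Type u} [AddCommGroup A] [Module R A] [AddCommGroup B] [Module R B]
  [AddCommGroup C] [Module R C]

variable (S) in
lemma baseChange_injective {f : A →ₗ[R] B} (hf : Function.Injective f) :
    Function.Injective (f.baseChange S) :=
  Module.Flat.lTensor_preserves_injective_linearMap (M := S) f hf

variable (S) in
omit [Module.Flat R S] in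
lemma baseChange_surjective {f : A →ₗ[R] B} (hf : Function.Surjective f) :
    Function.Surjective (f.baseChange S) :=
  LinearMap.lTensor_surjective S hf

variable (S) in
lemma baseChange_exact {f : A →ₗ[R] B} {g : B →ₗ[R] C} (h : Function.Exact f g) :
    Function.Exact (f.baseChange S) (g.baseChange S) :=
  Module.Flat.lTensor_exact S h

/-- A linear map from the base change of a submodule of a finite module to the base change of an
injective module extends. -/
lemma exists_extension_baseChange [IsNoetherianRing R] [Module.Finite R A] [Module.Finite R B]
    {f : A →ₗ[R] B} (hf : Function.Injective f) [hC : Injective (ModuleCat.of R C)]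
    (φ : S ⊗[R] A →ₗ[S] S ⊗[R] C) :
    ∃ ψ : S ⊗[R] B →ₗ[S] S ⊗[R] C, ψ ∘ₗ f.baseChange S = φ := by
  have hC' : Module.Injective R C := Module.injective_module_of_injective_object R C
  have : Module.FinitePresentation R A := Module.finitePresentation_of_finite R A
  induction φ using (Module.FinitePresentation.isBaseChange_map R A C S).inductionOn with
  | zero => exact ⟨0, LinearMap.zero_comp _⟩
  | tmul φ =>
    obtain ⟨ψ, hψ⟩ := hC'.out f hf φ
    refine ⟨ψ.baseChange S, ?_⟩
    rw [← LinearMap.baseChange_comp, show ψ ∘ₗ f = φ from LinearMap.ext hψ]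
    rfl
  | smul s φ h =>
    obtain ⟨ψ, rfl⟩ := h
    exact ⟨s • ψ, LinearMap.smul_comp _ _ _⟩
  | add φ₁ φ₂ h₁ h₂ =>
    obtain ⟨ψ₁, rfl⟩ := h₁
    obtain ⟨ψ₂, rfl⟩ := h₂
    exact ⟨ψ₁ + ψ₂, LinearMap.add_comp _ _ _⟩

lemma subsingleton_ext_baseChange [IsNoetherianRing R] [Module.Finite R A]
    [hC : Injective (ModuleCat.of R C)] (i : ℕ) :
    Subsingleton (Ext.{u} (ModuleCat.of S (S ⊗[R] A)) (ModuleCat.of S (S ⊗[R] C)) (i + 1)) := by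
  induction i generalizing A with
  | zero => ?_
  | succ i ih => ?_
  all_goals
    obtain ⟨n, g, hg⟩ := Module.Finite.exists_fin' R A
    let F := ULift.{u} (Fin n) → R
    let g' : F →ₗ[R] A := g ∘ₗ (LinearEquiv.funCongrLeft R R Equiv.ulift.symm).toLinearMap
    have hg' : Function.Surjective g' := hg.comp (LinearEquiv.surjective _)
    have hf : Function.Injective (LinearMap.ker g').subtype := Subtype.val_injective
    have hfg : Function.Exact (LinearMap.ker g').subtype g' := LinearMap.exact_subtype_ker_map g'
    have hT := shortExact (baseChange_injective S hf) (baseChange_exact S hfg)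
      (baseChange_surjective S hg')
    have : Projective (ModuleCat.of S (S ⊗[R] F)) :=
      (IsProjective.iff_projective _).1 inferInstance
  · refine hT.subsingleton_ext_one fun φ ↦ ?_
    obtain ⟨ψ, hψ⟩ := exists_extension_baseChange (S := S) hf φ.hom
    exact ⟨ModuleCat.ofHom ψ, ModuleCat.hom_ext hψ⟩
  · have := ih (A := LinearMap.ker g')
    exact hT.subsingleton_ext_succ i

lemma subsingleton_baseChange_of_injective [IsNoetherianRing R] (I : Ideal R)
    [Injective (ModuleCat.of R C)] (i : ℕ) :
    Subsingleton (LocCoh (I.map (algebraMap R S)) (i + 1) (S ⊗[R] C)) := by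
  refine subsingleton_of_ext fun t ↦ ?_
  let e : (S ⧸ (I.map (algebraMap R S)) ^ t) ≃ₗ[S] S ⊗[R] (R ⧸ I ^ t) :=
    Submodule.quotEquivOfEq _ _ (Ideal.map_pow _ _ _).symm ≪≫ₗ
    (Algebra.TensorProduct.quotIdealMapEquivTensorQuot S (I ^ t)).toLinearEquiv
  have := subsingleton_ext_baseChange (R := R) (S := S) (A := R ⧸ I ^ t) (C := C) i
  refine subsingleton_of_forall_eq 0 fun x ↦ ?_
  have h : (Ext.mk₀ e.toModuleIso.hom).comp ((Ext.mk₀ e.toModuleIso.inv).comp x (zero_add _))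
      (zero_add _) = x := by
    rw [← Ext.comp_assoc_of_second_deg_zero, Ext.mk₀_comp_mk₀, Iso.hom_inv_id,
      Ext.mk₀_id_comp]
  rw [← h, Subsingleton.elim ((Ext.mk₀ e.toModuleIso.inv).comp x (zero_add _)) 0, Ext.comp_zero]

lemma range_baseChange_subtype_torsion [IsNoetherianRing R] (I : Ideal R) :
    LinearMap.range ((torsion I A).subtype.baseChange S) =
      torsion (I.map (algebraMap R S)) (S ⊗[R] A) := by
  apply le_antisymm
  · rintro _ ⟨x, rfl⟩
    induction x with
    | zero => rw [map_zero]; exact zero_mem _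
    | add x y hx hy => rw [map_add]; exact add_mem hx hy
    | tmul s x =>
      obtain ⟨t, ht⟩ := x.2
      refine ⟨t, fun a ha ↦ ?_⟩
      rw [← Ideal.map_pow] at ha
      refine Submodule.span_induction ?_ ?_ ?_ ?_ ha
      · rintro _ ⟨r, hr, rfl⟩
        rw [algebraMap_smul, LinearMap.baseChange_tmul, ← TensorProduct.tmul_smul]
        simp [ht r hr]
      · exact zero_smul _ _
      · intro a b _ _ ha hb
        rw [add_smul, ha, hb, add_zero]
      · intro a b _ hb
        rw [smul_assoc, hb, smul_zero]
  · rintro x ⟨t, ht⟩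
    obtain ⟨n, a, ha⟩ := Submodule.fg_iff_exists_fin_generating_family.1
      (IsNoetherian.noetherian (I ^ t))
    let φ : A →ₗ[R] (Fin n → A) := LinearMap.pi fun j ↦ a j • LinearMap.id
    have hφ := baseChange_exact S (LinearMap.exact_subtype_ker_map φ)
    have hx : φ.baseChange S x = 0 := by
      have key : ∀ y : S ⊗[R] A, TensorProduct.piRight R S S (fun _ : Fin n ↦ A)
          (φ.baseChange S y) = fun j ↦ algebraMap R S (a j) • y := by
        intro y
        induction y with
        | zero => simp; rfl
        | add y z hy hz => 
          rw [map_add, map_add, hy, hz]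
          ext j
          simp
        | tmul s y =>
          ext j
          simp [φ, TensorProduct.tmul_smul]
      apply (TensorProduct.piRight R S S (fun _ : Fin n ↦ A)).injective
      rw [key, map_zero]
      ext j
      refine ht _ ?_
      rw [← Ideal.map_pow]
      exact Ideal.mem_map_of_mem _ (ha ▸ Submodule.subset_span ⟨j, rfl⟩)
    obtain ⟨y, rfl⟩ := (hφ x).1 hx
    have hle : LinearMap.ker φ ≤ torsion I A := by
      intro z hz
      refine ⟨t, fun b hb ↦ ?_⟩
      rw [← ha] at hb
      refine Submodule.span_induction ?_ ?_ ?_ ?_ hb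
      · rintro _ ⟨j, rfl⟩
        exact congrFun hz j
      · exact zero_smul _ _
      · intro a b _ _ ha hb
        rw [add_smul, ha, hb, add_zero]
      · intro a b _ hb
        rw [smul_assoc, hb, smul_zero]
    refine ⟨(Submodule.inclusion hle).baseChange S y, ?_⟩
    rw [← LinearMap.comp_apply, ← LinearMap.baseChange_comp, Submodule.subtype_comp_inclusion]

variable (S A) in
lemma exists_baseChange_equiv_zero [IsNoetherianRing R] (I : Ideal R) :
    ∃ e : S ⊗[R] LocCoh I 0 A ≃ₗ[S] LocCoh (I.map (algebraMap R S)) 0 (S ⊗[R] A),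
      ∀ x, eval _ _ (e x) = (eval I A).baseChange S x := by
  have hr : LinearMap.range ((eval I A).baseChange S) =
      LinearMap.range (eval (I.map (algebraMap R S)) (S ⊗[R] A)) := by
    rw [range_eval, ← range_baseChange_subtype_torsion]
    have : eval I A = (torsion I A).subtype ∘ₗ (equivTorsion I).toLinearMap := rfl
    rw [this, LinearMap.baseChange_comp]
    exact LinearMap.range_comp_of_range_eq_top _ (LinearMap.range_eq_top.2
      (baseChange_surjective S (equivTorsion I).surjective))
  refine ⟨LinearEquiv.ofInjective _ (baseChange_injective S (eval_injective I)) ≪≫ₗ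
    LinearEquiv.ofEq _ _ hr ≪≫ₗ (LinearEquiv.ofInjective _ (eval_injective _)).symm, fun x ↦ ?_⟩
  have := LinearEquiv.apply_symm_apply
    (LinearEquiv.ofInjective (eval (I.map (algebraMap R S)) (S ⊗[R] A)) (eval_injective _))
    (LinearEquiv.ofEq _ _ hr (LinearEquiv.ofInjective _
      (baseChange_injective S (eval_injective I)) x))
  exact congrArg Subtype.val this

/-- Cokernels of isomorphic maps are isomorphic. -/
lemma nonempty_equiv_of_exact {X Y Z X' Y' Z' : Type*} [AddCommGroup X] [AddCommGroup Y]
    [AddCommGroup Z] [AddCommGroup X'] [AddCommGroup Y'] [AddCommGroup Z'] [Module S X]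
    [Module S Y] [Module S Z] [Module S X'] [Module S Y'] [Module S Z'] {f : X →ₗ[S] Y}
    {g : Y →ₗ[S] Z} {f' : X' →ₗ[S] Y'} {g' : Y' →ₗ[S] Z'} (h : Function.Exact f g)
    (hg : Function.Surjective g) (h' : Function.Exact f' g') (hg' : Function.Surjective g')
    (a : X ≃ₗ[S] X') (b : Y ≃ₗ[S] Y') (hab : ∀ x, b (f x) = f' (a x)) : Nonempty (Z ≃ₗ[S] Z') := by
  have hker : LinearMap.ker g = LinearMap.ker (g' ∘ₗ b.toLinearMap) := by
    ext y
    simp only [LinearMap.mem_ker, LinearMap.comp_apply, LinearEquiv.coe_coe]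
    rw [h y, h' (b y)]
    constructor
    · rintro ⟨x, rfl⟩
      exact ⟨a x, (hab x).symm⟩
    · rintro ⟨x, hx⟩
      refine ⟨a.symm x, b.injective ?_⟩
      rw [hab, a.apply_symm_apply, hx]
  exact ⟨(g.quotKerEquivOfSurjective hg).symm ≪≫ₗ Submodule.quotEquivOfEq _ _ hker ≪≫ₗ
    (g' ∘ₗ b.toLinearMap).quotKerEquivOfSurjective (hg'.comp b.surjective)⟩

variable (S) in
/-- Local cohomology commutes with flat base change. -/
theorem nonempty_baseChange_equiv [IsNoetherianRing R] (I : Ideal R) (i : ℕ) (A : Type u)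
    [AddCommGroup A] [Module R A] :
    Nonempty (S ⊗[R] LocCoh I i A ≃ₗ[S] LocCoh (I.map (algebraMap R S)) i (S ⊗[R] A)) := by
  match i with
  | 0 => exact ⟨(exists_baseChange_equiv_zero S A I).choose⟩
  | 1 => 
    obtain ⟨E, _, _, f, hf, hE⟩ := exists_injective_embedding R A
    have hfg : Function.Exact f (LinearMap.range f).mkQ := LinearMap.exact_map_mkQ_range f
    have hg := (LinearMap.range f).mkQ_surjective
    generalize (LinearMap.range f).mkQ = g at hfg hg
    obtain ⟨δ, h₁, h₂⟩ := exists_connecting (J := I) 0 hf hfg hg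
    obtain ⟨δ', h₁', h₂'⟩ := exists_connecting (J := I.map (algebraMap R S)) 0
      (baseChange_injective S hf) (baseChange_exact S hfg) (baseChange_surjective S hg)
    have := subsingleton_of_injective (J := I) (A := E) 0
    have := subsingleton_baseChange_of_injective (R := R) (S := S) (C := E) I 0
    obtain ⟨a, ha⟩ := exists_baseChange_equiv_zero S E I
    obtain ⟨b, hb⟩ := exists_baseChange_equiv_zero S (E ⧸ LinearMap.range f) I
    refine nonempty_equiv_of_exact (baseChange_exact S h₁)
      (baseChange_surjective S fun y ↦ (h₂ y).1 (Subsingleton.elim _ _)) h₁'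
      (fun y ↦ (h₂' y).1 (Subsingleton.elim _ _)) a b fun x ↦ eval_injective _ ?_
    rw [hb, eval_map, ha, ← LinearMap.comp_apply, ← LinearMap.comp_apply,
      ← LinearMap.baseChange_comp, ← LinearMap.baseChange_comp]
    congr 2
    ext y
    exact eval_map _ _ _
  | i + 1 + 1 =>
    obtain ⟨E, _, _, f, hf, hE⟩ := exists_injective_embedding R A
    have hfg : Function.Exact f (LinearMap.range f).mkQ := LinearMap.exact_map_mkQ_range f
    have hg := (LinearMap.range f).mkQ_surjective
    obtain ⟨e⟩ := nonempty_baseChange_equiv I (i + 1) (E ⧸ LinearMap.range f)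
    generalize (LinearMap.range f).mkQ = g at hfg hg
    obtain ⟨δ, h₁, h₂⟩ := exists_connecting (J := I) (i + 1) hf hfg hg
    obtain ⟨δ', h₁', h₂'⟩ := exists_connecting (J := I.map (algebraMap R S)) (i + 1)
      (baseChange_injective S hf) (baseChange_exact S hfg) (baseChange_surjective S hg)
    have := subsingleton_of_injective (J := I) (A := E) i
    have := subsingleton_of_injective (J := I) (A := E) (i + 1)
    have := subsingleton_baseChange_of_injective (R := R) (S := S) (C := E) I i
    have := subsingleton_baseChange_of_injective (R := R) (S := S) (C := E) I (i + 1)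
    have hδ : Function.Bijective δ := by
      refine ⟨(injective_iff_map_eq_zero _).2 fun x hx ↦ ?_,
        fun y ↦ (h₂ y).1 (Subsingleton.elim _ _)⟩
      obtain ⟨y, rfl⟩ := (h₁ x).1 hx
      rw [Subsingleton.elim y 0, map_zero]
    have hδ' : Function.Bijective δ' := by
      refine ⟨(injective_iff_map_eq_zero _).2 fun x hx ↦ ?_,
        fun y ↦ (h₂' y).1 (Subsingleton.elim _ _)⟩
      obtain ⟨y, rfl⟩ := (h₁' x).1 hx
      rw [Subsingleton.elim y 0, map_zero]
    exact ⟨((LinearEquiv.ofBijective δ hδ).baseChange R S _ _).symm ≪≫ₗ e ≪≫ₗ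
      LinearEquiv.ofBijective δ' hδ'⟩

end LocCoh

section Artinian

variable {S : Type*} [CommRing S] {A : Type*} [AddCommGroup A] [Module S A]

/-- A module in which every element is killed by a power of `x` is Artinian as soon as the kernel
of multiplication by `x` is. -/
theorem isArtinian_of_isArtinian_ker_lsmul (x : S) (hA : ∀ y : A, ∃ t : ℕ, x ^ t • y = 0)
    [hK : IsArtinian S (LinearMap.ker (LinearMap.lsmul S A x))] : IsArtinian S A := by
  rw [← monotone_stabilizes_iff_artinian]
  intro X
  let Y : ℕ → Submodule S A := fun j ↦ OrderDual.ofDual (X j)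
  have hX : ∀ {i j : ℕ}, i ≤ j → Y j ≤ Y i := fun h ↦ X.monotone h
  let K := LinearMap.ker (LinearMap.lsmul S A x)
  let W : ℕ → ℕ → Submodule S K := fun j t ↦
    ((Y j).map (LinearMap.lsmul S A (x ^ t))).comap K.subtype
  have hW₁ : ∀ {i j t : ℕ}, i ≤ j → W j t ≤ W i t := fun h ↦
    Submodule.comap_mono (Submodule.map_mono (hX h))
  have hW₂ : ∀ {j s t : ℕ}, s ≤ t → W j t ≤ W j s := by
    rintro j s t h y ⟨z, hz, hy⟩
    obtain ⟨r, rfl⟩ := Nat.exists_eq_add_of_le h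
    refine ⟨x ^ r • z, Submodule.smul_mem _ _ hz, ?_⟩
    rw [← hy]
    simp [smul_smul, pow_add, mul_comm]
  obtain ⟨k, hk⟩ := IsArtinian.monotone_stabilizes (R := S) (M := K)
    ⟨fun n ↦ W n n, fun i j h ↦ (hW₂ h).trans (hW₁ h)⟩
  have hcol : ∀ t, ∃ n, ∀ m, n ≤ m → W n t = W m t := fun t ↦
    IsArtinian.monotone_stabilizes (R := S) (M := K) ⟨fun n ↦ W n t, fun i j h ↦ hW₁ h⟩
  choose n hn using hcol
  let N := max k ((Finset.range k).sup n)
  have hN : ∀ j t, N ≤ j → W N t ≤ W j t := by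
    intro j t hj
    rcases lt_or_ge t k with htk | htk
    · have hnN : n t ≤ N := (Finset.le_sup (Finset.mem_range.2 htk)).trans (le_max_right _ _)
      rw [← hn t N hnN, ← hn t j (hnN.trans hj)]
    · calc W N t ≤ W k k := (hW₁ (le_max_left _ _)).trans (hW₂ htk)
        _ = W (max j t) (max j t) := hk _ (htk.trans (le_max_right _ _))
        _ ≤ W j t := (hW₁ (le_max_left _ _)).trans (hW₂ (le_max_right _ _))
  refine ⟨N, fun j hj ↦ congrArg OrderDual.toDual (le_antisymm (a := Y N) (b := Y j) ?_ (hX hj))⟩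
  have key : ∀ s : ℕ, ∀ y ∈ Y N, x ^ s • y = 0 → y ∈ Y j := by
    intro s
    induction s with
    | zero =>
      intro y _ hy
      rw [pow_zero, one_smul] at hy
      rw [hy]
      exact zero_mem _
    | succ s ih =>
      intro y hy hxy
      have hyK : x ^ s • y ∈ K := by
        rw [LinearMap.mem_ker, LinearMap.lsmul_apply, smul_smul, ← pow_succ', hxy]
      obtain ⟨z, hz, hzy⟩ := hN j s hj (show ⟨x ^ s • y, hyK⟩ ∈ W N s from ⟨y, hy, rfl⟩)
      rw [← sub_add_cancel y z]
      refine add_mem (ih _ (sub_mem hy (hX hj hz)) ?_) hz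
      rw [smul_sub, sub_eq_zero]
      exact hzy.symm
  intro y hy
  obtain ⟨s, hs⟩ := hA y
  exact key s y hy hs

/-- Away from finitely many nonmaximal primes, multiplication by `x` on an Artinian module has
image containing a multiple of the module by a power of the maximal ideal. -/
theorem exists_finset_prime_forall_pow_smul_le [IsNoetherianRing S] [IsLocalRing S]
    [IsArtinian S A] :
    ∃ F : Finset (Ideal S), (∀ p ∈ F, p.IsPrime ∧ p ≠ maximalIdeal S) ∧
      ∀ x : S, (∀ p ∈ F, x ∉ p) → ∃ k : ℕ, ∀ a ∈ maximalIdeal S ^ k, ∀ y : A, ∃ z : A,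
        x • z = a • y := by
  classical
  suffices h : ∀ B : Submodule S A, ∃ F : Finset (Ideal S),
      (∀ p ∈ F, p.IsPrime ∧ p ≠ maximalIdeal S) ∧ ∀ x : S, (∀ p ∈ F, x ∉ p) →
        ∃ k : ℕ, ∀ a ∈ maximalIdeal S ^ k, ∀ y ∈ B, ∃ z ∈ B, x • z = a • y by
    obtain ⟨F, hF, h⟩ := h ⊤
    refine ⟨F, hF, fun x hx ↦ ?_⟩
    obtain ⟨k, hk⟩ := h x hx
    refine ⟨k, fun a ha y ↦ ?_⟩
    obtain ⟨z, -, hz⟩ := hk a ha y trivial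
    exact ⟨z, hz⟩
  intro B
  induction B using IsArtinian.induction with | hgt B ih => ?_
  by_cases hB : ∃ B₁ B₂ : Submodule S A, B₁ < B ∧ B₂ < B ∧ B = B₁ ⊔ B₂
  · obtain ⟨B₁, B₂, h₁, h₂, rfl⟩ := hB
    obtain ⟨F₁, hF₁, H₁⟩ := ih _ h₁
    obtain ⟨F₂, hF₂, H₂⟩ := ih _ h₂
    refine ⟨F₁ ∪ F₂, fun p hp ↦ ?_, fun x hx ↦ ?_⟩
    · exact (Finset.mem_union.1 hp).elim (hF₁ p) (hF₂ p)
    · obtain ⟨k₁, hk₁⟩ := H₁ x fun p hp ↦ hx p (Finset.mem_union_left _ hp)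
      obtain ⟨k₂, hk₂⟩ := H₂ x fun p hp ↦ hx p (Finset.mem_union_right _ hp)
      refine ⟨max k₁ k₂, fun a ha y hy ↦ ?_⟩
      obtain ⟨y₁, hy₁, y₂, hy₂, rfl⟩ := Submodule.mem_sup.1 hy
      obtain ⟨z₁, hz₁, e₁⟩ := hk₁ a (Ideal.pow_le_pow_right (le_max_left _ _) ha) y₁ hy₁
      obtain ⟨z₂, hz₂, e₂⟩ := hk₂ a (Ideal.pow_le_pow_right (le_max_right _ _) ha) y₂ hy₂
      exact ⟨z₁ + z₂, Submodule.add_mem_sup hz₁ hz₂, by rw [smul_add, smul_add, e₁, e₂]⟩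
  push Not at hB
  have dich : ∀ x : S, (∀ y ∈ B, ∃ z ∈ B, x • z = y) ∨ ∃ t : ℕ, ∀ y ∈ B, x ^ t • y = 0 := by
    intro x
    let g : ℕ → Submodule S A := fun t ↦ B.map (LinearMap.lsmul S A (x ^ t))
    have hg : ∀ {s t : ℕ}, s ≤ t → g t ≤ g s := by
      rintro s t h _ ⟨z, hz, rfl⟩
      obtain ⟨r, rfl⟩ := Nat.exists_eq_add_of_le h
      exact ⟨x ^ r • z, Submodule.smul_mem _ _ hz, by simp [smul_smul, pow_add, mul_comm]⟩
    obtain ⟨n, hn⟩ := IsArtinian.monotone_stabilizes (R := S) (M := A) ⟨g, fun i j h ↦ hg h⟩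
    have hg0 : g 0 = B := by
      ext y
      simp [g]
    by_cases h1 : g (n + 1) = B
    · left
      intro y hy
      rw [← h1] at hy
      obtain ⟨z, hz, rfl⟩ := hy
      exact ⟨x ^ n • z, Submodule.smul_mem _ _ hz, by simp [smul_smul, pow_succ']⟩
    · right
      refine ⟨n + 1, ?_⟩
      let Z : Submodule S A := B ⊓ LinearMap.ker (LinearMap.lsmul S A (x ^ (n + 1)))
      have hsup : B = g (n + 1) ⊔ Z := by
        apply le_antisymm
        · intro y hy
          have hy' : x ^ (n + 1) • y ∈ g (n + 1 + (n + 1)) := by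
            have e : g (n + 1) = g (n + 1 + (n + 1)) :=
              (hn (n + 1) (by lia)).symm.trans (hn (n + 1 + (n + 1)) (by lia))
            rw [← e]
            exact ⟨y, hy, rfl⟩
          obtain ⟨z, hz, hzy⟩ := hy'
          rw [← add_sub_cancel (x ^ (n + 1) • z) y]
          refine Submodule.add_mem_sup ⟨z, hz, rfl⟩
            ⟨sub_mem hy (Submodule.smul_mem _ _ hz), ?_⟩
          rw [SetLike.mem_coe, LinearMap.mem_ker, LinearMap.lsmul_apply, smul_sub, smul_smul,
            ← pow_add, sub_eq_zero]
          exact hzy.symm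
        · exact sup_le ((hg (Nat.zero_le _)).trans hg0.le) inf_le_left
      have hlt : g (n + 1) < B := lt_of_le_of_ne ((hg (Nat.zero_le _)).trans hg0.le) h1
      have hZ : Z = B := by
        by_contra hne
        exact hB _ _ hlt (lt_of_le_of_ne inf_le_left hne) hsup
      intro y hy
      rw [← hZ] at hy
      exact hy.2
  rcases eq_or_ne B ⊥ with rfl | hB0
  · refine ⟨∅, by simp, fun x _ ↦ ⟨0, fun a _ y hy ↦ ⟨0, zero_mem _, ?_⟩⟩⟩
    rw [(Submodule.mem_bot S).1 hy, smul_zero, smul_zero]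
  let P : Ideal S := B.annihilator.radical
  have hP : ∀ x, x ∈ P ↔ ∃ t : ℕ, ∀ y ∈ B, x ^ t • y = 0 := fun x ↦ by
    simp only [P, Ideal.mem_radical_iff, Submodule.mem_annihilator]
  have hsurj : ∀ x ∉ P, ∀ y ∈ B, ∃ z ∈ B, x • z = y := fun x hx ↦
    (dich x).resolve_right fun h ↦ hx ((hP x).2 h)
  have hPprime : P.IsPrime := by
    refine ⟨fun h ↦ hB0 ?_, fun {a b} hab ↦ ?_⟩
    · obtain ⟨t, ht⟩ := (hP 1).1 (h ▸ trivial)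
      exact (Submodule.eq_bot_iff _).2 fun y hy ↦ by simpa using ht y hy
    · by_contra! hn
      have hs : ∀ t : ℕ, ∀ y ∈ B, ∃ z ∈ B, (a * b) ^ t • z = y := by
        intro t
        induction t with
        | zero => exact fun y hy ↦ ⟨y, hy, by simp⟩
        | succ t ih =>
          intro y hy
          obtain ⟨z₁, h₁, rfl⟩ := ih y hy
          obtain ⟨z₂, h₂, rfl⟩ := hsurj a hn.1 z₁ h₁
          obtain ⟨z₃, h₃, rfl⟩ := hsurj b hn.2 z₂ h₂
          exact ⟨z₃, h₃, by rw [smul_smul a b, smul_smul, pow_succ]⟩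
      obtain ⟨t, ht⟩ := (hP _).1 hab
      refine hB0 ((Submodule.eq_bot_iff _).2 fun y hy ↦ ?_)
      obtain ⟨z, hz, rfl⟩ := hs t y hy
      exact ht z hz
  by_cases hPm : P = maximalIdeal S
  · obtain ⟨k, hk⟩ := Ideal.exists_radical_pow_le_of_fg B.annihilator
      (IsNoetherian.noetherian _)
    refine ⟨∅, by simp, fun x _ ↦ ⟨k, fun a ha y hy ↦ ⟨0, zero_mem _, ?_⟩⟩⟩
    rw [smul_zero]
    rw [← hPm] at ha
    exact (Submodule.mem_annihilator.1 (hk ha) y hy).symm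
  · refine ⟨{P}, by simpa using ⟨hPprime, hPm⟩, fun x hx ↦ ⟨0, fun a _ y hy ↦ ?_⟩⟩
    exact hsurj x (hx P (Finset.mem_singleton_self _)) _ (Submodule.smul_mem _ _ hy)

end Artinian

namespace LocCoh

open scoped Pointwise

variable {S : Type u} [CommRing S] {J : Ideal S} {A : Type u} [AddCommGroup A] [Module S A]

lemma exists_smul_pow_eq_zero {x : S} {k : ℕ} (hx : x ^ k ∈ J) {i : ℕ} (y : LocCoh J i A) :
    ∃ t : ℕ, x ^ t • y = 0 := by
  obtain ⟨t, ht⟩ := exists_pow_smul_eq_zero y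
  exact ⟨k * t, ht _ (by rw [pow_mul]; exact Ideal.pow_mem_pow hx t)⟩

lemma injective_smul_id {x : S} (hx : IsSMulRegular A x) :
    Function.Injective (x • LinearMap.id : A →ₗ[S] A) := hx

lemma exact_smul_mkQ (x : S) :
    Function.Exact (x • LinearMap.id : A →ₗ[S] A) (Submodule.mkQ (x • ⊤ : Submodule S A)) := by
  intro y
  rw [Submodule.mkQ_apply, Submodule.Quotient.mk_eq_zero, Submodule.mem_smul_pointwise_iff_exists]
  simp

lemma map_mkQ_eq_zero_iff {x : S} (hx : IsSMulRegular A x) (i : ℕ) (y : LocCoh J i A) :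
    map J i (Submodule.mkQ (x • ⊤ : Submodule S A)) y = 0 ↔ ∃ z, x • z = y := by
  rw [map_exact i (injective_smul_id hx) (exact_smul_mkQ x) (Submodule.mkQ_surjective _) y]
  simp [map_smul_id]

lemma exists_connecting_smul {x : S} (hx : IsSMulRegular A x) (i : ℕ) :
    ∃ δ : LocCoh J i (QuotSMulTop x A) →ₗ[S] LocCoh J (i + 1) A,
      (∀ y, δ y = 0 ↔ ∃ z, map J i (Submodule.mkQ (x • ⊤ : Submodule S A)) z = y) ∧
      ∀ y : LocCoh J (i + 1) A, x • y = 0 ↔ ∃ z, δ z = y := by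
  obtain ⟨δ, h₁, h₂⟩ := exists_connecting (J := J) i (injective_smul_id hx) (exact_smul_mkQ x)
    (Submodule.mkQ_surjective _)
  refine ⟨δ, h₁, fun y ↦ ?_⟩
  have := h₂ y
  rwa [map_smul_id] at this

lemma subsingleton_zero_of_isSMulRegular {x : S} {k : ℕ} (hk : x ^ k ∈ J)
    (hx : IsSMulRegular A x) : Subsingleton (LocCoh J 0 A) := by
  refine subsingleton_of_forall_eq 0 fun y ↦ ?_
  obtain ⟨t, ht⟩ := exists_smul_pow_eq_zero hk y
  refine eval_injective J (hx.pow t ?_)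
  simp only [map_zero, smul_zero, ← map_smul, ht]

lemma subsingleton_of_isSMulRegular {x : S} {k : ℕ} (hk : x ^ k ∈ J) {i : ℕ}
    (hx : IsSMulRegular A x) [Subsingleton (LocCoh J i (QuotSMulTop x A))] :
    Subsingleton (LocCoh J (i + 1) A) := by
  obtain ⟨δ, -, hδ⟩ := exists_connecting_smul (J := J) hx i
  have h0 : ∀ y : LocCoh J (i + 1) A, x • y = 0 → y = 0 := fun y hy ↦ by
    obtain ⟨z, rfl⟩ := (hδ y).1 hy
    rw [Subsingleton.elim z 0, map_zero]
  refine subsingleton_of_forall_eq 0 fun y ↦ ?_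
  obtain ⟨t, ht⟩ := exists_smul_pow_eq_zero hk y
  induction t with
  | zero => simpa using ht
  | succ t ih =>
    refine ih (h0 _ ?_)
    rwa [smul_smul, ← pow_succ']

lemma isSMulRegular_quotient_prime {p : Ideal S} (hp : p.IsPrime) {x : S} (hx : x ∉ p)
    (e : A ≃ₗ[S] S ⧸ p) : IsSMulRegular A x := by
  rw [e.isSMulRegular_congr, isSMulRegular_iff_right_eq_zero_of_smul]
  intro y hy
  obtain ⟨r, rfl⟩ := Ideal.Quotient.mk_surjective y
  have hxr : x * r ∈ p := Ideal.Quotient.eq_zero_iff_mem.1 hy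
  exact Ideal.Quotient.eq_zero_iff_mem.2 ((hp.mem_or_mem hxr).resolve_left hx)

variable [IsNoetherianRing S] [IsLocalRing S]

omit [IsNoetherianRing S] in
lemma torsion_eq_top_of_equiv_residueField (hJ : J ≤ maximalIdeal S)
    (e : A ≃ₗ[S] S ⧸ maximalIdeal S) : torsion J A = ⊤ := by
  refine eq_top_iff.2 fun y _ ↦ ⟨1, fun a ha ↦ e.injective ?_⟩
  rw [pow_one] at ha
  obtain ⟨r, hr⟩ := Ideal.Quotient.mk_surjective (e y)
  rw [map_smul, map_zero, ← hr]
  exact Ideal.Quotient.eq_zero_iff_mem.2 (Ideal.mul_mem_right _ _ (hJ ha))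

/-- Local cohomology of a finite module supported at the maximal ideal is Artinian. -/
theorem isArtinian {k : ℕ} (hJ : J ≤ maximalIdeal S) (hk : maximalIdeal S ^ k ≤ J) (i : ℕ)
    [Module.Finite S A] : IsArtinian S (LocCoh J i A) := by
  induction i generalizing A with
  | zero => ?_
  | succ i ih => ?_
  all_goals
    induction ‹Module.Finite S A› using
      IsNoetherianRing.induction_on_isQuotientEquivQuotientPrime S with
    | subsingleton N =>
      have := subsingleton_of_subsingleton J (A := N)
      infer_instance
    | exact N₁ N₂ N₃ f g hf hg hfg h₁ h₃ =>
      exact isArtinian_of_range_eq_ker (map J _ f) (map J _ g)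
        (map_exact _ hf hfg hg).linearMap_ker_eq.symm
    | quotient N p e => ?_
  all_goals
    rcases eq_or_ne p.1 (maximalIdeal S) with hp | hp
  · rw [hp] at e
    have : IsArtinian S N := by
      have : IsSimpleModule S (S ⧸ maximalIdeal S) :=
        isSimpleModule_iff_isCoatom.2 (Ideal.isMaximal_def.1 inferInstance)
      exact isArtinian_of_linearEquiv e.symm
    exact isArtinian_of_injective _ (eval_injective J)
  · obtain ⟨x, hxm, hxp⟩ := SetLike.exists_of_lt
      (lt_of_le_of_ne (le_maximalIdeal p.2.ne_top) hp)
    have := subsingleton_zero_of_isSMulRegular (hk (Ideal.pow_mem_pow hxm k))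
      (isSMulRegular_quotient_prime p.2 hxp e)
    infer_instance
  · rw [hp] at e
    have := subsingleton_of_torsion i (torsion_eq_top_of_equiv_residueField hJ e)
    infer_instance
  · obtain ⟨x, hxm, hxp⟩ := SetLike.exists_of_lt
      (lt_of_le_of_ne (le_maximalIdeal p.2.ne_top) hp)
    have hx := isSMulRegular_quotient_prime p.2 hxp e
    obtain ⟨δ, -, hδ⟩ := exists_connecting_smul (J := J) hx i
    have := ih (A := QuotSMulTop x N)
    have : LinearMap.range δ = LinearMap.ker (LinearMap.lsmul S (LocCoh J (i + 1) N) x) := by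
      ext y
      exact (hδ y).symm
    have : IsArtinian S (LinearMap.ker (LinearMap.lsmul S (LocCoh J (i + 1) N) x)) := by
      rw [← this]
      infer_instance
    exact isArtinian_of_isArtinian_ker_lsmul x
      (exists_smul_pow_eq_zero (hk (Ideal.pow_mem_pow hxm k)))

/-- Local cohomology vanishes above the dimension of the module. -/
theorem subsingleton_of_supportDim_lt {k : ℕ} (hJ : J ≤ maximalIdeal S)
    (hk : maximalIdeal S ^ k ≤ J) (i : ℕ) [Module.Finite S A] (hA : Module.supportDim S A < i) :
    Subsingleton (LocCoh J i A) := by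
  induction i generalizing A with
  | zero =>
    have : Subsingleton A := by
      by_contra h
      have h' := not_subsingleton_iff_nontrivial.1 h
      have : Nonempty (Module.support S A) := Module.nonempty_support_of_nontrivial.to_subtype
      exact absurd hA (not_lt.2 Order.krullDim_nonneg)
    exact subsingleton_of_subsingleton J 0
  | succ i ih =>
    induction ‹Module.Finite S A› using
      IsNoetherianRing.induction_on_isQuotientEquivQuotientPrime S with
    | subsingleton N => exact subsingleton_of_subsingleton J _
    | exact N₁ N₂ N₃ f g hf hg hfg h₁ h₃ =>
      have := h₁ ((Module.supportDim_le_of_injective f hf).trans_lt hA)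
      have := h₃ ((Module.supportDim_le_of_surjective g hg).trans_lt hA)
      exact subsingleton_of_exact (map_exact (J := J) (i + 1) hf hfg hg)
    | quotient N p e =>
      rcases eq_or_ne p.1 (maximalIdeal S) with hp | hp
      · rw [hp] at e
        exact subsingleton_of_torsion i (torsion_eq_top_of_equiv_residueField hJ e)
      · obtain ⟨x, hxm, hxp⟩ := SetLike.exists_of_lt
          (lt_of_le_of_ne (le_maximalIdeal p.2.ne_top) hp)
        have hx := isSMulRegular_quotient_prime p.2 hxp e
        have := ih (A := QuotSMulTop x N) (by
          have h := Module.supportDim_quotSMulTop_succ_eq_supportDim hx hxm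
          rw [← h, Nat.cast_add, Nat.cast_one] at hA
          exact lt_of_add_lt_add_right hA)
        exact subsingleton_of_isSMulRegular (hk (Ideal.pow_mem_pow hxm k)) hx

end LocCoh

section Quotient

variable {R : Type*} [CommRing R] [IsNoetherianRing R] {A : Type*} [AddCommGroup A] [Module R A]
  [Module.Finite R A]

omit [IsNoetherianRing R] in
lemma Module.exists_prime_supportDim_le {d : ℕ} (hd : Module.supportDim R A = d) :
    ∃ p : PrimeSpectrum R, annihilator R A ≤ p.1 ∧ d ≤ ringKrullDim (R ⧸ p.1) := by
  rw [supportDim_eq_ringKrullDim_quotient_annihilator, ringKrullDim_quotient] at hd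
  obtain ⟨l, hl⟩ := Order.le_krullDim_iff.1 hd.ge
  refine ⟨l.head.1, l.head.2, ?_⟩
  rw [ringKrullDim_quotient]
  refine Order.le_krullDim_iff.2 ⟨⟨l.length, fun i ↦ ⟨(l i).1, ?_⟩, fun i ↦ l.step i⟩, hl⟩
  exact l.monotone (Fin.zero_le _)

omit [IsNoetherianRing R] in
/-- A finite module has a quotient of the same dimension which is torsion-free outside of
a prime. -/
lemma Module.exists_quotient_isSMulRegular {d : ℕ} (hd : Module.supportDim R A = d) :
    ∃ (p : PrimeSpectrum R) (K : Submodule R A), d ≤ ringKrullDim (R ⧸ p.1) ∧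
      (∀ x ∉ p.1, IsSMulRegular (A ⧸ K) x) ∧ Module.supportDim R (A ⧸ K) = d := by
  obtain ⟨p, hp, hdp⟩ := Module.exists_prime_supportDim_le hd
  let K : Submodule R A := Submodule.torsion' R A p.1.primeCompl
  have hreg : ∀ x ∉ p.1, IsSMulRegular (A ⧸ K) x := by
    intro x hx
    rw [isSMulRegular_iff_right_eq_zero_of_smul]
    intro y hy
    obtain ⟨y, rfl⟩ := K.mkQ_surjective y
    rw [← map_smul, Submodule.mkQ_apply, Submodule.Quotient.mk_eq_zero] at hy
    obtain ⟨s, hs⟩ := hy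
    rw [Submodule.mkQ_apply, Submodule.Quotient.mk_eq_zero]
    refine ⟨s * ⟨x, hx⟩, ?_⟩
    rw [mul_smul]
    exact hs
  refine ⟨p, K, hdp, hreg, le_antisymm
    (hd ▸ supportDim_le_of_surjective _ K.mkQ_surjective) (hdp.trans ?_)⟩
  have hann : annihilator R (A ⧸ K) ≤ p.1 := by
    intro a ha
    obtain ⟨T, hT⟩ := Module.finite_def.1 ‹Module.Finite R A›
    have h : ∀ y : A, ∃ s : p.1.primeCompl, (s : R) • a • y = 0 := by
      intro y
      have : a • K.mkQ y = 0 := Module.mem_annihilator.1 ha _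
      rw [← map_smul, Submodule.mkQ_apply, Submodule.Quotient.mk_eq_zero] at this
      exact this
    choose s hs using h
    have hmem : (∏ y ∈ T, (s y : R)) * a ∈ annihilator R A := by
      rw [Module.mem_annihilator]
      intro y
      have hy : y ∈ Submodule.span R (T : Set A) := hT ▸ trivial
      induction hy using Submodule.span_induction with
      | mem y hy =>
        rw [mul_smul]
        obtain ⟨c, hc⟩ := Finset.dvd_prod_of_mem (fun y ↦ (s y : R)) hy
        rw [hc, mul_comm, mul_smul, hs, smul_zero]
      | zero => exact smul_zero _
      | add y z _ _ hy hz => rw [smul_add, hy, hz, add_zero]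
      | smul r y _ hy => rw [smul_comm, hy, smul_zero]
    refine (p.2.mem_or_mem (hp hmem)).resolve_left fun h ↦ ?_
    obtain ⟨y, -, hy⟩ := (p.2.prod_mem_iff).1 h
    exact (s y).2 hy
  rw [supportDim_eq_ringKrullDim_quotient_annihilator]
  exact ringKrullDim_le_of_surjective (Ideal.Quotient.factor hann)
    (Ideal.Quotient.factor_surjective hann)

end Quotient

namespace LocCoh

open scoped Pointwise

variable {R : Type u} [CommRing R] [IsNoetherianRing R] [IsLocalRing R]
  {A : Type u} [AddCommGroup A] [Module R A] [Module.Finite R A]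

lemma map_mkQ_surjective {d : ℕ} (hd : Module.supportDim R A = d) (K : Submodule R A) :
    Function.Surjective (map (maximalIdeal R) d K.mkQ) := by
  obtain ⟨δ, h, -⟩ := exists_connecting (J := maximalIdeal R) d K.subtype_injective
    (LinearMap.exact_subtype_mkQ K) K.mkQ_surjective
  have : Subsingleton (LocCoh (maximalIdeal R) (d + 1) K) := by
    refine subsingleton_of_supportDim_lt (k := 1) le_rfl (pow_one _).le (d + 1) ?_
    refine (Module.supportDim_le_of_injective _ K.subtype_injective).trans_lt ?_
    rw [hd]
    exact_mod_cast Nat.lt_succ_self d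
  exact fun y ↦ (h y).1 (Subsingleton.elim _ _)

lemma supportDim_quotSMulTop {d : ℕ} (hd : Module.supportDim R A = (d + 1 : ℕ)) {x : R}
    (hx : IsSMulRegular A x) (hxm : x ∈ maximalIdeal R) :
    Module.supportDim R (QuotSMulTop x A) = d := by
  have h := Module.supportDim_quotSMulTop_succ_eq_supportDim hx hxm
  rw [hd, Nat.cast_add, Nat.cast_one] at h
  generalize Module.supportDim R (QuotSMulTop x A) = s at h ⊢
  induction s using WithBot.recBotCoe with
  | bot =>
    rw [WithBot.bot_add] at h
    exact absurd h.symm (by exact_mod_cast WithBot.coe_ne_bot)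
  | coe s =>
    norm_cast at h ⊢
    exact ENat.add_left_injective_of_ne_top ENat.one_ne_top (by simpa using h)

omit [IsNoetherianRing R] in
lemma ne_maximalIdeal_of_le_ringKrullDim {d : ℕ} {p : Ideal R}
    (h : (d + 1 : ℕ) ≤ ringKrullDim (R ⧸ p)) : p ≠ maximalIdeal R := by
  rintro rfl
  let _ := Ideal.Quotient.field (maximalIdeal R)
  rw [ringKrullDim_eq_zero_of_field] at h
  norm_cast at h

/-- If the top local cohomology in positive dimension is killed by a power of the maximal ideal,
then it vanishes after passing to a quotient of the same dimension. -/
lemma exists_quotient_subsingleton {d k : ℕ} (hd : Module.supportDim R A = (d + 1 : ℕ))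
    (h : ∀ a ∈ maximalIdeal R ^ k, ∀ y : LocCoh (maximalIdeal R) (d + 1) A, a • y = 0) :
    ∃ K : Submodule R A, Module.supportDim R (A ⧸ K) = (d + 1 : ℕ) ∧
      Subsingleton (LocCoh (maximalIdeal R) (d + 1) (A ⧸ K)) := by
  obtain ⟨p, K, hp, hreg, hK⟩ := Module.exists_quotient_isSMulRegular hd
  refine ⟨K, hK, ?_⟩
  obtain ⟨x, hxm, hxp⟩ := SetLike.exists_of_lt
    (lt_of_le_of_ne (le_maximalIdeal p.2.ne_top) (ne_maximalIdeal_of_le_ringKrullDim hp))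
  have hx := hreg x hxp
  have : Subsingleton (LocCoh (maximalIdeal R) (d + 1) (QuotSMulTop x (A ⧸ K))) := by
    refine subsingleton_of_supportDim_lt (k := 1) le_rfl (pow_one _).le (d + 1) ?_
    rw [supportDim_quotSMulTop hK hx hxm]
    exact_mod_cast Nat.lt_succ_self d
  have hsurj : ∀ t : ℕ, ∀ y : LocCoh (maximalIdeal R) (d + 1) (A ⧸ K), ∃ z, x ^ t • z = y := by
    intro t
    induction t with
    | zero => exact fun y ↦ ⟨y, by simp⟩
    | succ t ih =>
      intro y
      obtain ⟨z, rfl⟩ := ih y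
      obtain ⟨w, rfl⟩ := (map_mkQ_eq_zero_iff hx (d + 1) z).1 (Subsingleton.elim _ _)
      exact ⟨w, by rw [smul_smul, pow_succ]⟩
  refine subsingleton_of_forall_eq 0 fun y ↦ ?_
  obtain ⟨z, rfl⟩ := hsurj k y
  obtain ⟨w, rfl⟩ := map_mkQ_surjective hd K z
  rw [← map_smul, h _ (Ideal.pow_mem_pow hxm k), map_zero]

/-- Grothendieck's nonvanishing theorem. -/
theorem not_subsingleton_of_supportDim_eq {d : ℕ} (hd : Module.supportDim R A = d) :
    ¬ Subsingleton (LocCoh (maximalIdeal R) d A) := by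
  intro hH
  induction d generalizing A with
  | zero =>
    have hA : Nontrivial A := by
      rw [← Module.supportDim_ne_bot_iff_nontrivial R, hd]
      exact WithBot.coe_ne_bot
    obtain ⟨q, hq⟩ := associatedPrimes.nonempty R A
    obtain ⟨hqp, y, hy⟩ := isAssociatedPrime_iff.1 hq
    have hqs : (⟨q, hqp⟩ : PrimeSpectrum R) ∈ Module.support R A :=
      Module.mem_support_iff_of_finite.2
        (Submodule.annihilator_top (R := R) (M := A) ▸ hq.annihilator_le)
    rw [support_of_supportDim_eq_zero R A (by simpa using hd)] at hqs
    have hy0 : y = 0 := by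
      have hyt : y ∈ torsion (maximalIdeal R) A := by
        refine ⟨1, fun a ha ↦ ?_⟩
        rw [pow_one] at ha
        have haq : a ∈ q := hqs ha
        rw [hy] at haq
        simpa using Submodule.mem_colon_singleton.1 haq
      rw [← range_eval] at hyt
      obtain ⟨z, rfl⟩ := hyt
      rw [Subsingleton.elim z 0, map_zero]
    refine hqp.ne_top ((Ideal.eq_top_iff_one _).2 ?_)
    rw [hy, hy0]
    simp
  | succ d ih =>
    obtain ⟨p, K, hp, hreg, hK⟩ := Module.exists_quotient_isSMulRegular hd
    have hpm := ne_maximalIdeal_of_le_ringKrullDim hp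
    have : Subsingleton (LocCoh (maximalIdeal R) (d + 1) (A ⧸ K)) :=
      (map_mkQ_surjective hd K).subsingleton
    have : IsArtinian R (LocCoh (maximalIdeal R) d (A ⧸ K)) :=
      isArtinian (k := 1) le_rfl (pow_one _).le d
    obtain ⟨F, hF, hFx⟩ := exists_finset_prime_forall_pow_smul_le (S := R)
      (A := LocCoh (maximalIdeal R) d (A ⧸ K))
    obtain ⟨x, hxm, hxp, hxF⟩ : ∃ x ∈ maximalIdeal R, x ∉ p.1 ∧ ∀ q ∈ F, x ∉ q := by
      classical
      by_contra! hcon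
      have hsub : (maximalIdeal R : Set R) ⊆
          ⋃ q ∈ (↑(insert p.1 F) : Set (Ideal R)), ((id q : Ideal R) : Set R) := by
        intro x hx
        simp only [Set.mem_iUnion, Finset.mem_coe, Finset.mem_insert, exists_prop]
        by_cases hxp : x ∈ p.1
        · exact ⟨p.1, Or.inl rfl, hxp⟩
        · obtain ⟨q, hq, hxq⟩ := hcon x hx hxp
          exact ⟨q, Or.inr hq, hxq⟩
      have hprime : ∀ q ∈ insert p.1 F, q.IsPrime ∧ q ≠ maximalIdeal R := fun q hq ↦
        (Finset.mem_insert.1 hq).elim (fun h ↦ h ▸ ⟨p.2, hpm⟩) (hF q)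
      obtain ⟨q, hq, hle⟩ :=
        (Ideal.subset_union_prime (f := id) ⊥ ⊥ fun q hq _ _ ↦ (hprime q hq).1).1 hsub
      exact (hprime q hq).2 (le_antisymm (le_maximalIdeal (hprime q hq).1.ne_top) hle)
    have hx := hreg x hxp
    have hN := supportDim_quotSMulTop hK hx hxm
    obtain ⟨δ, hδ, -⟩ := exists_connecting_smul (J := maximalIdeal R) hx d
    have hsurj : ∀ y : LocCoh (maximalIdeal R) d (QuotSMulTop x (A ⧸ K)),
        ∃ z, map (maximalIdeal R) d (Submodule.mkQ (x • ⊤ : Submodule R (A ⧸ K))) z = y :=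
      fun y ↦ (hδ y).1 (Subsingleton.elim _ _)
    cases d with
    | zero =>
      have := subsingleton_zero_of_isSMulRegular (J := maximalIdeal R) (k := 1)
        (by rwa [pow_one]) hx
      exact ih hN (Function.Surjective.subsingleton hsurj)
    | succ d =>
      obtain ⟨k, hk⟩ := hFx x hxF
      obtain ⟨K', hK', hs⟩ := exists_quotient_subsingleton (k := k) hN (by
        intro a ha y
        obtain ⟨z, rfl⟩ := hsurj y
        rw [← map_smul]
        obtain ⟨w, hw⟩ := hk a ha z
        exact (map_mkQ_eq_zero_iff hx _ _).2 ⟨w, hw⟩)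
      exact ih hK' hs

end LocCoh

/-- A nonzero module over a local ring which is elementwise killed by powers of the maximal ideal
has a nonzero element killed by the maximal ideal. -/
lemma exists_ne_zero_forall_maximalIdeal_smul_eq_zero {R N : Type*} [CommRing R] [IsLocalRing R]
    [AddCommGroup N] [Module R N] [Nontrivial N]
    (h : ∀ y : N, ∃ t, ∀ a ∈ maximalIdeal R ^ t, a • y = 0) :
    ∃ y : N, y ≠ 0 ∧ ∀ a ∈ maximalIdeal R, a • y = 0 := by
  obtain ⟨x, hx⟩ := exists_ne (0 : N)
  obtain ⟨t, ht⟩ := h x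
  induction t generalizing x with
  | zero => exact absurd (by simpa using ht 1 (by simp)) hx
  | succ t ih =>
    by_cases hxt : ∀ a ∈ maximalIdeal R ^ t, a • x = 0
    · exact ih x hx hxt
    · push Not at hxt
      obtain ⟨a, ha, hax⟩ := hxt
      refine ⟨a • x, hax, fun b hb ↦ ?_⟩
      rw [smul_smul, mul_comm]
      exact ht _ (pow_succ (maximalIdeal R) t ▸ Ideal.mul_mem_mul ha hb)

lemma exists_injective_residueField {R N : Type*} [CommRing R] [IsLocalRing R]
    [AddCommGroup N] [Module R N] [Nontrivial N]
    (h : ∀ y : N, ∃ t, ∀ a ∈ maximalIdeal R ^ t, a • y = 0) :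
    ∃ f : (R ⧸ maximalIdeal R) →ₗ[R] N, Function.Injective f := by
  obtain ⟨y, hy, hm⟩ := exists_ne_zero_forall_maximalIdeal_smul_eq_zero h
  refine ⟨(maximalIdeal R).liftQ (LinearMap.toSpanSingleton R N y) hm,
    LinearMap.ker_eq_bot.1 (Submodule.ker_liftQ_eq_bot _ _ _ fun a ha ↦ ?_)⟩
  by_contra ham
  exact hy (((notMem_maximalIdeal.1 ham).smul_eq_zero).1 ha)

/-- In a Noetherian local ring, a proper ideal with zero-dimensional quotient contains a power of
the maximal ideal. -/
lemma exists_maximalIdeal_pow_le_of_ringKrullDim_quotient_eq_zero {S : Type*} [CommRing S]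
    [IsNoetherianRing S] [IsLocalRing S] {I : Ideal S} (h : ringKrullDim (S ⧸ I) = 0) :
    ∃ k, maximalIdeal S ^ k ≤ I := by
  have : Ring.KrullDimLE 0 (S ⧸ I) := (Ring.krullDimLE_iff).2 h.le
  have hrad : maximalIdeal S ≤ I.radical := by
    rw [Ideal.radical_eq_sInf]
    refine le_sInf fun q ⟨hIq, hq⟩ ↦ ?_
    have hker : RingHom.ker (Ideal.Quotient.mk I) ≤ q := by rwa [Ideal.mk_ker]
    have := Ideal.map_isPrime_of_surjective Ideal.Quotient.mk_surjective hker
    have hmax : (q.map (Ideal.Quotient.mk I)).IsMaximal := Ideal.IsPrime.isMaximal' ‹_›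
    have := Ideal.comap_isMaximal_of_surjective _ Ideal.Quotient.mk_surjective
      (K := q.map (Ideal.Quotient.mk I))
    rw [Ideal.comap_map_of_surjective' _ Ideal.Quotient.mk_surjective, sup_eq_left.2 hker] at this
    exact (eq_maximalIdeal this).ge
  obtain ⟨k, hk⟩ := I.exists_radical_pow_le_of_fg (IsNoetherian.noetherian _)
  exact ⟨k, (Ideal.pow_right_mono hrad k).trans hk⟩

end LocalCohomology

/-- If `M` is a nonzero finitely generated `R`-module with `d = dim (R / Ann_R M)`, then the
top local cohomology module `H^d_{mS}(M ⊗_R S)` is Artinian as an `S`-module if and only if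
`dim (S/mS) = 0`. -/
theorem stmt17 (R S : Type u) [CommRing R] [CommRing S] [IsNoetherianRing R] [IsNoetherianRing S]
    [IsLocalRing R] [IsLocalRing S] [Algebra R S] [Module.Flat R S]
    [IsLocalHom (algebraMap R S)]
    (M : Type u) [AddCommGroup M] [Module R M] [Module.Finite R M] [Nontrivial M]
    (d : ℕ) (hd : ringKrullDim (R ⧸ Module.annihilator R M) = d) :
    IsArtinian S
        ((localCohomology ((maximalIdeal R).map (algebraMap R S)) d).obj
          (ModuleCat.of S (S ⊗[R] M))) ↔
      ringKrullDim (S ⧸ (maximalIdeal R).map (algebraMap R S)) = 0 := by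
  have hle : (maximalIdeal R).map (algebraMap R S) ≤ maximalIdeal S :=
    ((local_hom_TFAE (algebraMap R S)).out 0 2).1 ‹_›
  have : Nontrivial (S ⧸ (maximalIdeal R).map (algebraMap R S)) :=
    Ideal.Quotient.nontrivial_iff.2 (ne_top_of_le_ne_top (maximalIdeal.isMaximal S).ne_top hle)
  let e : _ ≃ₗ[S] LocCoh ((maximalIdeal R).map (algebraMap R S)) d (S ⊗[R] M) :=
    localCohomologyEquiv _ d (ModuleCat.of S (S ⊗[R] M))
  rw [e.isArtinian_iff]
  constructor
  · intro h
    obtain ⟨e'⟩ := LocCoh.nonempty_baseChange_equiv S (maximalIdeal R) d M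
    rw [← e'.isArtinian_iff] at h
    have : Nontrivial (LocCoh (maximalIdeal R) d M) :=
      not_subsingleton_iff_nontrivial.1 (LocCoh.not_subsingleton_of_supportDim_eq
        (hd ▸ Module.supportDim_eq_ringKrullDim_quotient_annihilator R M))
    obtain ⟨f, hf⟩ := exists_injective_residueField
      (LocCoh.exists_pow_smul_eq_zero (J := maximalIdeal R) (i := d) (A := M))
    have : IsArtinian S (S ⊗[R] (R ⧸ maximalIdeal R)) :=
      isArtinian_of_injective _ (LocCoh.baseChange_injective S hf)
    have : IsArtinian S (S ⧸ (maximalIdeal R).map (algebraMap R S)) :=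
      (Algebra.TensorProduct.quotIdealMapEquivTensorQuot S
        (maximalIdeal R)).toLinearEquiv.isArtinian_iff.2 this
    have : IsArtinianRing (S ⧸ (maximalIdeal R).map (algebraMap R S)) :=
      isArtinian_of_tower S this
    exact ((Ring.krullDimLE_iff).1 inferInstance).antisymm
      ringKrullDim_nonneg_of_nontrivial
  · intro h
    obtain ⟨k, hk⟩ := exists_maximalIdeal_pow_le_of_ringKrullDim_quotient_eq_zero h
    exact LocCoh.isArtinian hle hk d
end

section
/- Let E be an injective S-module containing an essential copy of the residue field S/n (that is, there is an injective S-linear map ι : S/n → E whose image meets every nonzero S-submodule of E nontrivially). Then for every prime ideal P of S, the annihilator in S of the submodule (0 :_E P) = {x ∈ E : P·x = 0} is exactly P, i.e. Ann_S(0 :_E P) = P. -/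
open IsLocalRing

/-- The powers of a finitely generated ideal with small residue ring have small residue rings. -/
theorem Ideal.small_quotient_pow.{v, u} {R : Type u} [CommRing R] [IsNoetherianRing R] (I : Ideal R)
    [Small.{v} (R ⧸ I)] (k : ℕ) : Small.{v} (R ⧸ I ^ k) := by
  induction k with
  | zero =>
    have : Subsingleton (R ⧸ I ^ 0) := Ideal.Quotient.subsingleton_iff.2 (by simp)
    infer_instance
  | succ k ih =>
    obtain ⟨r, g, hg⟩ := Submodule.fg_iff_exists_fin_generating_family.1
      (IsNoetherian.noetherian (I ^ k))
    refine small_of_surjective (α := (R ⧸ I ^ k) × (Fin r → R ⧸ I))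
      (f := fun p ↦ Ideal.Quotient.mk (I ^ (k + 1)) (p.1.out + ∑ i, (p.2 i).out * g i)) ?_
    intro y
    obtain ⟨x, rfl⟩ := Ideal.Quotient.mk_surjective y
    have out_mk (J : Ideal R) (z : R) : z - (Ideal.Quotient.mk J z).out ∈ J := by
      rw [← Ideal.Quotient.eq]
      exact (Quotient.out_eq _).symm
    obtain ⟨c, hc⟩ := (Submodule.mem_span_range_iff_exists_fun R).1 (hg.ge (out_mk (I ^ k) x))
    refine ⟨(Ideal.Quotient.mk _ x, fun i ↦ Ideal.Quotient.mk _ (c i)), ?_⟩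
    refine (Ideal.Quotient.eq.2 ?_).symm
    have hsum : x - ((Ideal.Quotient.mk (I ^ k) x).out +
        ∑ i, (Ideal.Quotient.mk I (c i)).out * g i) =
        ∑ i, (c i - (Ideal.Quotient.mk I (c i)).out) * g i := by
      simp only [sub_mul, Finset.sum_sub_distrib]
      simp only [smul_eq_mul] at hc
      rw [hc]
      ring
    rw [hsum, pow_succ']
    refine Ideal.sum_mem _ fun i _ ↦ Ideal.mul_mem_mul (out_mk I (c i)) ?_
    rw [← hg]
    exact Submodule.subset_span ⟨i, rfl⟩

/-- A Noetherian local ring is no larger than its residue field, up to universe size. -/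
theorem IsLocalRing.small_of_small_quotient.{v, u} {R : Type u} [CommRing R] [IsNoetherianRing R]
    [IsLocalRing R] [Small.{v} (R ⧸ maximalIdeal R)] : Small.{v} R := by
  have (k : ℕ) : Small.{v} (R ⧸ maximalIdeal R ^ k) := Ideal.small_quotient_pow _ k
  refine small_of_injective (β := ∀ k : ℕ, R ⧸ maximalIdeal R ^ k)
    (f := fun x k ↦ Ideal.Quotient.mk _ x) fun x y hxy ↦ ?_
  rw [← sub_eq_zero, ← Ideal.mem_bot,
    ← Ideal.iInf_pow_eq_bot_of_isLocalRing (maximalIdeal R) Ideal.IsPrime.ne_top',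
    Submodule.mem_iInf]
  exact fun k ↦ Ideal.Quotient.eq.1 (congrFun hxy k)

/-- If `E` is an injective `S`-module containing an essential copy of the residue field `S/n`
of the Noetherian local ring `S`, then for every prime ideal `P` of `S` the annihilator of
`(0 :_E P)` is exactly `P`. -/
theorem stmt18 (S : Type*) [CommRing S] [IsNoetherianRing S] [IsLocalRing S]
    (E : Type*) [AddCommGroup E] [Module S E] (hE : Module.Injective S E)
    (ι : (S ⧸ maximalIdeal S) →ₗ[S] E) (hι : Function.Injective ι)
    (hess : ∀ N : Submodule S E, N ≠ ⊥ → LinearMap.range ι ⊓ N ≠ ⊥)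
    (P : Ideal S) (hP : P.IsPrime) :
    (Submodule.torsionBySet S E ↑P).annihilator = P := by
  have := small_of_injective hι
  have := IsLocalRing.small_of_small_quotient (R := S)
  refine le_antisymm (fun a ha ↦ ?_) fun a ha ↦ Submodule.mem_annihilator.2 fun x hx ↦
    (Submodule.mem_torsionBySet_iff _ x).1 hx ⟨a, ha⟩
  by_contra haP
  have mul_injective : Function.Injective (LinearMap.lsmul S (S ⧸ P) a) := by
    refine (injective_iff_map_eq_zero _).2 fun x hx ↦ ?_
    rw [LinearMap.lsmul_apply, Algebra.smul_def] at hx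
    exact (mul_eq_zero.1 hx).resolve_left fun h ↦ haP (Ideal.Quotient.eq_zero_iff_mem.1 h)
  obtain ⟨h, hh⟩ := Module.Baer.extension_property (Module.Baer.of_injective hE)
    (LinearMap.lsmul S (S ⧸ P) a) mul_injective
    (ι ∘ₗ Submodule.factor (le_maximalIdeal hP.ne_top))
  have h_tors : h 1 ∈ Submodule.torsionBySet S E ↑P := by
    refine (Submodule.mem_torsionBySet_iff _ _).2 fun p ↦ ?_
    rw [← map_smul, Algebra.smul_def, mul_one]
    exact (congrArg h (Ideal.Quotient.eq_zero_iff_mem.2 p.2)).trans (map_zero h)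
  have h_zero := Submodule.mem_annihilator.1 ha _ h_tors
  rw [← map_smul] at h_zero
  have h_one : ι 1 = 0 := (LinearMap.congr_fun hh 1).symm.trans h_zero
  exact one_ne_zero (hι (h_one.trans (map_zero ι).symm))
end
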